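/- Let n ≥ 2 and let K and L be convex bodies in ℝⁿ containing the origin in their interiors. If the Gaussian surface area measures of K and L coincide, i.e. S_{γ_n,K}(η) = S_{γ_n,L}(η) for every Borel set η ⊆ S^{n-1}, and if γ_n(K) ≥ 1/2 and γ_n(L) ≥ 1/2, then K = L. -/

import Mathlib

open MeasureTheory Metric Set Filter
open scoped RealInnerProductSpace Topology Pointwise NNReal ENNReal

noncomputable section

/-- `ℝⁿ` as Euclidean space. -/
abbrev Eu (n : ℕ) := EuclideanSpace ℝ (Fin n)

/-- The Gaussian measure `γₙ(A) = (2π)^{-n/2} ∫_A e^{-|x|²/2} dx`. -/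
def gaussVol (n : ℕ) (A : Set (Eu n)) : ℝ :=
  (Real.sqrt (2 * Real.pi))⁻¹ ^ n * ∫ x in A, Real.exp (-‖x‖ ^ 2 / 2)

/-- A convex body: a compact convex set with nonempty interior. -/
def IsConvexBody {n : ℕ} (K : Set (Eu n)) : Prop :=
  Convex ℝ K ∧ IsCompact K ∧ (interior K).Nonempty

/-- The support function `h_K(v) = max_{y ∈ K} ⟪y, v⟫`. -/
def suppFun {n : ℕ} (K : Set (Eu n)) (v : Eu n) : ℝ :=
  sSup ((fun y => ⟪y, v⟫) '' K)

/-- The Gaussian surface area measure of `K`, as a set function: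
`S_{γₙ,K}(η) = (2π)^{-n/2} ∫_{ν_K⁻¹(η)} e^{-|x|²/2} dH^{n-1}(x)`, where
`ν_K⁻¹(η)` is the set of boundary points of `K` having an outer unit normal in `η`. -/
def gaussSurf (n : ℕ) (K : Set (Eu n)) (η : Set (Eu n)) : ℝ :=
  (Real.sqrt (2 * Real.pi))⁻¹ ^ n *
    ∫ x in {x | x ∈ frontier K ∧ ∃ v ∈ η, ⟪x, v⟫ = suppFun K v},
      Real.exp (-‖x‖ ^ 2 / 2) ∂μH[(n : ℝ) - 1]

open Classical in
/-- (A choice of) Gauss map of `K`: to a boundary point `x` it assigns an outer unit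
normal of `K` at `x` (for a convex body `K`, this is unique for `H^{n-1}`-a.e. `x ∈ ∂K`). -/
def gaussMap {n : ℕ} (K : Set (Eu n)) (x : Eu n) : Eu n :=
  if h : ∃ v : Eu n, ‖v‖ = 1 ∧ ⟪x, v⟫ = suppFun K v then h.choose else 0

/-- The Wulff shape `[g] = {x : x·v ≤ g v for all unit v}`. -/
def wulff {n : ℕ} (g : Eu n → ℝ) : Set (Eu n) :=
  {x | ∀ v : Eu n, ‖v‖ = 1 → ⟪x, v⟫ ≤ g v}

/-- The radial function `ρ_K(u) = max {r : r • u ∈ K}`. -/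
def radialFun {n : ℕ} (K : Set (Eu n)) (u : Eu n) : ℝ :=
  sSup {r : ℝ | r • u ∈ K}

/-- The standard Gaussian distribution function `Φ`. -/
def Phi (x : ℝ) : ℝ :=
  (Real.sqrt (2 * Real.pi))⁻¹ * ∫ t in Iic x, Real.exp (-t ^ 2 / 2)

/-- The inverse `Φ⁻¹` of the standard Gaussian distribution function. -/
def PhiInv : ℝ → ℝ := Function.invFun Phi

section part1

open ProbabilityTheory

/-- standard normal density -/
def ph (x : ℝ) : ℝ := (Real.sqrt (2 * Real.pi))⁻¹ * Real.exp (-x ^ 2 / 2)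

lemma ph_pos (x : ℝ) : 0 < ph x := by unfold ph; positivity

lemma ph_eq_pdf (x : ℝ) : ph x = gaussianPDFReal 0 1 x := by
  simp [ph, gaussianPDFReal_def]

lemma integrable_ph : Integrable ph := by
  have : ph = gaussianPDFReal 0 1 := funext ph_eq_pdf
  rw [this]; exact integrable_gaussianPDFReal 0 1

lemma continuous_ph : Continuous ph := by unfold ph; fun_prop

lemma Phi_eq_int (x : ℝ) : Phi x = ∫ t in Iic x, ph t := by
  unfold Phi ph; rw [integral_const_mul]

lemma Phi_eq_meas (x : ℝ) : Phi x = (gaussianReal 0 1).real (Iic x) := by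
  rw [Phi_eq_int, Measure.real, gaussianReal_apply_eq_integral _ one_ne_zero, ENNReal.toReal_ofReal]
  · simp_rw [ph_eq_pdf]
  · exact setIntegral_nonneg measurableSet_Iic fun x _ => gaussianPDFReal_nonneg _ _ _

lemma Phi_sub (a b : ℝ) : Phi b - Phi a = ∫ t in a..b, ph t := by
  rw [Phi_eq_int, Phi_eq_int, intervalIntegral.integral_Iic_sub_Iic]
  · exact integrable_ph.integrableOn
  · exact integrable_ph.integrableOn

lemma hasDerivAt_Phi (x : ℝ) : HasDerivAt Phi (ph x) x := by
  have h1 : Phi = fun y => Phi 0 + ∫ t in (0:ℝ)..y, ph t := by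
    funext y; rw [← Phi_sub]; ring
  rw [h1]
  apply HasDerivAt.const_add
  exact intervalIntegral.integral_hasDerivAt_right (continuous_ph.intervalIntegrable _ _)
    (continuous_ph.stronglyMeasurableAtFilter _ _) continuous_ph.continuousAt

lemma continuous_Phi : Continuous Phi :=
  continuous_iff_continuousAt.2 fun x => (hasDerivAt_Phi x).continuousAt

lemma strictMono_Phi : StrictMono Phi :=
  strictMono_of_deriv_pos fun x => by rw [(hasDerivAt_Phi x).deriv]; exact ph_pos x

lemma Phi_le_one (x : ℝ) : Phi x ≤ 1 := by
  rw [Phi_eq_meas]; exact measureReal_le_one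

lemma Phi_nonneg (x : ℝ) : 0 ≤ Phi x := by
  rw [Phi_eq_meas]; exact measureReal_nonneg

lemma Phi_pos (x : ℝ) : 0 < Phi x := (Phi_nonneg _).trans_lt (strictMono_Phi (sub_one_lt x))

lemma Phi_lt_one (x : ℝ) : Phi x < 1 := (strictMono_Phi (lt_add_one x)).trans_le (Phi_le_one _)

lemma Phi_neg (x : ℝ) : Phi (-x) = 1 - Phi x := by
  have h := gaussianReal_map_neg (μ := 0) (v := 1)
  have h0 := nullSingletonClass_gaussianReal (μ := 0) (v := 1) one_ne_zero
  rw [neg_zero] at h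
  rw [Phi_eq_meas, Phi_eq_meas, ← probReal_compl_eq_one_sub measurableSet_Iic]
  conv_lhs => rw [← h]
  rw [map_measureReal_apply (by fun_prop) measurableSet_Iic, measureReal_def, measureReal_def]
  congr 1
  have : (fun x : ℝ => -x) ⁻¹' Iic (-x) = Ici x := by ext; simp
  rw [this, compl_Iic]
  exact measure_congr Ioi_ae_eq_Ici.symm

lemma Phi_zero : Phi 0 = 1 / 2 := by
  have := Phi_neg 0
  rw [neg_zero] at this; linarith

lemma tendsto_Phi_atTop : Tendsto Phi atTop (𝓝 1) := by
  have : Phi = fun x => cdf (gaussianReal 0 1) x := by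
    funext x; rw [Phi_eq_meas, cdf_eq_real]
  rw [this]; exact tendsto_cdf_atTop _

lemma tendsto_Phi_atBot : Tendsto Phi atBot (𝓝 0) := by
  have : Phi = fun x => cdf (gaussianReal 0 1) x := by
    funext x; rw [Phi_eq_meas, cdf_eq_real]
  rw [this]; exact tendsto_cdf_atBot _

lemma exists_Phi_eq {p : ℝ} (h0 : 0 < p) (h1 : p < 1) : ∃ x, Phi x = p := by
  obtain ⟨a, ha⟩ := (tendsto_Phi_atBot.eventually_lt_const h0).exists
  obtain ⟨b, hb⟩ := (tendsto_Phi_atTop.eventually_const_lt h1).exists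
  obtain ⟨x, hx⟩ := mem_range_of_exists_le_of_exists_ge continuous_Phi ⟨a, ha.le⟩ ⟨b, hb.le⟩
  exact ⟨x, hx⟩

lemma Phi_PhiInv {p : ℝ} (h0 : 0 < p) (h1 : p < 1) : Phi (PhiInv p) = p :=
  Function.invFun_eq (exists_Phi_eq h0 h1)

lemma PhiInv_Phi (x : ℝ) : PhiInv (Phi x) = x :=
  Function.leftInverse_invFun strictMono_Phi.injective x

lemma continuousAt_PhiInv {p : ℝ} (h0 : 0 < p) (h1 : p < 1) : ContinuousAt PhiInv p := by
  have hs : StrictMonoOn PhiInv (Ioo 0 1) := by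
    intro a ha b hb hab
    rw [← Phi_PhiInv ha.1 ha.2, ← Phi_PhiInv hb.1 hb.2] at hab
    exact strictMono_Phi.lt_iff_lt.1 hab
  refine hs.continuousAt_of_image_mem_nhds (Ioo_mem_nhds h0 h1) ?_
  have : PhiInv '' Ioo 0 1 = univ := by
    refine eq_univ_of_forall fun x => ⟨Phi x, ⟨Phi_pos x, Phi_lt_one x⟩, PhiInv_Phi x⟩
  rw [this]; exact univ_mem

lemma hasDerivAt_PhiInv {p : ℝ} (h0 : 0 < p) (h1 : p < 1) :
    HasDerivAt PhiInv (ph (PhiInv p))⁻¹ p := by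
  refine HasDerivAt.of_local_left_inverse (f := Phi) (continuousAt_PhiInv h0 h1) (hasDerivAt_Phi _)
    (ph_pos _).ne' ?_
  filter_upwards [Ioo_mem_nhds h0 h1] with y hy using Phi_PhiInv hy.1 hy.2

lemma hasDerivAt_ph (x : ℝ) : HasDerivAt ph (-x * ph x) x := by
  unfold ph
  have h : HasDerivAt (fun x : ℝ => -x ^ 2 / 2) (-x) x := by
    have := ((hasDerivAt_pow 2 x).neg.div_const 2)
    refine this.congr_deriv ?_; simp; ring
  have := (h.exp.const_mul (Real.sqrt (2 * Real.pi))⁻¹)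
  refine this.congr_deriv ?_; ring

lemma tendsto_ph_atTop : Tendsto ph atTop (𝓝 0) := by
  unfold ph
  rw [← mul_zero (Real.sqrt (2 * Real.pi))⁻¹]
  refine Tendsto.const_mul _ (Real.tendsto_exp_atBot.comp ?_)
  have : Tendsto (fun x : ℝ => x ^ 2 / 2) atTop atTop :=
    (tendsto_pow_atTop two_ne_zero).atTop_div_const two_pos
  simp_rw [neg_div]
  exact tendsto_neg_atTop_atBot.comp this

/-- tail -/
def Ps (x : ℝ) : ℝ := 1 - Phi x

lemma Ps_pos (x : ℝ) : 0 < Ps x := by unfold Ps; linarith [Phi_lt_one x]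
lemma hasDerivAt_Ps (x : ℝ) : HasDerivAt Ps (-ph x) x := (hasDerivAt_Phi x).const_sub 1
lemma tendsto_Ps_atTop : Tendsto Ps atTop (𝓝 0) := by
  have := tendsto_Phi_atTop.const_sub 1
  rw [sub_self] at this
  exact this

/-- a function on `(0,∞)` with nonpositive derivative tending to 0 is nonnegative -/
lemma nonneg_of_deriv_nonpos {f f' : ℝ → ℝ} (hf : ∀ x, 0 < x → HasDerivAt f (f' x) x)
    (hf' : ∀ x, 0 < x → f' x ≤ 0) (hl : Tendsto f atTop (𝓝 0)) {x : ℝ} (hx : 0 < x) : 0 ≤ f x := by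
  have anti : AntitoneOn f (Ioi 0) := by
    apply antitoneOn_of_deriv_nonpos (convex_Ioi 0)
    · exact fun y hy => (hf y hy).continuousAt.continuousWithinAt
    · intro y hy; rw [interior_Ioi] at hy; exact (hf y hy).differentiableAt.differentiableWithinAt
    · intro y hy; rw [interior_Ioi] at hy; rw [(hf y hy).deriv]; exact hf' y hy
  refine le_of_tendsto hl ?_
  filter_upwards [eventually_ge_atTop x] with y hy
  exact anti hx (hx.trans_le hy) hy

lemma mills_upper {x : ℝ} (hx : 0 < x) : x * Ps x ≤ ph x := by
  have := nonneg_of_deriv_nonpos (f := fun x => ph x / x - Ps x) (f' := fun x => - ph x / x ^ 2)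
    (fun x hx => by
      have := ((hasDerivAt_ph x).div (hasDerivAt_id x) hx.ne').sub (hasDerivAt_Ps x)
      refine this.congr_deriv ?_
      simp; field_simp; ring)
    (fun x hx => by
      have := ph_pos x
      rw [neg_div]; simp; positivity)
    (by
      have h1 := tendsto_ph_atTop.div_atTop tendsto_id
      simpa using h1.sub tendsto_Ps_atTop) hx
  simp only [sub_nonneg] at this
  rw [le_div_iff₀ hx] at this; linarith

lemma mills_lower {x : ℝ} (hx : 0 < x) : x * ph x ≤ (x ^ 2 + 1) * Ps x := by
  have := nonneg_of_deriv_nonpos (f := fun x => Ps x - ph x * (x / (x ^ 2 + 1)))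
    (f' := fun x => - (2 * ph x) / (x ^ 2 + 1) ^ 2)
    (fun x hx => by
      have h0 : x ^ 2 + 1 ≠ 0 := by positivity
      have := (hasDerivAt_Ps x).sub ((hasDerivAt_ph x).mul
        ((hasDerivAt_id x).div ((hasDerivAt_pow 2 x).add_const 1) h0))
      refine this.congr_deriv ?_
      simp; field_simp; ring)
    (fun x hx => by
      have := ph_pos x
      rw [neg_div]; simp; positivity)
    (by
      have h1 : Tendsto (fun x : ℝ => ph x * (x / (x ^ 2 + 1))) atTop (𝓝 0) := by
        refine squeeze_zero' ?_ ?_ tendsto_ph_atTop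
        · filter_upwards [eventually_ge_atTop 0] with x hx
          have := ph_pos x
          positivity
        · filter_upwards [eventually_ge_atTop 0] with x hx
          have := ph_pos x
          have h2 : x / (x ^ 2 + 1) ≤ 1 := by
            rw [div_le_one (by positivity)]; nlinarith [sq_nonneg (x - 1)]
          nlinarith
      simpa using tendsto_Ps_atTop.sub h1) hx
  simp only [sub_nonneg] at this
  rw [← mul_div_assoc, div_le_iff₀ (by positivity)] at this; linarith

/-- `φ(x)/x` is superadditive in terms of the tail. -/
lemma mills_superadd {x y z : ℝ} (hx : 0 < x) (h : Ps x = Ps y + Ps z) :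
    ph y / y + ph z / z ≤ ph x / x := by
  have anti : AntitoneOn (fun x => ph x / (x * Ps x)) (Ioi 0) := by
    have hd : ∀ x : ℝ, 0 < x → HasDerivAt (fun x => ph x / (x * Ps x))
        (ph x * (x * ph x - (x ^ 2 + 1) * Ps x) / (x * Ps x) ^ 2) x := by
      intro x hx
      have h0 := Ps_pos x
      have := (hasDerivAt_ph x).div ((hasDerivAt_id x).mul (hasDerivAt_Ps x))
        (by simp; exact ⟨hx.ne', h0.ne'⟩)
      refine this.congr_deriv ?_
      simp; ring
    apply antitoneOn_of_deriv_nonpos (convex_Ioi 0)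
    · exact fun y hy => (hd y hy).continuousAt.continuousWithinAt
    · intro y hy; rw [interior_Ioi] at hy; exact (hd y hy).differentiableAt.differentiableWithinAt
    · intro y hy; rw [interior_Ioi] at hy; rw [(hd y hy).deriv]
      have := mills_lower hy
      have := ph_pos y
      apply div_nonpos_of_nonpos_of_nonneg _ (by positivity)
      nlinarith
  have hPs : StrictAnti Ps := fun a b hab => by unfold Ps; linarith [strictMono_Phi hab]
  have hxy : x ≤ y := by
    rw [← hPs.le_iff_ge]; linarith [Ps_pos z]
  have hxz : x ≤ z := by
    rw [← hPs.le_iff_ge]; linarith [Ps_pos y]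
  have e : ∀ w, 0 < w → ph w / w = Ps w * (ph w / (w * Ps w)) := fun w hw => by
    have := Ps_pos w; field_simp
  have hy := anti hx (hx.trans_le hxy : y ∈ Ioi 0) hxy
  have hz := anti hx (hx.trans_le hxz : z ∈ Ioi 0) hxz
  simp only at hy hz
  rw [e x hx, e y (hx.trans_le hxy), e z (hx.trans_le hxz)]
  calc _ ≤ Ps y * (ph x / (x * Ps x)) + Ps z * (ph x / (x * Ps x)) := by
        have := Ps_pos y; have := Ps_pos z; gcongr
    _ = _ := by rw [h]; ring

end part1

section part2

open ProbabilityTheory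

lemma quad_aux {s b A b' A' : ℝ} (h : Phi s = Phi b + Phi A - 1) :
    s * ((ph b * b' + ph A * A') / ph s) ^ 2 ≤
      (ph b / ph s) * b * b' ^ 2 + (ph A / ph s) * A * A' ^ 2 := by
  have hpb := ph_pos b
  have hpA := ph_pos A
  have hps := ph_pos s
  have e : (ph b * b' + ph A * A') / ph s = (ph b / ph s) * b' + (ph A / ph s) * A' := by ring
  rw [e]
  set p := ph b / ph s with hp
  set q := ph A / ph s with hq
  have p0 : 0 < p := by positivity
  have q0 : 0 < q := by positivity
  have key : ∀ (b A s b' A' : ℝ), b < 0 → Phi s = Phi b + Phi A - 1 →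
      s * ((ph b / ph s) * b' + (ph A / ph s) * A') ^ 2 ≤
      (ph b / ph s) * b * b' ^ 2 + (ph A / ph s) * A * A' ^ 2 := by
    clear * -
    intro b A s b' A' hb h
    have hpb := ph_pos b
    have hpA := ph_pos A
    have hps := ph_pos s
    have hsb : s < b := by
      rw [← strictMono_Phi.lt_iff_lt]; linarith [Phi_lt_one A]
    have hA : 0 < A := by
      rw [← strictMono_Phi.lt_iff_lt, Phi_zero]
      have := strictMono_Phi hb
      rw [Phi_zero] at this
      linarith [Phi_pos s]
    have phn : ∀ x, ph (-x) = ph x := fun x => by simp [ph]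
    have m := mills_superadd (x := -b) (y := -s) (z := A) (by linarith) (by
      unfold Ps; rw [Phi_neg, Phi_neg]; linarith)
    rw [phn, phn] at m
    set p := ph b / ph s with hp
    set q := ph A / ph s with hq
    have p0 : 0 < p := by positivity
    have q0 : 0 < q := by positivity
    set β := -b with hβ
    set σ := -s with hσ
    have β0 : 0 < β := by linarith
    have σ0 : 0 < σ := by linarith
    have m' : 1 / σ + q / A ≤ p / β := by
      have := div_le_div_of_nonneg_right m hps.le
      calc _ = (ph s / σ + ph A / A) / ph s := by rw [hq]; field_simp
        _ ≤ _ := this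
        _ = _ := by rw [hp]; field_simp
    set Y := p * b' + q * A' with hY
    have cs : (Y - q * A') ^ 2 ≤ (1 / σ + q / A) * (σ * Y ^ 2 + q * A * A' ^ 2) := by
      have : (1 / σ + q / A) * (σ * Y ^ 2 + q * A * A' ^ 2) - (Y - q * A') ^ 2 =
        q / (σ * A) * (σ * Y + A * A') ^ 2 := by field_simp; ring
      have h2 : 0 ≤ q / (σ * A) * (σ * Y + A * A') ^ 2 := by positivity
      linarith
    have r0 : 0 ≤ σ * Y ^ 2 + q * A * A' ^ 2 := by positivity
    have c2 : (p * b') ^ 2 ≤ (p / β) * (σ * Y ^ 2 + q * A * A' ^ 2) := by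
      have : Y - q * A' = p * b' := by rw [hY]; ring
      rw [← this]
      exact cs.trans (mul_le_mul_of_nonneg_right m' r0)
    have c3 : p * β * b' ^ 2 ≤ σ * Y ^ 2 + q * A * A' ^ 2 := by
      have := mul_le_mul_of_nonneg_left c2 (by positivity : 0 ≤ β / p)
      have e1 : β / p * (p * b') ^ 2 = p * β * b' ^ 2 := by field_simp
      have e2 : β / p * (p / β * (σ * Y ^ 2 + q * A * A' ^ 2)) = σ * Y ^ 2 + q * A * A' ^ 2 := by
        field_simp
      rwa [e1, e2] at this
    have e3 : s = -σ := by simp [hσ]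
    have e4 : b = -β := by simp [hβ]
    rw [e3, e4]; nlinarith
  rcases lt_or_ge b 0 with hb | hb
  · exact key b A s b' A' hb h
  rcases lt_or_ge A 0 with hA | hA
  · have := key A b s A' b' hA (by linarith)
    rw [add_comm (p * b'), add_comm (p * b * b' ^ 2)]; exact this
  rcases le_or_gt s 0 with hs | hs
  · have h1 : 0 ≤ p * b * b' ^ 2 + q * A * A' ^ 2 := by positivity
    have h2 : s * (p * b' + q * A') ^ 2 ≤ 0 := mul_nonpos_of_nonpos_of_nonneg hs (sq_nonneg _)
    linarith
  have m := mills_superadd (x := s) (y := b) (z := A) hs (by unfold Ps; linarith)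
  have hb' : s < b := by rw [← strictMono_Phi.lt_iff_lt]; linarith [Phi_lt_one A]
  have hA' : s < A := by rw [← strictMono_Phi.lt_iff_lt]; linarith [Phi_lt_one b]
  have b0 : 0 < b := by linarith
  have A0 : 0 < A := by linarith
  have m' : s * (p / b + q / A) ≤ 1 := by
    calc s * (p / b + q / A) = (ph b / b + ph A / A) * (s / ph s) := by rw [hp, hq]; ring
      _ ≤ ph s / s * (s / ph s) := by gcongr
      _ = 1 := by field_simp
  have cs : (p * b' + q * A') ^ 2 ≤ (p / b + q / A) * (p * b * b' ^ 2 + q * A * A' ^ 2) := by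
    have : (p / b + q / A) * (p * b * b' ^ 2 + q * A * A' ^ 2) - (p * b' + q * A') ^ 2 =
      p * q / (b * A) * (A * A' - b * b') ^ 2 := by field_simp; ring
    have h2 : 0 ≤ p * q / (b * A) * (A * A' - b * b') ^ 2 := by positivity
    linarith
  have r0 : 0 ≤ p * b * b' ^ 2 + q * A * A' ^ 2 := by positivity
  calc _ ≤ s * ((p / b + q / A) * (p * b * b' ^ 2 + q * A * A' ^ 2)) := by gcongr
    _ = (s * (p / b + q / A)) * (p * b * b' ^ 2 + q * A * A' ^ 2) := by ring
    _ ≤ 1 * (p * b * b' ^ 2 + q * A * A' ^ 2) := by gcongr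
    _ = _ := one_mul _

/-- One-dimensional Ehrhard inequality for bounded intervals. -/
lemma ehr1_fin {a₀ b₀ a₁ b₁ s₀ s₁ u v : ℝ} (h0 : a₀ < b₀) (h1 : a₁ < b₁)
    (hs0 : Phi s₀ = Phi b₀ - Phi a₀) (hs1 : Phi s₁ = Phi b₁ - Phi a₁)
    (hu : 0 ≤ u) (hv : 0 ≤ v) (huv : u + v = 1) :
    Phi (u * s₀ + v * s₁) ≤ Phi (u * b₀ + v * b₁) - Phi (u * a₀ + v * a₁) := by
  set b' := b₁ - b₀ with hb'
  set A' := -a₁ + a₀ with hA'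
  let b : ℝ → ℝ := fun t => b₀ + t * b'
  let A : ℝ → ℝ := fun t => -a₀ + t * A'
  let F : ℝ → ℝ := fun t => Phi (b t) + Phi (A t) - 1
  have hF : ∀ t, F t = Phi (b t) - Phi (-A t) := fun t => by
    simp only [F]; rw [Phi_neg]; ring
  have hF0 : ∀ t ∈ Icc (0:ℝ) 1, 0 < F t := by
    intro t ht
    rw [hF, sub_pos]
    apply strictMono_Phi
    simp only [A, b, hb', hA']
    have h2 : a₀ * (1 - t) + a₁ * t < b₀ * (1 - t) + b₁ * t := by
      rcases eq_or_lt_of_le ht.1 with h | h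
      · rw [← h]; linarith
      · nlinarith [ht.2]
    linarith
  have hF1 : ∀ t, F t < 1 := fun t => by
    simp only [F]; linarith [Phi_lt_one (b t), Phi_lt_one (A t)]
  let s : ℝ → ℝ := fun t => PhiInv (F t)
  have hs : ∀ t ∈ Icc (0:ℝ) 1, Phi (s t) = F t := fun t ht => Phi_PhiInv (hF0 t ht) (hF1 t)
  have hdb : ∀ t, HasDerivAt b b' t := fun t => by
    have := ((hasDerivAt_id t).mul_const b').const_add b₀
    exact this.congr_deriv (one_mul _)
  have hdA : ∀ t, HasDerivAt A A' t := fun t => by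
    have := ((hasDerivAt_id t).mul_const A').const_add (-a₀)
    exact this.congr_deriv (one_mul _)
  have hdF : ∀ t, HasDerivAt F (ph (b t) * b' + ph (A t) * A') t := fun t =>
    (((hasDerivAt_Phi _).comp t (hdb t)).add ((hasDerivAt_Phi _).comp t (hdA t))).sub_const 1
  let s' : ℝ → ℝ := fun t => (ph (b t) * b' + ph (A t) * A') / ph (s t)
  have hds : ∀ t ∈ Icc (0:ℝ) 1, HasDerivAt s (s' t) t := fun t ht => by
    have := (hasDerivAt_PhiInv (hF0 t ht) (hF1 t)).comp t (hdF t)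
    refine this.congr_deriv ?_
    simp only [s', s]; ring
  let s'' : ℝ → ℝ := fun t => s t * s' t ^ 2 - ((ph (b t) / ph (s t)) * b t * b' ^ 2 +
    (ph (A t) / ph (s t)) * A t * A' ^ 2)
  have hds' : ∀ t ∈ Icc (0:ℝ) 1, HasDerivAt s' (s'' t) t := fun t ht => by
    have := ((((hasDerivAt_ph _).comp t (hdb t)).mul_const b').add
      (((hasDerivAt_ph _).comp t (hdA t)).mul_const A')).div
      ((hasDerivAt_ph _).comp t (hds t ht)) (ph_pos (s t)).ne'
    refine this.congr_deriv ?_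
    have := (ph_pos (s t)).ne'
    simp only [s'', s', Function.comp, Pi.add_apply]
    field_simp
    ring
  have conc : ConcaveOn ℝ (Icc 0 1) s := by
    apply concaveOn_of_hasDerivWithinAt2_nonpos (convex_Icc 0 1) (f' := s') (f'' := s'')
    · exact fun t ht => (hds t ht).continuousAt.continuousWithinAt
    · exact fun t ht => (hds t (interior_subset ht)).hasDerivWithinAt
    · exact fun t ht => (hds' t (interior_subset ht)).hasDerivWithinAt
    · intro t ht
      have := quad_aux (b' := b') (A' := A') (hs t (interior_subset ht))
      simp only [s'', s']; linarith
  have c := conc.2 (x := 0) (y := 1) (by simp) (by simp) hu hv huv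
  simp only [smul_eq_mul, mul_zero, mul_one, zero_add] at c
  have e0 : s 0 = s₀ := by
    apply strictMono_Phi.injective
    rw [hs 0 (by simp), hF, hs0]; simp [b, A]
  have e1 : s 1 = s₁ := by
    apply strictMono_Phi.injective
    rw [hs 1 (by simp), hF, hs1]; simp [b, A, hb', hA']
  rw [e0, e1] at c
  have hvI : v ∈ Icc (0:ℝ) 1 := ⟨hv, by linarith⟩
  calc _ ≤ Phi (s v) := strictMono_Phi.monotone c
    _ = _ := by
      rw [hs v hvI, hF]
      simp only [b, A, hb', hA']
      obtain rfl : u = 1 - v := by linarith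
      congr 2 <;> ring

/-- One-dimensional Ehrhard inequality for convex sets. -/
lemma ehr1 {I J C : Set ℝ} (hI : Convex ℝ I) (hJ : Convex ℝ J) {u v r s : ℝ}
    (hu : 0 ≤ u) (hv : 0 ≤ v) (huv : u + v = 1)
    (hC : ∀ x ∈ I, ∀ y ∈ J, u * x + v * y ∈ C)
    (hr : Phi r ≤ (gaussianReal 0 1).real I) (hs : Phi s ≤ (gaussianReal 0 1).real J) :
    Phi (u * r + v * s) ≤ (gaussianReal 0 1).real C := by
  have n0 := nullSingletonClass_gaussianReal (μ := 0) (v := 1) one_ne_zero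
  have main : ∀ (I : Set ℝ), Convex ℝ I → ∀ r r', r' < r → Phi r ≤ (gaussianReal 0 1).real I →
      ∃ a b s, a < b ∧ Icc a b ⊆ I ∧ r' ≤ s ∧ Phi s = Phi b - Phi a := by
    intro I hI r r' hr' hr
    have hm : MeasurableSet I := hI.ordConnected.measurableSet
    have : ENNReal.ofReal (Phi r') < gaussianReal 0 1 I := by
      rw [ENNReal.ofReal_lt_iff_lt_toReal (Phi_nonneg _) (measure_ne_top _ _)]
      exact (strictMono_Phi hr').trans_le hr
    obtain ⟨Q, hQI, hQ, hQr⟩ := hm.exists_lt_isCompact this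
    have hne : Q.Nonempty := by
      rw [nonempty_iff_ne_empty]; rintro rfl; simp at hQr
    have hsub : Q ⊆ Icc (sInf Q) (sSup Q) := fun x hx =>
      ⟨csInf_le hQ.bddBelow hx, le_csSup hQ.bddAbove hx⟩
    have hab : sInf Q ≤ sSup Q := (hsub hne.some_mem).1.trans (hsub hne.some_mem).2
    have hval : (gaussianReal 0 1).real (Icc (sInf Q) (sSup Q)) = Phi (sSup Q) - Phi (sInf Q) := by
      rw [Phi_eq_meas, Phi_eq_meas, ← measureReal_sdiff (Iic_subset_Iic.2 hab) measurableSet_Iic,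
        Iic_sdiff_Iic, measureReal_congr Ioc_ae_eq_Icc]
    have hlt : Phi r' < Phi (sSup Q) - Phi (sInf Q) := by
      rw [← hval]
      rw [ENNReal.ofReal_lt_iff_lt_toReal (Phi_nonneg _) (measure_ne_top _ _)] at hQr
      exact hQr.trans_le (measureReal_mono hsub)
    obtain ⟨s, hs⟩ := exists_Phi_eq (p := Phi (sSup Q) - Phi (sInf Q))
      ((Phi_nonneg _).trans_lt hlt) (by linarith [Phi_lt_one (sSup Q), Phi_pos (sInf Q)])
    refine ⟨sInf Q, sSup Q, s, ?_, hI.ordConnected.out (hQI (hQ.sInf_mem hne)) (hQI (hQ.sSup_mem hne)),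
      ?_, hs⟩
    · rw [← strictMono_Phi.lt_iff_lt]; linarith [Phi_nonneg r']
    · rw [← strictMono_Phi.le_iff_le]; linarith
  have step : ∀ ε > 0, Phi (u * r + v * s - ε) ≤ (gaussianReal 0 1).real C := by
    intro ε hε
    obtain ⟨a₀, b₀, s₀, h0, hI0, hr0, hs0⟩ := main I hI r (r - ε) (by linarith) hr
    obtain ⟨a₁, b₁, s₁, h1, hI1, hr1, hs1⟩ := main J hJ s (s - ε) (by linarith) hs
    have e := ehr1_fin h0 h1 hs0 hs1 hu hv huv
    have hab : u * a₀ + v * a₁ ≤ u * b₀ + v * b₁ := by gcongr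
    have hval : (gaussianReal 0 1).real (Icc (u * a₀ + v * a₁) (u * b₀ + v * b₁)) =
        Phi (u * b₀ + v * b₁) - Phi (u * a₀ + v * a₁) := by
      rw [Phi_eq_meas, Phi_eq_meas, ← measureReal_sdiff (Iic_subset_Iic.2 hab) measurableSet_Iic,
        Iic_sdiff_Iic, measureReal_congr Ioc_ae_eq_Icc]
    have hsub : Icc (u * a₀ + v * a₁) (u * b₀ + v * b₁) ⊆ C := by
      intro z hz
      set ca := u * a₀ + v * a₁ with hca
      set cb := u * b₀ + v * b₁ with hcb
      have hlt : ca < cb := by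
        rcases eq_or_lt_of_le hu with h | h
        · have : v = 1 := by linarith
          rw [hca, hcb, ← h, this]; linarith
        · nlinarith
      have hth0 : 0 ≤ (z - ca) / (cb - ca) := div_nonneg (by linarith [hz.1]) (by linarith)
      have hth1 : (z - ca) / (cb - ca) ≤ 1 := by rw [div_le_one (by linarith)]; linarith [hz.2]
      set θ := (z - ca) / (cb - ca) with hθ
      have hz' : z = ca + θ * (cb - ca) := by
        rw [hθ, div_mul_cancel₀ _ (by linarith : (cb - ca) ≠ 0).symm.symm]; ring
      have hx : a₀ + θ * (b₀ - a₀) ∈ Icc a₀ b₀ := ⟨by nlinarith, by nlinarith⟩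
      have hy : a₁ + θ * (b₁ - a₁) ∈ Icc a₁ b₁ := ⟨by nlinarith, by nlinarith⟩
      have := hC _ (hI0 hx) _ (hI1 hy)
      have e : u * (a₀ + θ * (b₀ - a₀)) + v * (a₁ + θ * (b₁ - a₁)) = z := by
        rw [hz', hca, hcb]; ring
      rwa [e] at this
    calc _ ≤ Phi (u * s₀ + v * s₁) := by
          apply strictMono_Phi.monotone
          have e2 : u * r + v * s - ε = u * (r - ε) + v * (s - ε) := by
            obtain rfl : u = 1 - v := by linarith
            ring
          rw [e2]; gcongr
      _ ≤ _ := e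
      _ = _ := hval.symm
      _ ≤ _ := measureReal_mono hsub
  have lim : Tendsto (fun ε => Phi (u * r + v * s - ε)) (𝓝[>] 0) (𝓝 (Phi (u * r + v * s))) := by
    have : Continuous (fun ε => Phi (u * r + v * s - ε)) := continuous_Phi.comp (by fun_prop)
    have h := this.tendsto 0
    simp only [sub_zero] at h
    exact h.mono_left nhdsWithin_le_nhds
  exact le_of_tendsto lim (by filter_upwards [self_mem_nhdsWithin] with ε hε using step ε hε)

lemma Phi_logconcave (r s : ℝ) : Phi r * Phi s ≤ Phi ((r + s) / 2) ^ 2 := by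
  have anti : Antitone (fun x => ph x / Phi x) := by
    have hd : ∀ x : ℝ, HasDerivAt (fun x => ph x / Phi x)
        (- ph x * (x * Phi x + ph x) / Phi x ^ 2) x := by
      intro x
      have := (hasDerivAt_ph x).div (hasDerivAt_Phi x) (Phi_pos x).ne'
      refine this.congr_deriv ?_
      ring
    apply antitone_of_deriv_nonpos (fun x => (hd x).differentiableAt)
    intro x
    rw [(hd x).deriv]
    have h1 := ph_pos x
    have h2 : 0 ≤ x * Phi x + ph x := by
      rcases le_or_gt 0 x with h | h
      · have := Phi_pos x; positivity
      · have := mills_upper (x := -x) (by linarith)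
        unfold Ps at this
        rw [Phi_neg] at this
        have e : ph (-x) = ph x := by simp [ph]
        rw [e] at this; linarith
    apply div_nonpos_of_nonpos_of_nonneg _ (by positivity)
    nlinarith
  have hd : ∀ x, HasDerivAt (fun x => Real.log (Phi x)) (ph x / Phi x) x := fun x =>
    (hasDerivAt_Phi x).log (Phi_pos x).ne'
  have conc : ConcaveOn ℝ univ (fun x => Real.log (Phi x)) := by
    apply Antitone.concaveOn_univ_of_deriv (fun x => (hd x).differentiableAt)
    have : deriv (fun x => Real.log (Phi x)) = fun x => ph x / Phi x := funext fun x => (hd x).deriv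
    rw [this]; exact anti
  have c := conc.2 (mem_univ r) (mem_univ s) (show (0:ℝ) ≤ 1/2 by norm_num) (show (0:ℝ) ≤ 1/2 by norm_num)
    (by norm_num)
  simp only [smul_eq_mul] at c
  have e : 1 / 2 * r + 1 / 2 * s = (r + s) / 2 := by ring
  rw [e] at c
  rw [← Real.log_le_log_iff (mul_pos (Phi_pos _) (Phi_pos _)) (pow_pos (Phi_pos _) _),
    Real.log_mul (Phi_pos _).ne' (Phi_pos _).ne', Real.log_pow]
  push_cast; linarith

lemma Phi_strictConcave : StrictConcaveOn ℝ (Ici 0) Phi := by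
  apply strictConcaveOn_of_deriv2_neg (convex_Ici 0) continuous_Phi.continuousOn
  intro x hx
  rw [interior_Ici] at hx
  have : deriv Phi = ph := funext fun x => (hasDerivAt_Phi x).deriv
  simp only [Function.iterate_succ, Function.iterate_zero, Function.comp, id]
  rw [this, (hasDerivAt_ph x).deriv]
  have := mul_pos (mem_Ioi.1 hx) (ph_pos x)
  linarith

end part2

section part3

open ProbabilityTheory

/-- The Gaussian density on `ℝⁿ`. -/
def gd (n : ℕ) (x : Eu n) : ℝ := (Real.sqrt (2 * Real.pi))⁻¹ ^ n * Real.exp (-‖x‖ ^ 2 / 2)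

/-- The Gaussian measure on `ℝⁿ` as a measure. -/
def gam (n : ℕ) : Measure (Eu n) := volume.withDensity (fun x => ENNReal.ofReal (gd n x))

variable {n : ℕ}

lemma gd_pos (x : Eu n) : 0 < gd n x := by unfold gd; positivity

lemma continuous_gd : Continuous (gd n) := by unfold gd; fun_prop

lemma integrable_gexp : Integrable (fun x : Eu n => Real.exp (-‖x‖ ^ 2 / 2)) := by
  have h := GaussianFourier.integrable_cexp_neg_mul_sq_norm_add (V := Eu n) (b := 1/2)
    (by norm_num) 0 0
  have := h.norm
  refine this.congr (Eventually.of_forall fun x => ?_)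
  simp only [Complex.norm_exp]
  congr 1
  simp [← Complex.ofReal_pow]
  norm_num
  ring

lemma integrable_gd : Integrable (gd n) := integrable_gexp.const_mul _

lemma gconst : (Real.sqrt (2 * Real.pi))⁻¹ ^ n * (2 * Real.pi) ^ (n / 2 : ℝ) = 1 := by
  rw [Real.sqrt_eq_rpow, ← Real.rpow_neg (by positivity), ← Real.rpow_natCast,
    ← Real.rpow_mul (by positivity), ← Real.rpow_add (by positivity)]
  have : -(1 / 2) * (n:ℝ) + n / 2 = 0 := by ring
  rw [this, Real.rpow_zero]

lemma charFun_gam (t : Eu n) : charFun (gam n) t = Complex.exp (- ‖t‖ ^ 2 / 2) := by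
  rw [charFun_apply, gam, integral_withDensity_eq_integral_toReal_smul (by
    exact (continuous_gd.measurable.ennreal_ofReal)) (by simp)]
  have h := GaussianFourier.integral_cexp_neg_mul_sq_norm_add (V := Eu n) (b := 1/2)
    (by norm_num) Complex.I t
  have e : ∀ x : Eu n, (ENNReal.ofReal (gd n x)).toReal • Complex.exp (⟪x, t⟫ * Complex.I) =
      (((Real.sqrt (2 * Real.pi))⁻¹ ^ n : ℝ) : ℂ) *
        Complex.exp (-(1/2) * ‖x‖ ^ 2 + Complex.I * ⟪t, x⟫) := by
    intro x
    rw [ENNReal.toReal_ofReal (gd_pos x).le, gd, Complex.real_smul, Complex.ofReal_mul, mul_assoc,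
      Complex.ofReal_exp, ← Complex.exp_add, real_inner_comm]
    congr 2
    push_cast; ring
  simp_rw [e]
  rw [integral_const_mul, h, ← mul_assoc]
  have c : (((Real.sqrt (2 * Real.pi))⁻¹ ^ n : ℝ) : ℂ) *
      (Real.pi / (1/2)) ^ (Module.finrank ℝ (Eu n) / 2 : ℂ) = 1 := by
    have e2 : ((Real.pi : ℂ) / (1/2)) = ((2 * Real.pi : ℝ) : ℂ) := by push_cast; ring
    have e3 : (Module.finrank ℝ (Eu n) / 2 : ℂ) = ((n / 2 : ℝ) : ℂ) := by simp
    rw [e2, e3, ← Complex.ofReal_cpow (by positivity), ← Complex.ofReal_mul, gconst]; simp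
  rw [c, one_mul]
  congr 1
  rw [Complex.I_sq]; ring

instance : IsFiniteMeasure (gam n) :=
  isFiniteMeasure_withDensity_ofReal integrable_gd.2

lemma gam_eq_std : gam n = stdGaussian (Eu n) := by
  apply Measure.ext_of_charFun
  ext t
  rw [charFun_gam, charFun_stdGaussian]

instance : IsProbabilityMeasure (gam n) := by
  rw [gam_eq_std]; infer_instance

lemma gaussVol_eq {A : Set (Eu n)} (hA : MeasurableSet A) : gaussVol n A = (gam n).real A := by
  rw [gaussVol, ← integral_const_mul, Measure.real, gam, withDensity_apply _ hA]
  change ∫ a in A, gd n a = _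
  rw [integral_eq_lintegral_of_nonneg_ae (Eventually.of_forall fun x => (gd_pos x).le)
      continuous_gd.aestronglyMeasurable]

lemma gam_ac : gam n ≪ volume := withDensity_absolutelyContinuous _ _

lemma ac_gam : volume ≪ gam n := by
  apply withDensity_absolutelyContinuous' continuous_gd.measurable.ennreal_ofReal.aemeasurable
  exact Eventually.of_forall fun x => by simpa using gd_pos x

/-- Replace the `e`-component of `x` by `s`. -/
def repl (e x : Eu n) (s : ℝ) : Eu n := x - ⟪x, e⟫ • e + s • e

lemma continuous_repl (e : Eu n) : Continuous (fun p : Eu n × ℝ => repl e p.1 p.2) := by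
  unfold repl; fun_prop

lemma map_repl {e : Eu n} (he : ‖e‖ = 1) :
    ((gam n).prod (gaussianReal 0 1)).map (fun p : Eu n × ℝ => repl e p.1 p.2) = gam n := by
  apply Measure.ext_of_charFun
  ext t
  rw [charFun_apply, integral_map (continuous_repl e).measurable.aemeasurable
    (Continuous.aestronglyMeasurable (by fun_prop))]
  have e1 : ∀ p : Eu n × ℝ, Complex.exp (⟪repl e p.1 p.2, t⟫ * Complex.I) =
      Complex.exp (⟪p.1, t - ⟪t, e⟫ • e⟫ * Complex.I) * Complex.exp (⟪t, e⟫ * p.2 * Complex.I) := by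
    intro p
    rw [← Complex.exp_add]
    congr 1
    simp only [repl, inner_add_left, inner_sub_left, inner_sub_right, real_inner_smul_left,
      real_inner_smul_right, real_inner_comm e t]
    push_cast; ring
  simp_rw [e1]
  rw [integral_prod_mul (fun x : Eu n => Complex.exp (⟪x, t - ⟪t, e⟫ • e⟫ * Complex.I))
    (fun s : ℝ => Complex.exp (⟪t, e⟫ * s * Complex.I)), ← charFun_apply, ← charFun_apply_real,
    charFun_gam, charFun_gaussianReal, charFun_gam, ← Complex.exp_add]
  congr 1
  have : ‖t - ⟪t, e⟫ • e‖ ^ 2 = ‖t‖ ^ 2 - ⟪t, e⟫ ^ 2 := by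
    rw [norm_sub_sq_real, real_inner_smul_right, norm_smul, he, mul_one, Real.norm_eq_abs, sq_abs]
    ring
  rw [← Complex.ofReal_pow, this]
  push_cast; simp; ring

/-- Slice measure. -/
def slc (e : Eu n) (A : Set (Eu n)) (x : Eu n) : ℝ := (gaussianReal 0 1).real {s | repl e x s ∈ A}

lemma measurable_slc (e : Eu n) {A : Set (Eu n)} (hA : MeasurableSet A) :
    Measurable (slc e A) := by
  have h : MeasurableSet {p : Eu n × ℝ | repl e p.1 p.2 ∈ A} := (continuous_repl e).measurable hA
  exact (measurable_measure_prodMk_left h).ennreal_toReal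

lemma slc_nonneg (e : Eu n) (A : Set (Eu n)) (x : Eu n) : 0 ≤ slc e A x := measureReal_nonneg
lemma slc_le_one (e : Eu n) (A : Set (Eu n)) (x : Eu n) : slc e A x ≤ 1 := measureReal_le_one

lemma integrable_slc (e : Eu n) {A : Set (Eu n)} (hA : MeasurableSet A) :
    Integrable (slc e A) (gam n) :=
  Integrable.of_bound (measurable_slc e hA).aestronglyMeasurable 1
    (Eventually.of_forall fun x => by
      rw [Real.norm_eq_abs, abs_of_nonneg (slc_nonneg _ _ _)]; exact slc_le_one _ _ _)

/-- Fubini along `e`. -/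
lemma integral_repl {e : Eu n} (he : ‖e‖ = 1) {f : Eu n → ℝ} (hf : Integrable f (gam n)) :
    ∫ x, f x ∂(gam n) = ∫ x, ∫ s, f (repl e x s) ∂(gaussianReal 0 1) ∂(gam n) := by
  have hf' := hf
  conv_lhs => rw [← map_repl he]
  rw [← map_repl he] at hf'
  rw [integral_map (continuous_repl e).measurable.aemeasurable hf'.1]
  rw [integrable_map_measure hf'.1 (continuous_repl e).measurable.aemeasurable] at hf'
  exact integral_prod _ hf'

lemma gam_eq_slc {e : Eu n} (he : ‖e‖ = 1) {A : Set (Eu n)} (hA : MeasurableSet A) :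
    (gam n).real A = ∫ x, slc e A x ∂(gam n) := by
  rw [← integral_indicator_one hA, integral_repl he]
  · congr 1; ext x
    rw [slc, ← integral_indicator_one]
    · rfl
    · exact (continuous_repl e).measurable.comp measurable_prodMk_left hA
  · exact (integrable_const (1:ℝ)).indicator hA

lemma inner_repl {e : Eu n} (he : ‖e‖ = 1) (x : Eu n) (s : ℝ) : ⟪repl e x s, e⟫ = s := by
  simp [repl, inner_add_left, inner_sub_left, real_inner_smul_left, he]

lemma repl_self {e : Eu n} (x : Eu n) : repl e x ⟪x, e⟫ = x := by simp [repl]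

lemma repl_repl {e : Eu n} (he : ‖e‖ = 1) (x : Eu n) (s t : ℝ) :
    repl e (repl e x s) t = repl e x t := by
  have := inner_repl he x s
  rw [repl, this]; simp [repl]

lemma slc_repl {e : Eu n} (he : ‖e‖ = 1) (A : Set (Eu n)) (x : Eu n) (s : ℝ) :
    slc e A (repl e x s) = slc e A x := by
  simp only [slc, repl_repl he]

lemma gam_halfspace {e : Eu n} (he : ‖e‖ = 1) (r : ℝ) :
    (gam n).real {x | ⟪x, e⟫ ≤ r} = Phi r := by
  rw [gam_eq_slc he (measurableSet_le (by fun_prop) (by fun_prop))]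
  have : ∀ x : Eu n, slc e {x | ⟪x, e⟫ ≤ r} x = Phi r := fun x => by
    simp only [slc, mem_ofPred_eq, inner_repl he, Phi_eq_meas]; rfl
  simp [this]

end part3

section part4

open ProbabilityTheory

variable {n : ℕ}

/-- Ehrhard symmetrization. -/
def esym (e : Eu n) (A : Set (Eu n)) : Set (Eu n) := {x | Phi ⟪x, e⟫ ≤ slc e A x}

lemma measurableSet_esym (e : Eu n) {A : Set (Eu n)} (hA : MeasurableSet A) :
    MeasurableSet (esym e A) :=
  measurableSet_le (continuous_Phi.measurable.comp (by fun_prop)) (measurable_slc e hA)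

lemma meas_Phi_le {m : ℝ} (h0 : 0 ≤ m) (h1 : m ≤ 1) :
    (gaussianReal 0 1).real {s | Phi s ≤ m} = m := by
  rcases eq_or_lt_of_le h0 with h | h
  · have : {s | Phi s ≤ m} = ∅ := by
      ext s; simp only [mem_ofPred_eq, mem_empty_iff_false, iff_false, not_le, ← h]; exact Phi_pos s
    rw [this, ← h]; simp
  rcases eq_or_lt_of_le h1 with h' | h'
  · have : {s | Phi s ≤ m} = univ := by
      ext s; simp only [mem_ofPred_eq, mem_univ, iff_true, h']; exact Phi_le_one s
    rw [this, h']; simp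
  obtain ⟨a, rfl⟩ := exists_Phi_eq h h'
  have : {s | Phi s ≤ Phi a} = Iic a := by
    ext s; simp [strictMono_Phi.le_iff_le]
  rw [this, Phi_eq_meas]

lemma esym_slice {e : Eu n} (he : ‖e‖ = 1) (A : Set (Eu n)) (x : Eu n) :
    {s | repl e x s ∈ esym e A} = {s | Phi s ≤ slc e A x} := by
  ext s; simp [esym, inner_repl he, slc_repl he]

lemma slc_esym {e : Eu n} (he : ‖e‖ = 1) (A : Set (Eu n)) (x : Eu n) :
    slc e (esym e A) x = slc e A x := by
  rw [slc, esym_slice he, meas_Phi_le (slc_nonneg _ _ _) (slc_le_one _ _ _)]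

lemma gam_esym {e : Eu n} (he : ‖e‖ = 1) {A : Set (Eu n)} (hA : MeasurableSet A) :
    (gam n).real (esym e A) = (gam n).real A := by
  rw [gam_eq_slc he hA, gam_eq_slc he (measurableSet_esym e hA)]
  simp_rw [slc_esym he]

lemma repl_comb (e x y : Eu n) (u v s t : ℝ) :
    repl e (u • x + v • y) (u * s + v * t) = u • repl e x s + v • repl e y t := by
  simp only [repl, inner_add_left, real_inner_smul_left]
  module

lemma convex_slice {A : Set (Eu n)} (hA : Convex ℝ A) (e x : Eu n) :
    Convex ℝ {s | repl e x s ∈ A} := by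
  intro s hs t ht a b ha hb hab
  have := hA hs ht ha hb hab
  rw [← repl_comb, ← add_smul, hab, one_smul] at this
  exact this

lemma esym_comb {e : Eu n} {A B C : Set (Eu n)} (hA : Convex ℝ A)
    (hB : Convex ℝ B) {u v : ℝ} (hu : 0 ≤ u) (hv : 0 ≤ v) (huv : u + v = 1)
    (h : ∀ x ∈ A, ∀ y ∈ B, u • x + v • y ∈ C) :
    ∀ x ∈ esym e A, ∀ y ∈ esym e B, u • x + v • y ∈ esym e C := by
  intro x hx y hy
  have := ehr1 (convex_slice hA e x) (convex_slice hB e y) hu hv huv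
    (C := {s | repl e (u • x + v • y) s ∈ C})
    (by intro s hs t ht
        have := h _ hs _ ht
        rw [← repl_comb] at this; exact this) hx hy
  change Phi ⟪u • x + v • y, e⟫ ≤ _
  rw [inner_add_left, real_inner_smul_left, real_inner_smul_left]
  exact this

lemma convex_esym {e : Eu n} {A : Set (Eu n)} (hA : Convex ℝ A) : Convex ℝ (esym e A) := by
  intro x hx y hy u v hu hv huv
  exact esym_comb hA hA hu hv huv (fun x hx y hy => hA hx hy hu hv huv) x hx y hy

lemma esym_down {e : Eu n} (he : ‖e‖ = 1) {A : Set (Eu n)} {x : Eu n} (hx : x ∈ esym e A)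
    {t : ℝ} (ht : 0 ≤ t) : x - t • e ∈ esym e A := by
  have h : x - t • e = repl e x (⟪x, e⟫ - t) := by simp [repl]; module
  change Phi ⟪x - t • e, e⟫ ≤ slc e A (x - t • e)
  rw [h, slc_repl he, inner_repl he]
  exact (strictMono_Phi.monotone (by linarith)).trans hx

lemma bathtub {Q : Set ℝ} (hQ : MeasurableSet Q) :
    ∫ s in {s | Phi s ≤ (gaussianReal 0 1).real Q}, s ∂(gaussianReal 0 1) ≤
      ∫ s in Q, s ∂(gaussianReal 0 1) ∧
    (∫ s in {s | Phi s ≤ (gaussianReal 0 1).real Q}, s ∂(gaussianReal 0 1) =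
      ∫ s in Q, s ∂(gaussianReal 0 1) →
      Q =ᵐ[gaussianReal 0 1] {s | Phi s ≤ (gaussianReal 0 1).real Q}) := by
  set γ := gaussianReal 0 1
  set m := γ.real Q with hm
  set H := {s | Phi s ≤ m} with hH
  have hHm : MeasurableSet H := measurableSet_le continuous_Phi.measurable measurable_const
  have hmH : γ.real H = m := meas_Phi_le measureReal_nonneg measureReal_le_one
  have hinteg : Integrable (fun s : ℝ => s) γ := IsGaussian.integrable_id (μ := γ)
  have hm0 : 0 ≤ m := measureReal_nonneg
  have hm1 : m ≤ 1 := measureReal_le_one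
  rcases eq_or_lt_of_le hm0 with h | h
  · have h1 : Q =ᵐ[γ] (∅ : Set ℝ) := by
      rw [ae_eq_empty]
      exact (measureReal_eq_zero_iff).1 (hm.symm.trans h.symm)
    have h2 : H =ᵐ[γ] (∅ : Set ℝ) := by
      rw [ae_eq_empty]
      exact (measureReal_eq_zero_iff).1 (hmH.trans h.symm)
    have h3 := h1.trans h2.symm
    exact ⟨(setIntegral_congr_set h3).symm.le, fun _ => h3⟩
  rcases eq_or_lt_of_le hm1 with h' | h'
  · have aux : ∀ R : Set ℝ, MeasurableSet R → γ.real R = m → R =ᵐ[γ] (univ : Set ℝ) := by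
      intro R hR e
      rw [ae_eq_univ]
      have := probReal_compl_eq_one_sub hR (μ := γ)
      rw [e, h', sub_self] at this
      exact (measureReal_eq_zero_iff).1 this
    have h3 := (aux Q hQ rfl).trans (aux H hHm hmH).symm
    exact ⟨(setIntegral_congr_set h3).symm.le, fun _ => h3⟩
  obtain ⟨a, ha⟩ := exists_Phi_eq h h'
  have hHa : H = Iic a := by
    ext s; simp only [hH, mem_ofPred_eq, ← ha, strictMono_Phi.le_iff_le, mem_Iic]
  let F : ℝ → ℝ := fun s => Q.indicator (fun s => s - a) s - H.indicator (fun s => s - a) s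
  have hia : Integrable (fun s : ℝ => s - a) γ := hinteg.sub (integrable_const _)
  have hF : ∫ s, F s ∂γ = ∫ s in Q, s ∂γ - ∫ s in H, s ∂γ := by
    rw [integral_sub (hia.indicator hQ) (hia.indicator hHm), integral_indicator hQ,
      integral_indicator hHm, integral_sub hinteg.integrableOn (integrable_const _),
      integral_sub hinteg.integrableOn (integrable_const _)]
    simp only [setIntegral_const, hmH, ← hm]; ring
  have hFi : Integrable F γ := (hia.indicator hQ).sub (hia.indicator hHm)
  have hF0 : ∀ s, 0 ≤ F s := by
    intro s
    by_cases h1 : s ∈ Q <;> by_cases h2 : s ∈ H <;> simp only [F, indicator_of_mem, h1, h2,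
      indicator_of_notMem, not_false_iff] <;> rw [hHa] at h2 <;> simp at h2 <;> linarith
  have hI0 : 0 ≤ ∫ s, F s ∂γ := integral_nonneg hF0
  refine ⟨by linarith, fun h => ?_⟩
  have hz : ∫ s, F s ∂γ = 0 := by rw [hF, h, sub_self]
  rw [integral_eq_zero_iff_of_nonneg hF0 hFi] at hz
  have hna : ∀ᵐ s ∂γ, s ≠ a := by
    have n0 := nullSingletonClass_gaussianReal (μ := 0) (v := 1) one_ne_zero
    rw [ae_iff]; simp [γ]
  filter_upwards [hz, hna] with s hs hsa
  apply propext
  change s ∈ Q ↔ s ∈ H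
  by_cases h1 : s ∈ Q <;> by_cases h2 : s ∈ H <;> simp only [F, indicator_of_mem, h1, h2,
      indicator_of_notMem, not_false_iff, Pi.zero_apply, sub_zero, zero_sub, neg_eq_zero] at hs ⊢
  · exact absurd (by linarith) hsa
  · exact absurd (by linarith) hsa

lemma integrable_inner_gam (w : Eu n) : Integrable (fun x => ⟪x, w⟫) (gam n) := by
  rw [gam_eq_std]
  exact (IsGaussian.integrable_id (μ := stdGaussian (Eu n))).inner_const w

lemma setIntegral_repl {e : Eu n} (he : ‖e‖ = 1) (w : Eu n) {A : Set (Eu n)}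
    (hA : MeasurableSet A) :
    ∫ x in A, ⟪x, w⟫ ∂(gam n) = ∫ x, (⟪x - ⟪x, e⟫ • e, w⟫ * slc e A x +
      ⟪e, w⟫ * ∫ s in {s | repl e x s ∈ A}, s ∂(gaussianReal 0 1)) ∂(gam n) := by
  rw [← integral_indicator hA, integral_repl he ((integrable_inner_gam w).indicator hA)]
  congr 1; ext x
  have hm : MeasurableSet {s | repl e x s ∈ A} :=
    (continuous_repl e).measurable.comp measurable_prodMk_left hA
  have : ∀ s, A.indicator (fun x => ⟪x, w⟫) (repl e x s) = {s | repl e x s ∈ A}.indicator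
    (fun s => ⟪x - ⟪x, e⟫ • e, w⟫ + ⟪e, w⟫ * s) s := by
    intro s
    by_cases h : repl e x s ∈ A
    · rw [indicator_of_mem h, indicator_of_mem (show s ∈ {s | repl e x s ∈ A} from h), repl,
        inner_add_left, real_inner_smul_left e]; ring
    · rw [indicator_of_notMem h, indicator_of_notMem (show s ∉ {s | repl e x s ∈ A} from h)]
  simp_rw [this]
  have hinteg : Integrable (fun s : ℝ => s) (gaussianReal 0 1) :=
    IsGaussian.integrable_id (μ := gaussianReal 0 1)
  rw [integral_indicator hm, integral_add (integrable_const _) (hinteg.const_mul _).integrableOn,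
    setIntegral_const, integral_const_mul, slc, smul_eq_mul]
  ring

lemma setIntegral_repl_integrable {e : Eu n} (he : ‖e‖ = 1) {A : Set (Eu n)}
    (hA : MeasurableSet A) :
    Integrable (fun x => ∫ s in {s | repl e x s ∈ A}, s ∂(gaussianReal 0 1)) (gam n) := by
  have h1 := (integrable_inner_gam e).indicator hA
  rw [← map_repl he] at h1
  rw [integrable_map_measure h1.1 (continuous_repl e).measurable.aemeasurable] at h1
  refine h1.integral_prod_left.congr (Eventually.of_forall fun x => ?_)
  have hm : MeasurableSet {s | repl e x s ∈ A} :=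
    (continuous_repl e).measurable.comp measurable_prodMk_left hA
  simp only [Function.comp]
  rw [← integral_indicator hm]
  congr 1; ext s
  by_cases h : repl e x s ∈ A
  · rw [indicator_of_mem h, indicator_of_mem (show s ∈ {s | repl e x s ∈ A} from h),
      inner_repl he]
  · rw [indicator_of_notMem h, indicator_of_notMem (show s ∉ {s | repl e x s ∈ A} from h)]

lemma esym_energy {e : Eu n} (he : ‖e‖ = 1) {w : Eu n} (hw : 0 < ⟪e, w⟫) {A : Set (Eu n)}
    (hA : MeasurableSet A) :
    ∫ x in esym e A, ⟪x, w⟫ ∂(gam n) ≤ ∫ x in A, ⟪x, w⟫ ∂(gam n) ∧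
    (∫ x in esym e A, ⟪x, w⟫ ∂(gam n) = ∫ x in A, ⟪x, w⟫ ∂(gam n) →
      A =ᵐ[gam n] esym e A) := by
  have hS := measurableSet_esym e hA
  have hm : ∀ x, MeasurableSet {s | repl e x s ∈ A} := fun x =>
    (continuous_repl e).measurable.comp measurable_prodMk_left hA
  let G : Eu n → ℝ := fun x => (∫ s in {s | repl e x s ∈ A}, s ∂(gaussianReal 0 1)) -
    ∫ s in {s | repl e x s ∈ esym e A}, s ∂(gaussianReal 0 1)
  have hbt := fun x => bathtub (hm x)
  have hG0 : ∀ x, 0 ≤ G x := by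
    intro x
    simp only [G, esym_slice he]
    exact sub_nonneg.2 (hbt x).1
  have hGi : Integrable G (gam n) :=
    (setIntegral_repl_integrable he hA).sub (setIntegral_repl_integrable he hS)
  have key : ∫ x in A, ⟪x, w⟫ ∂(gam n) - ∫ x in esym e A, ⟪x, w⟫ ∂(gam n) =
      ⟪e, w⟫ * ∫ x, G x ∂(gam n) := by
    have hi : ∀ B : Set (Eu n), MeasurableSet B → Integrable (fun x => (⟪x - ⟪x, e⟫ • e, w⟫ *
        slc e B x + ⟪e, w⟫ * ∫ s in {s | repl e x s ∈ B}, s ∂(gaussianReal 0 1))) (gam n) := by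
      intro B hB
      refine Integrable.add ?_ ((setIntegral_repl_integrable he hB).const_mul _)
      refine Integrable.mul_bdd (c := 1) ?_ (measurable_slc e hB).aestronglyMeasurable
        (Eventually.of_forall fun x => ?_)
      · have : ∀ x : Eu n, ⟪x - ⟪x, e⟫ • e, w⟫ = ⟪x, w⟫ - ⟪x, e⟫ * ⟪e, w⟫ := fun x => by
          rw [inner_sub_left, real_inner_smul_left]
        simp_rw [this]
        exact (integrable_inner_gam w).sub ((integrable_inner_gam e).mul_const _)
      · rw [Real.norm_eq_abs, abs_of_nonneg (slc_nonneg _ _ _)]; exact slc_le_one _ _ _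
    rw [setIntegral_repl he w hA, setIntegral_repl he w hS, ← integral_sub (hi A hA) (hi _ hS),
      ← integral_const_mul]
    congr 1; ext x
    rw [slc_esym he]; simp only [G]; ring
  have hGI : 0 ≤ ∫ x, G x ∂(gam n) := integral_nonneg hG0
  refine ⟨by nlinarith, fun h => ?_⟩
  rw [h, sub_self] at key
  have hz : ∫ x, G x ∂(gam n) = 0 := by
    rcases mul_eq_zero.1 key.symm with h | h
    · exact absurd h hw.ne'
    · exact h
  rw [integral_eq_zero_iff_of_nonneg hG0 hGi] at hz
  have hae : ∀ᵐ x ∂(gam n), {s | repl e x s ∈ A} =ᵐ[gaussianReal 0 1]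
      {s | repl e x s ∈ esym e A} := by
    filter_upwards [hz] with x hx
    simp only [G, Pi.zero_apply] at hx
    rw [esym_slice he] at hx ⊢
    exact (hbt x).2 (sub_eq_zero.1 hx).symm
  have hd : ∀ B D : Set (Eu n), MeasurableSet B → MeasurableSet D → (∀ᵐ x ∂(gam n),
      {s | repl e x s ∈ B} =ᵐ[gaussianReal 0 1] {s | repl e x s ∈ D}) →
      (gam n) (B \ D) = 0 := by
    intro B D hB hD hBD
    rw [← measureReal_eq_zero_iff, gam_eq_slc he (hB.diff hD)]
    rw [integral_eq_zero_iff_of_nonneg (slc_nonneg e _) (integrable_slc e (hB.diff hD))]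
    filter_upwards [hBD] with x hx
    have := (ae_le_set.1 hx.le)
    simp only [slc, Pi.zero_apply]
    rw [measureReal_eq_zero_iff]
    exact this
  rw [ae_eq_set]
  exact ⟨hd A _ hA hS hae, hd _ A hS hA (hae.mono fun x hx => hx.symm)⟩

end part4

section part5

open ProbabilityTheory

variable {n : ℕ}

/-- Kuratowski limit along an ultrafilter. -/
def klim (U : Ultrafilter ℕ) (A : ℕ → Set (Eu n)) : Set (Eu n) :=
  {x | ∀ ε > 0, ∀ᶠ k in (U : Filter ℕ), (A k ∩ ball x ε).Nonempty}

lemma klim_out {U : Ultrafilter ℕ} {A : ℕ → Set (Eu n)} {x : Eu n} (hx : x ∉ klim U A) :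
    ∃ ε > 0, ∀ᶠ k in (U : Filter ℕ), Disjoint (ball x ε) (A k) := by
  simp only [klim, mem_ofPred_eq, not_forall] at hx
  obtain ⟨ε, hε, h⟩ := hx
  rw [← Ultrafilter.eventually_not] at h
  refine ⟨ε, hε, h.mono fun k hk => ?_⟩
  rw [disjoint_comm, disjoint_iff_inter_eq_empty]
  exact not_nonempty_iff_eq_empty.1 hk

lemma klim_closed (U : Ultrafilter ℕ) (A : ℕ → Set (Eu n)) : IsClosed (klim U A) := by
  rw [← isOpen_compl_iff, Metric.isOpen_iff]
  intro x hx
  obtain ⟨ε, hε, h⟩ := klim_out hx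
  refine ⟨ε / 2, by linarith, fun y hy hy' => ?_⟩
  have := hy' (ε / 2) (by linarith)
  obtain ⟨k, hk1, z, hz1, hz2⟩ := (h.and this).exists
  refine disjoint_left.1 hk1 ?_ hz1
  rw [mem_ball] at *
  linarith [dist_triangle z y x]

lemma klim_comb {U : Ultrafilter ℕ} {A B C : ℕ → Set (Eu n)} {u v : ℝ} (hu : 0 ≤ u) (hv : 0 ≤ v)
    (huv : u + v = 1) (h : ∀ k, ∀ x ∈ A k, ∀ y ∈ B k, u • x + v • y ∈ C k) :
    ∀ x ∈ klim U A, ∀ y ∈ klim U B, u • x + v • y ∈ klim U C := by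
  intro x hx y hy ε hε
  filter_upwards [hx ε hε, hy ε hε] with k ⟨a, ha, hax⟩ ⟨b, hb, hby⟩
  refine ⟨u • a + v • b, h k a ha b hb, ?_⟩
  have := convex_ball (0 : Eu n) ε (x := a - x) (by simpa [dist_eq_norm] using hax) (y := b - y)
    (by simpa [dist_eq_norm] using hby) hu hv huv
  rw [mem_ball, dist_eq_norm]
  rw [mem_ball_zero_iff] at this
  have e : u • a + v • b - (u • x + v • y) = u • (a - x) + v • (b - y) := by module
  rw [e]; exact this

lemma klim_convex {U : Ultrafilter ℕ} {A : ℕ → Set (Eu n)} (hA : ∀ k, Convex ℝ (A k)) :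
    Convex ℝ (klim U A) := by
  intro x hx y hy u v hu hv huv
  exact klim_comb hu hv huv (fun k x hx y hy => hA k hx hy hu hv huv) x hx y hy

lemma klim_int {U : Ultrafilter ℕ} {A : ℕ → Set (Eu n)} (hA : ∀ k, Convex ℝ (A k))
    (hAc : ∀ k, IsClosed (A k)) {x : Eu n} (hx : x ∈ interior (klim U A)) :
    ∃ ρ > 0, ∀ᶠ k in (U : Filter ℕ), ball x ρ ⊆ A k := by
  obtain ⟨δ, hδ, hball⟩ := Metric.mem_nhds_iff.1 (mem_interior_iff_mem_nhds.1 hx)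
  obtain ⟨ρ, hρ, hρδ⟩ : ∃ ρ > 0, 2 * ρ < δ := ⟨δ / 3, by linarith, by linarith⟩
  refine ⟨ρ, hρ, ?_⟩
  obtain ⟨F, hF, hFc⟩ := (isCompact_closedBall x (2 * ρ)).elim_nhds_subcover
    (fun y => ball y (ρ / 2)) (fun y _ => ball_mem_nhds y (by linarith))
  have hev : ∀ᶠ k in (U : Filter ℕ), ∀ f ∈ F, (A k ∩ ball f (ρ / 2)).Nonempty := by
    rw [eventually_all_finset]
    intro f hf
    exact hball (closedBall_subset_ball hρδ (hF f hf)) (ρ / 2) (by linarith)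
  filter_upwards [hev] with k hk
  have net : ∀ p ∈ closedBall x (2 * ρ), ∃ z ∈ A k, ‖z - p‖ < ρ := by
    intro p hp
    obtain ⟨f, hf, hpf⟩ := mem_iUnion₂.1 (hFc hp)
    obtain ⟨z, hz, hzf⟩ := hk f hf
    refine ⟨z, hz, ?_⟩
    rw [mem_ball] at hpf hzf
    rw [← dist_eq_norm]
    linarith [dist_triangle_right z p f]
  intro y hy
  by_contra hyA
  obtain ⟨f, c, hfc, hcy⟩ := geometric_hahn_banach_closed_point (hA k) (hAc k) hyA
  obtain ⟨w, rfl⟩ := (InnerProductSpace.toDual ℝ (Eu n)).surjective f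
  simp only [InnerProductSpace.toDual_apply_apply] at hfc hcy
  by_cases hw : w = 0
  · obtain ⟨z, hz, -⟩ := net x (by simp; linarith)
    have := hfc z hz
    simp [hw] at this hcy; linarith
  have hw' : 0 < ‖w‖ := norm_pos_iff.2 hw
  obtain ⟨z, hz, hzp⟩ := net (x + (2 * ρ / ‖w‖) • w) (by
    rw [mem_closedBall, dist_eq_norm, add_sub_cancel_left, norm_smul, norm_div, norm_norm,
      div_mul_cancel₀ _ hw'.ne', Real.norm_eq_abs, abs_of_pos (by linarith)])
  have h1 := hfc z hz
  have h2 : ⟪w, z - (x + (2 * ρ / ‖w‖) • w)⟫ ≥ -(‖w‖ * ρ) := by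
    have := abs_real_inner_le_norm w (z - (x + (2 * ρ / ‖w‖) • w))
    have h3 := (abs_le.1 this).1
    have : ‖w‖ * ‖z - (x + (2 * ρ / ‖w‖) • w)‖ ≤ ‖w‖ * ρ := by gcongr
    linarith
  have h4 : ⟪w, y - x⟫ ≤ ‖w‖ * ρ := by
    refine (real_inner_le_norm _ _).trans ?_
    rw [mem_ball, dist_eq_norm] at hy
    gcongr
  have h5 : (2 * ρ / ‖w‖) * (‖w‖ * ‖w‖) = 2 * ρ * ‖w‖ := by field_simp
  rw [inner_sub_right, inner_add_right, real_inner_smul_right, real_inner_self_eq_norm_mul_norm,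
    h5] at h2
  rw [inner_sub_right] at h4
  linarith

lemma klim_meas {U : Ultrafilter ℕ} {A : ℕ → Set (Eu n)} (hA : ∀ k, Convex ℝ (A k))
    (hAc : ∀ k, IsClosed (A k)) (ν : Measure (Eu n)) [IsFiniteMeasure ν] (hν : ν ≪ volume)
    {ε : ℝ≥0∞} (hε : ε ≠ 0) :
    ∀ᶠ k in (U : Filter ℕ), ν (symmDiff (A k) (klim U A)) ≤ ε := by
  have hε2 : ε / 2 ≠ 0 := by simpa using hε
  set T := klim U A with hT
  have hTc : IsClosed T := klim_closed U A
  have hTconv : Convex ℝ T := klim_convex hA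
  obtain ⟨Q, hQT, hQc, hQ⟩ := isOpen_interior.measurableSet.exists_isCompact_sdiff_lt
    (μ := ν) (A := interior T) (measure_ne_top _ _) hε2
  obtain ⟨R, hRT, hRc, hR⟩ := hTc.measurableSet.compl.exists_isCompact_sdiff_lt
    (μ := ν) (measure_ne_top _ _) hε2
  have e1 : ∀ᶠ k in (U : Filter ℕ), Q ⊆ A k := by
    refine hQc.induction_on (p := fun s => ∀ᶠ k in (U : Filter ℕ), s ⊆ A k) ?_ ?_ ?_ ?_
    · simp
    · exact fun s t hst h => h.mono fun k hk => hst.trans hk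
    · exact fun s t hs ht => by filter_upwards [hs, ht] with k h1 h2 using union_subset h1 h2
    · intro x hx
      obtain ⟨ρ, hρ, h⟩ := klim_int hA hAc (hQT hx)
      exact ⟨ball x ρ, mem_nhdsWithin_of_mem_nhds (ball_mem_nhds x hρ), h⟩
  have e2 : ∀ᶠ k in (U : Filter ℕ), Disjoint R (A k) := by
    refine hRc.induction_on (p := fun s => ∀ᶠ k in (U : Filter ℕ), Disjoint s (A k)) ?_ ?_ ?_ ?_
    · simp
    · exact fun s t hst h => h.mono fun k hk => hk.mono_left hst
    · exact fun s t hs ht => by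
        filter_upwards [hs, ht] with k h1 h2 using disjoint_union_left.2 ⟨h1, h2⟩
    · intro x hx
      obtain ⟨ρ, hρ, h⟩ := klim_out (hRT hx)
      exact ⟨ball x ρ, mem_nhdsWithin_of_mem_nhds (ball_mem_nhds x hρ), h⟩
  filter_upwards [e1, e2] with k h1 h2
  have hsub : symmDiff (A k) T ⊆ ((interior T \ Q) ∪ (Tᶜ \ R)) ∪ frontier T := by
    intro x hx
    rcases hx with ⟨hx1, hx2⟩ | ⟨hx1, hx2⟩
    · exact Or.inl (Or.inr ⟨hx2, fun h => disjoint_left.1 h2 h hx1⟩)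
    · by_cases hi : x ∈ interior T
      · exact Or.inl (Or.inl ⟨hi, fun h => hx2 (h1 h)⟩)
      · exact Or.inr ⟨subset_closure hx1, hi⟩
  calc ν (symmDiff (A k) T) ≤ ν (((interior T \ Q) ∪ (Tᶜ \ R)) ∪ frontier T) := measure_mono hsub
    _ ≤ ν ((interior T \ Q) ∪ (Tᶜ \ R)) + ν (frontier T) := measure_union_le _ _
    _ = ν ((interior T \ Q) ∪ (Tᶜ \ R)) := by rw [hν (hTconv.addHaar_frontier volume), add_zero]
    _ ≤ ν (interior T \ Q) + ν (Tᶜ \ R) := measure_union_le _ _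
    _ ≤ ε / 2 + ε / 2 := add_le_add hQ.le hR.le
    _ = ε := ENNReal.add_halves ε

lemma klim_integral {U : Ultrafilter ℕ} {A : ℕ → Set (Eu n)} (hA : ∀ k, Convex ℝ (A k))
    (hAc : ∀ k, IsClosed (A k)) {f : Eu n → ℝ} (hf : Integrable f (gam n)) :
    Tendsto (fun k => ∫ x in A k, f x ∂(gam n)) U (𝓝 (∫ x in klim U A, f x ∂(gam n))) := by
  rw [Metric.tendsto_nhds]
  intro ε hε
  let ν := (gam n).withDensity (fun x => ‖f x‖ₑ)
  haveI : IsFiniteMeasure ν := isFiniteMeasure_withDensity hf.2.ne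
  have hν : ν ≪ volume := (withDensity_absolutelyContinuous _ _).trans gam_ac
  have hε' : ENNReal.ofReal (ε / 2) ≠ 0 := by simpa using hε
  filter_upwards [klim_meas hA hAc ν hν hε'] with k hk
  have hT := (klim_closed U A).measurableSet
  have hAk := (hAc k).measurableSet
  rw [Real.dist_eq, ← integral_indicator hT, ← integral_indicator hAk,
    ← integral_sub (hf.indicator hAk) (hf.indicator hT)]
  have h1 : ‖∫ x, ((A k).indicator f x - (klim U A).indicator f x) ∂(gam n)‖ₑ ≤
      ν (symmDiff (A k) (klim U A)) := by
    refine (enorm_integral_le_lintegral_enorm _).trans ?_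
    rw [withDensity_apply _ (hAk.symmDiff hT), ← lintegral_indicator (hAk.symmDiff hT)]
    refine lintegral_mono fun x => ?_
    by_cases h1 : x ∈ A k <;> by_cases h2 : x ∈ klim U A <;>
      simp [h1, h2, Set.indicator, Set.mem_symmDiff]
  have h2 := h1.trans hk
  rw [← ofReal_norm, ENNReal.ofReal_le_ofReal_iff (by linarith), Real.norm_eq_abs] at h2
  linarith

lemma klim_gam {U : Ultrafilter ℕ} {A : ℕ → Set (Eu n)} (hA : ∀ k, Convex ℝ (A k))
    (hAc : ∀ k, IsClosed (A k)) :
    Tendsto (fun k => (gam n).real (A k)) U (𝓝 ((gam n).real (klim U A))) := by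
  have := klim_integral (U := U) hA hAc (integrable_const (1:ℝ))
  simpa using this

lemma ae_closure {A : Set (Eu n)} (hA : Convex ℝ A) : A =ᵐ[gam n] closure A := by
  have h0 : (gam n) (frontier A) = 0 := gam_ac (hA.addHaar_frontier volume)
  rw [ae_eq_set]
  constructor
  · rw [sdiff_eq_empty.2 subset_closure]; simp
  · refine measure_mono_null ?_ h0
    intro x hx
    exact ⟨hx.1, fun h => hx.2 (interior_subset h)⟩

lemma ae_interior {A : Set (Eu n)} (hA : Convex ℝ A) : A =ᵐ[gam n] interior A := by
  have h0 : (gam n) (frontier A) = 0 := gam_ac (hA.addHaar_frontier volume)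
  rw [ae_eq_set]
  constructor
  · refine measure_mono_null ?_ h0
    intro x hx
    exact ⟨subset_closure hx.1, hx.2⟩
  · rw [sdiff_eq_empty.2 interior_subset]; simp

lemma esym_shift {A : Set (Eu n)} (hAc : IsClosed A) {e : Eu n} (he : ‖e‖ = 1)
    (hae : A =ᵐ[gam n] esym e A) {x : Eu n} (hx : x ∈ interior A) {t : ℝ} (ht : 0 ≤ t) :
    x - t • e ∈ A := by
  by_contra hxt
  obtain ⟨δ₁, hδ₁, hb₁⟩ := Metric.mem_nhds_iff.1 (mem_interior_iff_mem_nhds.1 hx)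
  obtain ⟨δ₂, hδ₂, hb₂⟩ := Metric.mem_nhds_iff.1 (hAc.isOpen_compl.mem_nhds hxt)
  set δ := min δ₁ δ₂
  have hδ : 0 < δ := lt_min hδ₁ hδ₂
  obtain ⟨n1, n2⟩ := ae_eq_set.1 hae
  have n1' : volume (A \ esym e A) = 0 := ac_gam n1
  have n2' : volume (esym e A \ A) = 0 := ac_gam n2
  have h3 : volume (ball x δ ∩ esym e A) = 0 := by
    rw [← measure_preimage_add_right volume (-(t • e))] at n2'
    refine measure_mono_null ?_ n2'
    intro y hy
    have h4 := esym_down he hy.2 ht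
    refine ⟨by show y + -(t • e) ∈ _; rw [← sub_eq_add_neg]; exact h4, fun h5 => ?_⟩
    refine hb₂ (a := y + -(t • e)) ?_ h5
    rw [mem_ball, dist_eq_norm]
    have e1 : y + -(t • e) - (x - t • e) = y - x := by abel
    rw [e1, ← dist_eq_norm]
    exact (mem_ball.1 hy.1).trans_le (min_le_right _ _)
  have h4 : volume (ball x δ) = 0 := by
    refine measure_mono_null (t := (ball x δ ∩ esym e A) ∪ (A \ esym e A)) ?_
      (measure_union_null h3 n1')
    intro y hy
    by_cases h : y ∈ esym e A
    · exact Or.inl ⟨hy, h⟩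
    · exact Or.inr ⟨hb₁ (ball_subset_ball (min_le_left _ _) hy), h⟩
  exact (measure_ball_pos volume x hδ).ne' h4

lemma halfspace_sub {A : Set (Eu n)} (hAc : IsClosed A) (hA : Convex ℝ A) {w : Eu n}
    (hw : ‖w‖ = 1) (h : ∀ e : Eu n, ‖e‖ = 1 → 0 < ⟪e, w⟫ → A =ᵐ[gam n] esym e A) {r : ℝ}
    (hr : Phi r ≤ (gam n).real A) {y : Eu n} (hy : ⟪y, w⟫ < r) : y ∈ A := by
  by_contra hyA
  have h1 : ∀ x ∈ interior A, ⟪x, w⟫ ≤ ⟪y, w⟫ := by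
    intro x hx
    by_contra hlt
    push Not at hlt
    have hd : 0 < ⟪x - y, w⟫ := by rw [inner_sub_left]; linarith
    have hne : x - y ≠ 0 := by
      intro h0; rw [h0, inner_zero_left] at hd; exact lt_irrefl _ hd
    have hn : 0 < ‖x - y‖ := norm_pos_iff.2 hne
    have he : ‖(‖x - y‖⁻¹ • (x - y))‖ = 1 := by
      rw [norm_smul, norm_inv, norm_norm, inv_mul_cancel₀ hn.ne']
    have := esym_shift hAc he (h _ he (by rw [real_inner_smul_left]; positivity)) hx hn.le
    rw [smul_smul, mul_inv_cancel₀ hn.ne', one_smul, sub_sub_cancel] at this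
    exact hyA this
  have h2 : (gam n).real A ≤ Phi ⟪y, w⟫ := by
    rw [measureReal_congr (ae_interior hA), ← gam_halfspace hw]
    exact measureReal_mono h1
  have h3 := strictMono_Phi hy
  linarith

/-- Ehrhard's inequality for closed convex sets. -/
theorem ehrhard {w : Eu n} (hw : ‖w‖ = 1) {A B C : Set (Eu n)} (hAc : IsClosed A)
    (hBc : IsClosed B) (hCc : IsClosed C) (hA : Convex ℝ A) (hB : Convex ℝ B) (hC : Convex ℝ C)
    {u v : ℝ} (hu : 0 ≤ u) (hv : 0 ≤ v) (huv : u + v = 1)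
    (h : ∀ x ∈ A, ∀ y ∈ B, u • x + v • y ∈ C) {r s : ℝ}
    (hr : Phi r ≤ (gam n).real A) (hs : Phi s ≤ (gam n).real B) :
    Phi (u * r + v * s) ≤ (gam n).real C := by
  let Adm : Set (Eu n) → Set (Eu n) → Set (Eu n) → Prop := fun A B D =>
    ((IsClosed A ∧ IsClosed B ∧ IsClosed D) ∧ (Convex ℝ A ∧ Convex ℝ B ∧ Convex ℝ D)) ∧
    (∀ x ∈ A, ∀ y ∈ B, u • x + v • y ∈ D) ∧
    (Phi r ≤ (gam n).real A ∧ Phi s ≤ (gam n).real B ∧ (gam n).real D ≤ (gam n).real C)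
  let J : Set (Eu n) → Set (Eu n) → ℝ := fun A B =>
    ∫ x in A, ⟪x, w⟫ ∂(gam n) + ∫ x in B, ⟪x, w⟫ ∂(gam n)
  let V : Set ℝ := {j | ∃ A B D, Adm A B D ∧ J A B = j}
  have hne : V.Nonempty := ⟨_, A, B, C, ⟨⟨⟨hAc, hBc, hCc⟩, hA, hB, hC⟩, h, hr, hs, le_rfl⟩, rfl⟩
  have hbd : BddBelow V := by
    refine ⟨-(2 * ∫ x, |⟪x, w⟫| ∂(gam n)), ?_⟩
    rintro j ⟨A, B, D, -, rfl⟩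
    have aux : ∀ A : Set (Eu n), -(∫ x, |⟪x, w⟫| ∂(gam n)) ≤ ∫ x in A, ⟪x, w⟫ ∂(gam n) := by
      intro A
      have h1 := abs_integral_le_integral_abs (f := fun x => ⟪x, w⟫) (μ := (gam n).restrict A)
      have h2 : ∫ x in A, |⟪x, w⟫| ∂(gam n) ≤ ∫ x, |⟪x, w⟫| ∂(gam n) :=
        setIntegral_le_integral (integrable_inner_gam w).abs (Eventually.of_forall fun x => abs_nonneg _)
      linarith [(abs_le.1 h1).1]
    have := aux A
    have := aux B
    simp only [J]; linarith
  obtain ⟨j, -, hjt, hjV⟩ := exists_seq_tendsto_sInf hne hbd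
  choose As Bs Ds hadm hJ using hjV
  let U : Ultrafilter ℕ := hyperfilter ℕ
  have hU : (U : Filter ℕ) ≤ atTop := by
    rw [← Nat.cofinite_eq_atTop]; exact hyperfilter_le_cofinite
  have tA := fun (f : Eu n → ℝ) (hf : Integrable f (gam n)) =>
    klim_integral (U := U) (fun k => (hadm k).1.2.1) (fun k => (hadm k).1.1.1) hf
  have tB := fun (f : Eu n → ℝ) (hf : Integrable f (gam n)) =>
    klim_integral (U := U) (fun k => (hadm k).1.2.2.1) (fun k => (hadm k).1.1.2.1) hf
  set A' := klim U As
  set B' := klim U Bs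
  set D' := klim U Ds
  have hadm' : Adm A' B' D' := by
    refine ⟨⟨⟨klim_closed _ _, klim_closed _ _, klim_closed _ _⟩,
      klim_convex fun k => (hadm k).1.2.1, klim_convex fun k => (hadm k).1.2.2.1,
      klim_convex fun k => (hadm k).1.2.2.2⟩, klim_comb hu hv huv fun k => (hadm k).2.1, ?_, ?_, ?_⟩
    · exact ge_of_tendsto' (klim_gam (fun k => (hadm k).1.2.1) (fun k => (hadm k).1.1.1))
        fun k => (hadm k).2.2.1
    · exact ge_of_tendsto' (klim_gam (fun k => (hadm k).1.2.2.1) (fun k => (hadm k).1.1.2.1))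
        fun k => (hadm k).2.2.2.1
    · exact le_of_tendsto' (klim_gam (fun k => (hadm k).1.2.2.2) (fun k => (hadm k).1.1.2.2))
        fun k => (hadm k).2.2.2.2
  have hJ' : J A' B' = sInf V := by
    have t1 := (tA _ (integrable_inner_gam w)).add (tB _ (integrable_inner_gam w))
    have t2 := hjt.mono_left hU
    refine tendsto_nhds_unique t1 (t2.congr fun k => (hJ k).symm)
  have hsym : ∀ e : Eu n, ‖e‖ = 1 → 0 < ⟪e, w⟫ →
      A' =ᵐ[gam n] esym e A' ∧ B' =ᵐ[gam n] esym e B' := by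
    intro e he hew
    obtain ⟨⟨⟨c1, c2, c3⟩, d1, d2, d3⟩, hc, m1, m2, m3⟩ := hadm'
    have aA := ae_closure (convex_esym (e := e) d1)
    have aB := ae_closure (convex_esym (e := e) d2)
    have aD := ae_closure (convex_esym (e := e) d3)
    have hadm2 : Adm (closure (esym e A')) (closure (esym e B')) (closure (esym e D')) := by
      refine ⟨⟨⟨isClosed_closure, isClosed_closure, isClosed_closure⟩, (convex_esym d1).closure,
        (convex_esym d2).closure, (convex_esym d3).closure⟩, ?_, ?_, ?_, ?_⟩
      · intro x hx y hy
        have hcont : Continuous fun p : Eu n × Eu n => u • p.1 + v • p.2 := by fun_prop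
        have := map_mem_closure hcont (s := esym e A' ×ˢ esym e B') (t := esym e D')
          (x := (x, y)) (by rw [closure_prod_eq]; exact ⟨hx, hy⟩)
          (fun p hp => esym_comb d1 d2 hu hv huv hc p.1 hp.1 p.2 hp.2)
        exact this
      · rw [← measureReal_congr aA, gam_esym he c1.measurableSet]; exact m1
      · rw [← measureReal_congr aB, gam_esym he c2.measurableSet]; exact m2
      · rw [← measureReal_congr aD, gam_esym he c3.measurableSet]; exact m3
    have hle : sInf V ≤ J (closure (esym e A')) (closure (esym e B')) :=
      csInf_le hbd ⟨_, _, _, hadm2, rfl⟩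
    rw [← hJ'] at hle
    simp only [J] at hle
    rw [← setIntegral_congr_set aA, ← setIntegral_congr_set aB] at hle
    obtain ⟨p1, p2⟩ := esym_energy he hew c1.measurableSet
    obtain ⟨q1, q2⟩ := esym_energy he hew c2.measurableSet
    exact ⟨p2 (by linarith), q2 (by linarith)⟩
  obtain ⟨⟨⟨c1, c2, c3⟩, d1, d2, d3⟩, hc, m1, m2, m3⟩ := hadm'
  have sA : ∀ y : Eu n, ⟪y, w⟫ < r → y ∈ A' := fun y hy =>
    halfspace_sub c1 d1 hw (fun e he hew => (hsym e he hew).1) m1 hy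
  have sB : ∀ y : Eu n, ⟪y, w⟫ < s → y ∈ B' := fun y hy =>
    halfspace_sub c2 d2 hw (fun e he hew => (hsym e he hew).2) m2 hy
  have sD : ∀ z : Eu n, ⟪z, w⟫ < u * r + v * s → z ∈ D' := by
    intro z hz
    set δ := u * r + v * s - ⟪z, w⟫ with hδ
    have hww : ⟪w, w⟫ = (1:ℝ) := by rw [real_inner_self_eq_norm_sq, hw]; norm_num
    have e1 := hc (z + (r - δ - ⟪z, w⟫) • w) (sA _ (by
      rw [inner_add_left, real_inner_smul_left, hww]; linarith)) (z + (s - δ - ⟪z, w⟫) • w) (sB _ (by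
      rw [inner_add_left, real_inner_smul_left, hww]; linarith))
    have hv' : v = 1 - u := by linarith
    have e2 : u • (z + (r - δ - ⟪z, w⟫) • w) + v • (z + (s - δ - ⟪z, w⟫) • w) = z := by
      have : u • (z + (r - δ - ⟪z, w⟫) • w) + v • (z + (s - δ - ⟪z, w⟫) • w) =
        (u + v) • z + ((u * r + v * s) - (u + v) * (δ + ⟪z, w⟫)) • w := by module
      rw [this, huv, one_smul, hδ]
      simp
    rwa [e2] at e1
  have hclo : {z : Eu n | ⟪z, w⟫ ≤ u * r + v * s} ⊆ D' := by
    intro z hz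
    have hww : ⟪w, w⟫ = (1:ℝ) := by rw [real_inner_self_eq_norm_sq, hw]; norm_num
    have ht : Tendsto (fun t : ℝ => z - t • w) (𝓝[>] 0) (𝓝 z) := by
      have : Continuous fun t : ℝ => z - t • w := by fun_prop
      have := this.tendsto 0
      simp only [zero_smul, sub_zero] at this
      exact this.mono_left nhdsWithin_le_nhds
    refine c3.mem_of_tendsto ht ?_
    filter_upwards [self_mem_nhdsWithin] with t ht
    apply sD
    rw [inner_sub_left, real_inner_smul_left, hww]
    have : (0:ℝ) < t := ht
    have : ⟪z, w⟫ ≤ u * r + v * s := hz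
    linarith
  calc Phi (u * r + v * s) = (gam n).real {z : Eu n | ⟪z, w⟫ ≤ u * r + v * s} :=
        (gam_halfspace hw _).symm
    _ ≤ (gam n).real D' := measureReal_mono hclo
    _ ≤ _ := m3

end part5

section part6

open ProbabilityTheory

variable {n : ℕ}

lemma convex_shift {A : Set (Eu n)} (hA : Convex ℝ A) (w : Eu n) :
    Convex ℝ {x | x - w ∈ A} := by
  intro x hx y hy a b ha hb hab
  have := hA hx hy ha hb hab
  have e : a • (x - w) + b • (y - w) = a • x + b • y - w := by
    calc a • (x - w) + b • (y - w) = a • x + b • y - (a + b) • w := by module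
      _ = _ := by rw [hab, one_smul]
  rw [e] at this
  exact this

lemma gam_real_eq {A : Set (Eu n)} (hA : MeasurableSet A) :
    (gam n).real A = ∫ x in A, gd n x := by
  rw [← gaussVol_eq hA, gaussVol, ← integral_const_mul]; rfl

lemma gam_lt_one (hn : 1 ≤ n) {K : Set (Eu n)} (hK : IsCompact K) : (gam n).real K < 1 := by
  have h1 := probReal_compl_eq_one_sub hK.measurableSet (μ := gam n)
  have h2 : 0 < (gam n).real Kᶜ := by
    refine measureReal_nonneg.lt_of_ne' ?_
    rw [measureReal_ne_zero_iff]
    intro h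
    have : volume Kᶜ = 0 := ac_gam h
    refine (hK.isClosed.isOpen_compl.measure_ne_zero volume ?_) this
    haveI : Nonempty (Fin n) := ⟨⟨0, hn⟩⟩
    by_contra hne
    rw [not_nonempty_iff_eq_empty, compl_empty_iff] at hne
    exact noncompact_univ (Eu n) (hne ▸ hK)
  linarith

lemma gam_translate {A : Set (Eu n)} (hA : MeasurableSet A) (w : Eu n) {b : ℝ}
    (hb : ∀ x ∈ A, ⟪x, w⟫ ≤ b) :
    (gam n).real A * Real.exp (-b - ‖w‖ ^ 2 / 2) ≤ (gam n).real {x | x - w ∈ A} := by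
  have hm : MeasurableSet {x | x - w ∈ A} := (measurable_id.sub_const w) hA
  have h1 : (gam n).real {x | x - w ∈ A} = ∫ x in A, gd n (x + w) := by
    rw [gam_real_eq hm, ← integral_indicator hm, ← integral_indicator hA,
      ← integral_add_right_eq_self _ w]
    congr 1; ext x
    by_cases h : x ∈ A
    · rw [indicator_of_mem h, indicator_of_mem (by simpa using h)]
    · rw [indicator_of_notMem h, indicator_of_notMem (by simpa using h)]
  rw [h1, gam_real_eq hA, ← integral_mul_const]
  refine setIntegral_mono_on (integrable_gd.integrableOn.mul_const _)
    (integrable_gd.comp_add_right w).integrableOn hA fun x hx => ?_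
  rw [gd, gd, mul_assoc, ← Real.exp_add]
  gcongr
  rw [norm_add_sq_real]
  linarith [hb x hx]

lemma gam_logconc {w : Eu n} (hw : ‖w‖ = 1) {A B C : Set (Eu n)} (hAc : IsClosed A)
    (hBc : IsClosed B) (hCc : IsClosed C) (hA : Convex ℝ A) (hB : Convex ℝ B) (hC : Convex ℝ C)
    (h : ∀ x ∈ A, ∀ y ∈ B, (1/2 : ℝ) • x + (1/2 : ℝ) • y ∈ C)
    (hA1 : (gam n).real A < 1) (hB1 : (gam n).real B < 1) :
    (gam n).real A * (gam n).real B ≤ (gam n).real C ^ 2 := by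
  rcases eq_or_lt_of_le (measureReal_nonneg : 0 ≤ (gam n).real A) with h0 | h0
  · rw [← h0]; nlinarith [sq_nonneg ((gam n).real C)]
  rcases eq_or_lt_of_le (measureReal_nonneg : 0 ≤ (gam n).real B) with h0' | h0'
  · rw [← h0']; nlinarith [sq_nonneg ((gam n).real C)]
  obtain ⟨r, hr⟩ := exists_Phi_eq h0 hA1
  obtain ⟨s, hs⟩ := exists_Phi_eq h0' hB1
  have e := ehrhard hw hAc hBc hCc hA hB hC (by norm_num) (by norm_num) (by norm_num) h hr.le hs.le
  rw [← hr, ← hs]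
  refine (Phi_logconcave r s).trans ?_
  have e2 : 1 / 2 * r + 1 / 2 * s = (r + s) / 2 := by ring
  rw [e2] at e
  have := Phi_nonneg ((r + s) / 2)
  gcongr

lemma gauss_conc (hn : 1 ≤ n) {A B C : Set (Eu n)} (hAc : IsCompact A)
    (hBc : IsCompact B) (hCc : IsClosed C) (hA : Convex ℝ A) (hB : Convex ℝ B) (hC : Convex ℝ C)
    {u v : ℝ} (hu : 0 ≤ u) (hv : 0 ≤ v) (huv : u + v = 1)
    (h : ∀ x ∈ A, ∀ y ∈ B, u • x + v • y ∈ C)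
    (hA1 : 1 / 2 ≤ (gam n).real A) (hB1 : 1 / 2 ≤ (gam n).real B) :
    u * (gam n).real A + v * (gam n).real B ≤ (gam n).real C ∧
    (0 < u → 0 < v → (gam n).real A ≠ (gam n).real B →
      u * (gam n).real A + v * (gam n).real B < (gam n).real C) := by
  haveI : Nonempty (Fin n) := ⟨⟨0, hn⟩⟩
  obtain ⟨w, hw⟩ := exists_norm_eq (Eu n) (zero_le_one (α := ℝ))
  obtain ⟨r, hr⟩ := exists_Phi_eq (by linarith) (gam_lt_one hn hAc)
  obtain ⟨s, hs⟩ := exists_Phi_eq (by linarith) (gam_lt_one hn hBc)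
  have e := ehrhard hw hAc.isClosed hBc.isClosed hCc hA hB hC hu hv huv h hr.le hs.le
  have hr0 : 0 ≤ r := by
    rw [← strictMono_Phi.le_iff_le, Phi_zero, hr]; exact hA1
  have hs0 : 0 ≤ s := by
    rw [← strictMono_Phi.le_iff_le, Phi_zero, hs]; exact hB1
  rw [← hr, ← hs]
  constructor
  · exact (Phi_strictConcave.concaveOn.2 (mem_Ici.2 hr0) (mem_Ici.2 hs0) hu hv huv).trans e
  · intro hu' hv' hne
    have hrs : r ≠ s := fun h => hne (by rw [h])
    exact (Phi_strictConcave.2 (mem_Ici.2 hr0) (mem_Ici.2 hs0) hrs hu' hv' huv).trans_le e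

/-- Minkowski combination. -/
def mcomb (t : ℝ) (K L : Set (Eu n)) : Set (Eu n) := (1 - t) • K + t • L

lemma mcomb_mem {t : ℝ} {K L : Set (Eu n)} {x y : Eu n} (hx : x ∈ K) (hy : y ∈ L) :
    (1 - t) • x + t • y ∈ mcomb t K L :=
  add_mem_add (smul_mem_smul_set hx) (smul_mem_smul_set hy)

lemma mcomb_compact (t : ℝ) {K L : Set (Eu n)} (hK : IsCompact K) (hL : IsCompact L) :
    IsCompact (mcomb t K L) := (hK.smul _).add (hL.smul _)

lemma mcomb_convex (t : ℝ) {K L : Set (Eu n)} (hK : Convex ℝ K) (hL : Convex ℝ L) :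
    Convex ℝ (mcomb t K L) := (hK.smul _).add (hL.smul _)

lemma gam_slab {v : Eu n} (hv : ‖v‖ = 1) {s t : ℝ} (hst : s ≤ t) :
    (gam n).real {x | s < ⟪x, v⟫ ∧ ⟪x, v⟫ ≤ t} = Phi t - Phi s := by
  rw [← gam_halfspace hv, ← gam_halfspace hv, ← measureReal_sdiff]
  · congr 1; ext x; simp [and_comm]
  · intro x hx; exact le_trans hx hst
  · exact measurableSet_le (by fun_prop) (by fun_prop)

lemma gam_hyper {v : Eu n} (hv : ‖v‖ = 1) (s : ℝ) : (gam n) {x | ⟪x, v⟫ = s} = 0 := by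
  rw [← measureReal_eq_zero_iff]
  refine le_antisymm ?_ measureReal_nonneg
  have h : ∀ t < s, (gam n).real {x | ⟪x, v⟫ = s} ≤ Phi s - Phi t := by
    intro t ht
    rw [← gam_slab hv ht.le]
    exact measureReal_mono fun x (hx : ⟪x, v⟫ = s) => ⟨by rw [hx]; exact ht, hx.le⟩
  have hc : Tendsto (fun t => Phi s - Phi t) (𝓝[<] s) (𝓝 0) := by
    have : Continuous (fun t => Phi s - Phi t) := continuous_const.sub continuous_Phi
    have := this.tendsto s
    rw [sub_self] at this
    exact this.mono_left nhdsWithin_le_nhds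
  exact ge_of_tendsto hc (by filter_upwards [self_mem_nhdsWithin] with t ht using h t ht)

lemma cap_split {v : Eu n} (hv : ‖v‖ = 1) (s : ℝ) {K : Set (Eu n)} :
    (gam n).real (K ∩ {x | ⟪x, v⟫ ≤ s}) + (gam n).real (K ∩ {x | s ≤ ⟪x, v⟫}) =
      (gam n).real K := by
  have h1 := measureReal_inter_add_sdiff (μ := gam n) (s := K) (t := {x | ⟪x, v⟫ ≤ s})
    (measurableSet_le (by fun_prop) (by fun_prop))
  rw [← h1]
  congr 1
  apply measureReal_congr
  rw [ae_eq_set]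
  constructor
  · refine measure_mono_null ?_ (gam_hyper hv s)
    rintro x ⟨⟨hx1, hx2⟩, hx3⟩
    by_contra hne
    exact hx3 ⟨hx1, fun h => hne (le_antisymm h hx2)⟩
  · refine measure_mono_null ?_ (measure_empty (μ := gam n))
    rintro x ⟨⟨hx1, hx2⟩, hx3⟩
    exact hx3 ⟨hx1, (not_le.1 (show ¬ ⟪x, v⟫ ≤ s from hx2)).le⟩

lemma cap_exists {v : Eu n} (hv : ‖v‖ = 1) {K : Set (Eu n)} (hK : IsCompact K) {b p : ℝ}
    (hb : ∀ x ∈ K, ⟪x, v⟫ ≤ b) (hp0 : 0 ≤ p) (hp : p ≤ (gam n).real K) :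
    ∃ s, (gam n).real (K ∩ {x | s ≤ ⟪x, v⟫}) = p := by
  let F : ℝ → ℝ := fun s => (gam n).real (K ∩ {x | ⟪x, v⟫ ≤ s})
  have hFle : ∀ s t, s ≤ t → |F t - F s| ≤ |Phi t - Phi s| := by
    intro s t hst
    have hm : F s ≤ F t := measureReal_mono (by
      rintro x ⟨h1, h2⟩; exact ⟨h1, le_trans h2 hst⟩)
    have hP := strictMono_Phi.monotone hst
    rw [abs_of_nonneg (by linarith), abs_of_nonneg (by linarith), ← gam_slab hv hst]
    have : F t ≤ F s + (gam n).real {x | s < ⟪x, v⟫ ∧ ⟪x, v⟫ ≤ t} := by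
      refine (measureReal_mono ?_).trans (measureReal_union_le _ _)
      rintro x ⟨h1, h2⟩
      by_cases h : ⟪x, v⟫ ≤ s
      · exact Or.inl ⟨h1, h⟩
      · exact Or.inr ⟨not_le.1 h, h2⟩
    linarith
  have hFc : Continuous F := by
    rw [continuous_iff_continuousAt]
    intro s
    rw [ContinuousAt, tendsto_iff_norm_sub_tendsto_zero]
    have h0 : Tendsto (fun t => |Phi t - Phi s|) (𝓝 s) (𝓝 0) := by
      have := ((continuous_Phi.sub (continuous_const (y := Phi s))).abs).tendsto s
      simpa using this
    refine squeeze_zero (fun t => norm_nonneg _) (fun t => ?_) h0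
    rw [Real.norm_eq_abs]
    rcases le_total s t with h | h
    · exact hFle s t h
    · rw [abs_sub_comm, abs_sub_comm (Phi t)]; exact hFle t s h
  obtain ⟨a, ha⟩ : ∃ a, ∀ x ∈ K, a ≤ ⟪x, v⟫ := by
    obtain ⟨a, ha⟩ := (hK.image (f := fun x => ⟪x, v⟫) (by fun_prop)).bddBelow
    exact ⟨a, fun x hx => ha ⟨x, hx, rfl⟩⟩
  have hFa : F (a - 1) = 0 := by
    have : K ∩ {x | ⟪x, v⟫ ≤ a - 1} = ∅ := by
      ext x; simp only [mem_inter_iff, mem_ofPred_eq, mem_empty_iff_false, iff_false, not_and,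
        not_le]
      intro hx; linarith [ha x hx]
    simp only [F, this, measureReal_empty]
  have hFb : F b = (gam n).real K := by
    have : K ∩ {x | ⟪x, v⟫ ≤ b} = K := inter_eq_left.2 hb
    simp only [F, this]
  have : (gam n).real K - p ∈ Icc (F (a - 1)) (F b) := by
    rw [hFa, hFb]; constructor <;> linarith
  obtain ⟨s, hs⟩ := mem_range_of_exists_le_of_exists_ge hFc ⟨_, this.1⟩ ⟨_, this.2⟩
  refine ⟨s, ?_⟩
  have := cap_split hv s (K := K)
  simp only [F] at hs
  linarith

lemma strict_aux (hn : 1 ≤ n) {K L M : Set (Eu n)} (hKc : IsCompact K) (hLc : IsCompact L)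
    (hMc : IsClosed M) (hK : Convex ℝ K) (hL : Convex ℝ L) (hM : Convex ℝ M)
    (hLi : (interior L).Nonempty)
    (h : ∀ x ∈ K, ∀ y ∈ L, (1/2 : ℝ) • x + (1/2 : ℝ) • y ∈ M) {c : ℝ}
    (hKv : (gam n).real K = c) (hLv : (gam n).real L = c) {x₀ : Eu n} (hx₀ : x₀ ∈ L)
    (hx₀' : x₀ ∉ K) : c < (gam n).real M := by
  by_contra hcM
  push Not at hcM
  haveI : Nonempty (Fin n) := ⟨⟨0, hn⟩⟩
  obtain ⟨v, hv, b, hb, hbx⟩ : ∃ v : Eu n, ‖v‖ = 1 ∧ ∃ b : ℝ, (∀ x ∈ K, ⟪x, v⟫ ≤ b) ∧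
      b < ⟪x₀, v⟫ := by
    obtain ⟨f, c', hfc, hcy⟩ := geometric_hahn_banach_closed_point hK hKc.isClosed hx₀'
    obtain ⟨w, rfl⟩ := (InnerProductSpace.toDual ℝ (Eu n)).surjective f
    simp only [InnerProductSpace.toDual_apply_apply] at hfc hcy
    by_cases hw : w = 0
    · obtain ⟨v, hv⟩ := exists_norm_eq (Eu n) (zero_le_one (α := ℝ))
      refine ⟨v, hv, ⟪x₀, v⟫ - 1, fun x hx => ?_, by linarith⟩
      have := hfc x hx
      simp [hw] at this hcy; linarith
    have hw' : 0 < ‖w‖⁻¹ := inv_pos.2 (norm_pos_iff.2 hw)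
    refine ⟨‖w‖⁻¹ • w, ?_, ‖w‖⁻¹ * c', fun x hx => ?_, ?_⟩
    · rw [norm_smul, norm_inv, norm_norm, inv_mul_cancel₀ (norm_pos_iff.2 hw).ne']
    · rw [real_inner_smul_right, real_inner_comm]
      exact mul_le_mul_of_nonneg_left (hfc x hx).le hw'.le
    · rw [real_inner_smul_right, real_inner_comm]
      exact mul_lt_mul_of_pos_left hcy hw'
  obtain ⟨s', hbs', hs'x⟩ := exists_between hbx
  set L₁ := L ∩ {x | s' ≤ ⟪x, v⟫} with hL₁
  have hhalf : ∀ s : ℝ, IsClosed {x : Eu n | s ≤ ⟪x, v⟫} := fun s =>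
    isClosed_le (by fun_prop) (by fun_prop)
  have hhalf' : ∀ s : ℝ, IsClosed {x : Eu n | ⟪x, v⟫ ≤ s} := fun s =>
    isClosed_le (by fun_prop) (by fun_prop)
  have hlin : IsLinearMap ℝ (fun x : Eu n => ⟪x, v⟫) :=
    ⟨fun x y => inner_add_left _ _ _, fun a x => real_inner_smul_left _ _ _⟩
  have hch : ∀ s : ℝ, Convex ℝ {x : Eu n | s ≤ ⟪x, v⟫} := fun s => convex_halfSpace_ge hlin s
  have hch' : ∀ s : ℝ, Convex ℝ {x : Eu n | ⟪x, v⟫ ≤ s} := fun s => convex_halfSpace_le hlin s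
  set p := (gam n).real L₁ with hp
  have hp0 : 0 < p := by
    refine measureReal_nonneg.lt_of_ne' ?_
    rw [measureReal_ne_zero_iff]
    intro h0
    have h1 : volume L₁ = 0 := ac_gam h0
    have hO : IsOpen (interior L ∩ {x | s' < ⟪x, v⟫}) :=
      isOpen_interior.inter (isOpen_lt (by fun_prop) (by fun_prop))
    have hne : (interior L ∩ {x : Eu n | s' < ⟪x, v⟫}).Nonempty := by
      have hx : x₀ ∈ closure (interior L) := by
        rw [hL.closure_interior_eq_closure_of_nonempty_interior hLi]; exact subset_closure hx₀
      have := mem_closure_iff.1 hx {x : Eu n | s' < ⟪x, v⟫}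
        (isOpen_lt (by fun_prop) (by fun_prop)) hs'x
      rwa [inter_comm]
    have hsub : interior L ∩ {x : Eu n | s' < ⟪x, v⟫} ⊆ L₁ := by
      intro x hx
      have h2 : s' < ⟪x, v⟫ := hx.2
      exact ⟨interior_subset hx.1, h2.le⟩
    exact hO.measure_ne_zero volume hne (measure_mono_null hsub h1)
  have hpc : p ≤ c := by rw [← hLv]; exact measureReal_mono inter_subset_left
  obtain ⟨s, hs⟩ := cap_exists hv hKc hb hp0.le (by rw [hKv]; exact hpc)
  set K₁ := K ∩ {x | s ≤ ⟪x, v⟫} with hK₁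
  have sK := cap_split hv s (K := K)
  have sL := cap_split hv s' (K := L)
  have sM := cap_split hv ((s + s') / 2) (K := M)
  have hc1 : c < 1 := by rw [← hKv]; exact gam_lt_one hn hKc
  have hMm : c - p ≤ (gam n).real (M ∩ {x | ⟪x, v⟫ ≤ (s + s') / 2}) := by
    rcases eq_or_lt_of_le hpc with h1 | h1
    · rw [h1, sub_self]; exact measureReal_nonneg
    obtain ⟨r, hr⟩ := exists_Phi_eq (p := c - p) (by linarith) (by linarith)
    have := ehrhard hv (A := K ∩ {x | ⟪x, v⟫ ≤ s}) (B := L ∩ {x | ⟪x, v⟫ ≤ s'})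
      (C := M ∩ {x | ⟪x, v⟫ ≤ (s + s') / 2}) (hKc.isClosed.inter (hhalf' _))
      (hLc.isClosed.inter (hhalf' _)) (hMc.inter (hhalf' _)) (hK.inter (hch' _))
      (hL.inter (hch' _)) (hM.inter (hch' _)) (u := 1/2) (v := 1/2) (r := r) (s := r)
      (by norm_num) (by norm_num) (by norm_num) (by
        rintro x ⟨hx1, hx2⟩ y ⟨hy1, hy2⟩
        refine ⟨h x hx1 y hy1, ?_⟩
        simp only [mem_ofPred_eq, inner_add_left, real_inner_smul_left] at hx2 hy2 ⊢
        linarith) (by rw [hr]; linarith) (by rw [hr]; linarith)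
    have e : 1 / 2 * r + 1 / 2 * r = r := by ring
    rwa [e, hr] at this
  have hMp : (gam n).real (M ∩ {x | (s + s') / 2 ≤ ⟪x, v⟫}) ≤ p := by linarith
  obtain ⟨ε, hε, hεb⟩ : ∃ ε : ℝ, 0 < ε ∧ s' - b = 2 * ε := ⟨(s' - b) / 2, by linarith, by ring⟩
  have hK₁c : IsClosed K₁ := hKc.isClosed.inter (hhalf _)
  have hL₁c : IsClosed L₁ := hLc.isClosed.inter (hhalf _)
  have hnv : ‖ε • v‖ ^ 2 = ε ^ 2 := by rw [norm_smul, hv, mul_one, Real.norm_eq_abs, sq_abs]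
  have tK := gam_translate hK₁c.measurableSet (ε • v) (b := ε * b) (by
    rintro x ⟨hx, -⟩
    rw [real_inner_smul_right]
    exact mul_le_mul_of_nonneg_left (hb x hx) hε.le)
  have tL := gam_translate hL₁c.measurableSet (-(ε • v)) (b := -(ε * s')) (by
    rintro x ⟨-, hx⟩
    rw [inner_neg_right, real_inner_smul_right]
    exact neg_le_neg (mul_le_mul_of_nonneg_left hx hε.le))
  rw [norm_neg] at tL
  rw [hnv, hs] at tK
  rw [hnv, ← hp] at tL
  have hcK : IsCompact {x | x - ε • v ∈ K₁} := by
    have : {x | x - ε • v ∈ K₁} = (Homeomorph.addRight (-(ε • v))) ⁻¹' K₁ := by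
      ext x; simp [sub_eq_add_neg]
    rw [this]
    exact (Homeomorph.isCompact_preimage _).2 (hKc.inter_right (hhalf _))
  have hcL : IsCompact {x | x - -(ε • v) ∈ L₁} := by
    have : {x | x - -(ε • v) ∈ L₁} = (Homeomorph.addRight (ε • v)) ⁻¹' L₁ := by
      ext x; simp
    rw [this]
    exact (Homeomorph.isCompact_preimage _).2 (hLc.inter_right (hhalf _))
  have hlc := gam_logconc hv (A := {x | x - ε • v ∈ K₁}) (B := {x | x - -(ε • v) ∈ L₁})
    (C := M ∩ {x | (s + s') / 2 ≤ ⟪x, v⟫}) hcK.isClosed hcL.isClosed (hMc.inter (hhalf _))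
    (convex_shift (hK.inter (hch s)) _) (convex_shift (hL.inter (hch s')) _)
    (hM.inter (hch _)) (by
      rintro x ⟨hx1, hx2⟩ y ⟨hy1, hy2⟩
      have := h _ hx1 _ hy1
      have e : (1/2:ℝ) • (x - ε • v) + (1/2:ℝ) • (y - -(ε • v)) = (1/2:ℝ) • x + (1/2:ℝ) • y := by
        module
      rw [e] at this
      refine ⟨this, ?_⟩
      rw [← e]
      simp only [mem_ofPred_eq] at hx2 hy2 ⊢
      rw [inner_add_left, real_inner_smul_left, real_inner_smul_left]
      linarith) (gam_lt_one hn hcK) (gam_lt_one hn hcL)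
  have hfin : p * p * Real.exp (ε ^ 2) ≤ p ^ 2 := by
    have h1 : p * Real.exp (-(ε * b) - ε ^ 2 / 2) * (p * Real.exp (- -(ε * s') - ε ^ 2 / 2)) ≤
        p ^ 2 := by
      calc _ ≤ _ := mul_le_mul tK tL (by positivity) measureReal_nonneg
        _ ≤ _ := hlc
        _ ≤ _ := by gcongr
    have h2 : p * Real.exp (-(ε * b) - ε ^ 2 / 2) * (p * Real.exp (- -(ε * s') - ε ^ 2 / 2)) =
        p * p * Real.exp (ε ^ 2) := by
      have : p * Real.exp (-(ε * b) - ε ^ 2 / 2) * (p * Real.exp (- -(ε * s') - ε ^ 2 / 2)) =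
        p * p * (Real.exp (-(ε * b) - ε ^ 2 / 2) * Real.exp (- -(ε * s') - ε ^ 2 / 2)) := by ring
      rw [this, ← Real.exp_add]
      congr 2
      have : s' = b + 2 * ε := by linarith
      rw [this]; ring
    linarith
  have : 1 < Real.exp (ε ^ 2) := Real.one_lt_exp_iff.2 (by positivity)
  nlinarith [mul_pos hp0 hp0]

lemma strict_conc (hn : 1 ≤ n) {K L : Set (Eu n)} (hK : IsConvexBody K) (hL : IsConvexBody L)
    (hKv : 1 / 2 ≤ (gam n).real K) (hLv : 1 / 2 ≤ (gam n).real L) (hne : K ≠ L) :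
    ((gam n).real K + (gam n).real L) / 2 < (gam n).real (mcomb (1/2) K L) := by
  obtain ⟨hKx, hKc, hKi⟩ := hK
  obtain ⟨hLx, hLc, hLi⟩ := hL
  have h : ∀ x ∈ K, ∀ y ∈ L, (1/2 : ℝ) • x + (1/2 : ℝ) • y ∈ mcomb (1/2) K L := by
    intro x hx y hy
    have := mcomb_mem (t := 1/2) hx hy
    have e : (1 - 1/2 : ℝ) = 1/2 := by norm_num
    rwa [e] at this
  have hMc := (mcomb_compact (1/2) hKc hLc).isClosed
  have hMx := mcomb_convex (1/2) hKx hLx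
  by_cases hv : (gam n).real K = (gam n).real L
  · have e : ((gam n).real K + (gam n).real L) / 2 = (gam n).real K := by rw [hv]; ring
    rw [e]
    by_cases hsub : L ⊆ K
    · obtain ⟨x, hx, hx'⟩ : ∃ x ∈ K, x ∉ L := by
        by_contra hcon
        push Not at hcon
        exact hne (Subset.antisymm hcon hsub)
      exact strict_aux hn hLc hKc hMc hLx hKx hMx hKi (fun x hx y hy => by
        rw [add_comm]; exact h y hy x hx) hv.symm rfl hx hx'
    · obtain ⟨x, hx, hx'⟩ := not_subset.1 hsub
      exact strict_aux hn hKc hLc hMc hKx hLx hMx hLi h rfl hv.symm hx hx'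
  · have := (gauss_conc hn hKc hLc hMc hKx hLx hMx (by norm_num) (by norm_num) (by norm_num) h
      hKv hLv).2 (by norm_num) (by norm_num) hv
    linarith

end part6

section part7

open InnerProductSpace

variable {n : ℕ}

/-- convex bodies with the origin in the interior -/
structure Bd (K : Set (Eu n)) : Prop where
  conv : Convex ℝ K
  cpt : IsCompact K
  zero : (0 : Eu n) ∈ interior K

variable {K L : Set (Eu n)}

lemma Bd.nhds (hK : Bd K) : K ∈ 𝓝 (0 : Eu n) := mem_interior_iff_mem_nhds.1 hK.zero

lemma Bd.absorbent (hK : Bd K) : Absorbent ℝ K := absorbent_nhds_zero hK.nhds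

lemma Bd.zmem (hK : Bd K) : (0 : Eu n) ∈ K := interior_subset hK.zero

lemma Bd.g_cont (hK : Bd K) : Continuous (gauge K) := continuous_gauge hK.conv hK.nhds

lemma Bd.g_le_one (hK : Bd K) {x : Eu n} : gauge K x ≤ 1 ↔ x ∈ K := by
  rw [gauge_le_one_iff_mem_closure hK.conv hK.nhds, hK.cpt.isClosed.closure_eq]

lemma Bd.g_eq_one (hK : Bd K) {x : Eu n} : gauge K x = 1 ↔ x ∈ frontier K :=
  gauge_eq_one_iff_mem_frontier hK.conv hK.nhds

lemma Bd.g_pos (hK : Bd K) {x : Eu n} (hx : x ≠ 0) : 0 < gauge K x :=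
  (gauge_pos hK.absorbent (NormedSpace.isVonNBounded_iff ℝ |>.2 hK.cpt.isBounded)).2 hx

lemma g_smul {a : ℝ} (ha : 0 ≤ a) (x : Eu n) : gauge K (a • x) = a * gauge K x :=
  gauge_smul_of_nonneg ha x

lemma Bd.le_supp (hK : Bd K) {y : Eu n} (hy : y ∈ K) (u : Eu n) : ⟪y, u⟫ ≤ suppFun K u := by
  refine le_csSup ?_ (mem_image_of_mem _ hy)
  exact (hK.cpt.image (by fun_prop : Continuous fun y : Eu n => ⟪y, u⟫)).bddAbove

lemma Bd.supp_le (hK : Bd K) {u : Eu n} {a : ℝ} (h : ∀ y ∈ K, ⟪y, u⟫ ≤ a) : suppFun K u ≤ a := by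
  refine csSup_le (Set.Nonempty.image _ ⟨0, hK.zmem⟩) ?_
  rintro _ ⟨y, hy, rfl⟩; exact h y hy

lemma Bd.supp_smul (hK : Bd K) {a : ℝ} (ha : 0 ≤ a) (u : Eu n) :
    suppFun K (a • u) = a * suppFun K u := by
  rcases ha.eq_or_lt with rfl | ha
  · simp only [zero_smul, zero_mul]
    refine le_antisymm (hK.supp_le fun y _ => by simp) ?_
    simpa using hK.le_supp hK.zmem (0 : Eu n)
  · apply le_antisymm
    · refine hK.supp_le fun y hy => ?_
      rw [real_inner_smul_right]
      exact mul_le_mul_of_nonneg_left (hK.le_supp hy u) ha.le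
    · rw [mul_comm, ← le_div_iff₀ ha]
      refine hK.supp_le fun y hy => ?_
      rw [le_div_iff₀ ha, mul_comm, ← real_inner_smul_right]
      exact hK.le_supp hy _

lemma Bd.exists_ball (hK : Bd K) : ∃ r : ℝ, 0 < r ∧ closedBall 0 r ⊆ K :=
  Metric.nhds_basis_closedBall.mem_iff.1 hK.nhds

lemma Bd.exists_bound (hK : Bd K) : ∃ R : ℝ, 0 < R ∧ ∀ x ∈ K, ‖x‖ ≤ R := by
  obtain ⟨R, h0, hR⟩ := hK.cpt.isBounded.exists_pos_norm_le
  exact ⟨R, h0, hR⟩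

lemma Bd.supp_lip (hK : Bd K) {R : ℝ} (hR : ∀ x ∈ K, ‖x‖ ≤ R) (u v : Eu n) :
    suppFun K u ≤ suppFun K v + R * ‖u - v‖ := by
  refine hK.supp_le fun y hy => ?_
  have h1 : ⟪y, u⟫ = ⟪y, v⟫ + ⟪y, u - v⟫ := by rw [inner_sub_right]; ring
  have h2 := real_inner_le_norm y (u - v)
  have h3 := mul_le_mul_of_nonneg_right (hR y hy) (norm_nonneg (u - v))
  linarith [hK.le_supp hy v]

lemma Bd.supp_cont (hK : Bd K) : Continuous (suppFun K) := by
  obtain ⟨R, h0, hR⟩ := hK.exists_bound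
  have : LipschitzWith ⟨R, h0.le⟩ (suppFun K) := by
    refine LipschitzWith.of_le_add_mul _ fun u v => ?_
    rw [dist_eq_norm]; exact hK.supp_lip hR u v
  exact this.continuous

lemma Bd.supp_ge (hK : Bd K) {r : ℝ} (h0 : 0 < r) (hr : closedBall 0 r ⊆ K) (u : Eu n) :
    r * ‖u‖ ≤ suppFun K u := by
  rcases eq_or_ne u 0 with rfl | hu
  · simpa using hK.le_supp hK.zmem (0 : Eu n)
  have hu' : 0 < ‖u‖ := norm_pos_iff.2 hu
  have : (r / ‖u‖) • u ∈ K := hr (by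
    rw [mem_closedBall_zero_iff, norm_smul, Real.norm_eq_abs, abs_of_pos (by positivity)]
    field_simp; rfl)
  have h1 := hK.le_supp this u
  rw [real_inner_smul_left, real_inner_self_eq_norm_sq] at h1
  calc _ = _ := by field_simp
    _ ≤ _ := h1

lemma Bd.supp_pos (hK : Bd K) {u : Eu n} (hu : u ≠ 0) : 0 < suppFun K u := by
  obtain ⟨r, h0, hr⟩ := hK.exists_ball
  have hu' : 0 < ‖u‖ := norm_pos_iff.2 hu
  exact lt_of_lt_of_le (by positivity) (hK.supp_ge h0 hr u)

/-- radial projection to the boundary -/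
def tT (K : Set (Eu n)) (x : Eu n) : Eu n := (gauge K x)⁻¹ • x

lemma Bd.g_tT (hK : Bd K) {x : Eu n} (hx : x ≠ 0) : gauge K (tT K x) = 1 := by
  have := hK.g_pos hx
  rw [tT, g_smul (by positivity)]; field_simp

lemma Bd.tT_eq (hK : Bd K) {x : Eu n} (hx : x ≠ 0) : x = gauge K x • tT K x := by
  have := hK.g_pos hx
  rw [tT, smul_smul, mul_inv_cancel₀ this.ne', one_smul]

lemma tT_zero : tT K 0 = 0 := by simp [tT]

lemma Bd.tT_meas (hK : Bd K) : Measurable (tT K) :=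
  (hK.g_cont.measurable.inv).smul measurable_id

lemma tT_smul {a : ℝ} (ha : 0 < a) (x : Eu n) : tT K (a • x) = tT K x := by
  rw [tT, tT, g_smul ha.le, smul_smul]
  congr 1; rw [mul_inv]; field_simp

lemma Bd.inner_le (hK : Bd K) (x u : Eu n) : ⟪x, u⟫ ≤ suppFun K u * gauge K x := by
  rcases eq_or_ne x 0 with rfl | hx
  · simp
  · have h1 := hK.le_supp (hK.g_le_one.1 (hK.g_tT hx).le) u
    have := hK.g_pos hx
    conv_lhs => rw [hK.tT_eq hx, real_inner_smul_left]
    rw [mul_comm]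
    exact mul_le_mul_of_nonneg_right h1 this.le

/-- normal vectors -/
def Nr (K : Set (Eu n)) (x u : Eu n) : Prop := ‖u‖ = 1 ∧ ⟪x, u⟫ = suppFun K u * gauge K x

lemma Bd.nr_front (hK : Bd K) {x u : Eu n} (hx : x ∈ frontier K) :
    Nr K x u ↔ ‖u‖ = 1 ∧ ⟪x, u⟫ = suppFun K u := by
  rw [Nr, hK.g_eq_one.2 hx, mul_one]

lemma nr_smul {x u : Eu n} {a : ℝ} (ha : 0 < a) : Nr K (a • x) u ↔ Nr K x u := by
  rw [Nr, Nr, g_smul ha.le, real_inner_smul_left]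
  constructor
  · rintro ⟨h1, h2⟩
    refine ⟨h1, mul_left_cancel₀ ha.ne' ?_⟩
    rw [h2]; ring
  · rintro ⟨h1, h2⟩
    exact ⟨h1, by rw [h2]; ring⟩

lemma Bd.exists_nr (hK : Bd K) {x : Eu n} (hx : x ≠ 0) : ∃ u, Nr K x u := by
  have hp := hK.g_pos hx
  suffices h : ∃ u, Nr K (tT K x) u by
    obtain ⟨u, hu⟩ := h
    exact ⟨u, (nr_smul (inv_pos.2 hp)).1 hu⟩
  have hf := hK.g_eq_one.1 (hK.g_tT hx)
  have hi : tT K x ∉ interior K := hf.2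
  obtain ⟨f, hfx⟩ := geometric_hahn_banach_open_point hK.conv.interior isOpen_interior hi
  set w := (toDual ℝ (Eu n)).symm f with hw
  have hfw : ∀ y, f y = ⟪y, w⟫ := fun y => by
    rw [real_inner_comm, hw, toDual_symm_apply]
  have hw0 : w ≠ 0 := by
    intro h
    have := hfx 0 hK.zero
    rw [hfw, hfw, h] at this
    simp at this
  have hle : ∀ y ∈ K, ⟪y, w⟫ ≤ ⟪tT K x, w⟫ := by
    intro y hy
    have : y ∈ closure (interior K) := by
      rw [hK.conv.closure_interior_eq_closure_of_nonempty_interior ⟨0, hK.zero⟩]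
      exact subset_closure hy
    have hc : IsClosed {y : Eu n | ⟪y, w⟫ ≤ ⟪tT K x, w⟫} :=
      isClosed_le (by fun_prop) (by fun_prop)
    refine (closure_minimal (fun z hz => ?_) hc) this
    have := hfx z hz
    rw [hfw, hfw] at this
    exact this.le
  have hwp : 0 < ‖w‖ := norm_pos_iff.2 hw0
  refine ⟨‖w‖⁻¹ • w, (hK.nr_front hf).2 ⟨?_, ?_⟩⟩
  · rw [norm_smul, norm_inv, norm_norm, inv_mul_cancel₀ hwp.ne']
  · refine le_antisymm (hK.le_supp (hK.g_le_one.1 (hK.g_tT hx).le) _) ?_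
    refine hK.supp_le fun y hy => ?_
    rw [real_inner_smul_right, real_inner_smul_right]
    exact mul_le_mul_of_nonneg_left (hle y hy) (by positivity)

/-- gradient of the gauge -/
def gG (K : Set (Eu n)) (x : Eu n) : Eu n := gradient (gauge K) x

lemma gG_meas : Measurable (gG K) := by
  have : gG K = (toDual ℝ (Eu n)).symm ∘ fderiv ℝ (gauge K) := rfl
  rw [this]
  exact (toDual ℝ (Eu n)).symm.continuous.measurable.comp (measurable_fderiv ℝ _)

lemma Bd.gG_normal (hK : Bd K) {x u : Eu n} (hd : DifferentiableAt ℝ (gauge K) x)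
    (hu : Nr K x u) : suppFun K u • gG K x = u := by
  have h1 : HasFDerivAt (gauge K) (toDual ℝ (Eu n) (gG K x)) x := hd.hasGradientAt.hasFDerivAt
  have h2 : HasFDerivAt (fun y : Eu n => ⟪u, y⟫) (toDual ℝ (Eu n) u) x :=
    (toDual ℝ (Eu n) u).hasFDerivAt
  have h3 := (h1.const_mul (suppFun K u)).sub h2
  have hm : IsLocalMin ((fun y => suppFun K u * gauge K y) - fun y : Eu n => ⟪u, y⟫) x := by
    refine Filter.Eventually.of_forall fun y => ?_
    simp only [Pi.sub_apply]
    rw [real_inner_comm x u, hu.2, sub_self, real_inner_comm]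
    linarith [hK.inner_le y u]
  have h4 := hm.hasFDerivAt_eq_zero h3
  have h5 : toDual ℝ (Eu n) (suppFun K u • gG K x - u) = 0 := by
    rw [map_sub, map_smul]; exact h4
  rw [map_eq_zero_iff _ (toDual ℝ (Eu n)).injective] at h5
  exact sub_eq_zero.1 h5

lemma Bd.gG_norm (hK : Bd K) {x u : Eu n} (hd : DifferentiableAt ℝ (gauge K) x)
    (hu : Nr K x u) : ‖gG K x‖ = (suppFun K u)⁻¹ ∧ u = ‖gG K x‖⁻¹ • gG K x := by
  have hu0 : u ≠ 0 := by rintro rfl; simpa using hu.1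
  have hp := hK.supp_pos hu0
  have h := hK.gG_normal hd hu
  have h1 : ‖gG K x‖ = (suppFun K u)⁻¹ := by
    have := congrArg norm h
    rw [norm_smul, hu.1, Real.norm_eq_abs, abs_of_pos hp] at this
    exact eq_inv_of_mul_eq_one_right this
  exact ⟨h1, by rw [h1, inv_inv, h]⟩

lemma Bd.diff_smul (hK : Bd K) {x : Eu n} {a : ℝ} (ha : 0 < a)
    (hd : DifferentiableAt ℝ (gauge K) x) : DifferentiableAt ℝ (gauge K) (a • x) := by
  have e : gauge K = fun y => a * gauge K (a⁻¹ • y) := by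
    ext y; rw [g_smul (inv_pos.2 ha).le]; field_simp
  rw [e]
  refine DifferentiableAt.const_mul ?_ _
  have h2 : DifferentiableAt ℝ (gauge K) (a⁻¹ • (a • x)) := by
    rwa [smul_smul, inv_mul_cancel₀ ha.ne', one_smul]
  exact DifferentiableAt.comp (g := gauge K) (f := fun y : Eu n => a⁻¹ • y) (a • x) h2 (by fun_prop)

lemma Bd.diff_tT (hK : Bd K) {x : Eu n} (hx : x ≠ 0) :
    DifferentiableAt ℝ (gauge K) (tT K x) ↔ DifferentiableAt ℝ (gauge K) x := by
  have hp := hK.g_pos hx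
  constructor
  · intro h
    have := hK.diff_smul hp h
    rwa [← hK.tT_eq hx] at this
  · exact hK.diff_smul (inv_pos.2 hp)

lemma Bd.gG_smul (hK : Bd K) {x : Eu n} (hx : x ≠ 0) {a : ℝ} (ha : 0 < a) :
    gG K (a • x) = gG K x := by
  by_cases hd : DifferentiableAt ℝ (gauge K) x
  · obtain ⟨u, hu⟩ := hK.exists_nr hx
    have hu0 : u ≠ 0 := by rintro rfl; simpa using hu.1
    have hp := hK.supp_pos hu0
    have h1 := hK.gG_normal hd hu
    have h2 := hK.gG_normal (hK.diff_smul ha hd) ((nr_smul ha).2 hu)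
    exact smul_right_injective _ hp.ne' (h2.trans h1.symm)
  · have hd' : ¬ DifferentiableAt ℝ (gauge K) (a • x) := by
      intro h
      have := hK.diff_smul (inv_pos.2 ha) h
      rw [smul_smul, inv_mul_cancel₀ ha.ne', one_smul] at this
      exact hd this
    rw [gG, gG, gradient_eq_zero_of_not_differentiableAt hd,
      gradient_eq_zero_of_not_differentiableAt hd']

lemma Bd.gG_tT (hK : Bd K) {x : Eu n} (hx : x ≠ 0) : gG K (tT K x) = gG K x :=
  hK.gG_smul hx (inv_pos.2 (hK.g_pos hx))

lemma Bd.ae_diff (hK : Bd K) : ∀ᵐ x : Eu n, DifferentiableAt ℝ (gauge K) x := by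
  obtain ⟨C, hC⟩ := hK.conv.lipschitz_gauge hK.nhds
  exact hC.ae_differentiableAt

lemma Bd.supp_gG (hK : Bd K) {x : Eu n} (hx : x ≠ 0) (hd : DifferentiableAt ℝ (gauge K) x) :
    suppFun K (gG K x) = 1 := by
  obtain ⟨u, hu⟩ := hK.exists_nr hx
  have hu0 : u ≠ 0 := by rintro rfl; simpa using hu.1
  have hp := hK.supp_pos hu0
  obtain ⟨h1, h2⟩ := hK.gG_norm hd hu
  have h3 := hK.gG_normal hd hu
  have h4 := hK.supp_smul hp.le (gG K x)
  rw [h3] at h4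
  exact (mul_left_cancel₀ hp.ne' (by rw [mul_one]; exact h4)).symm

/-- bound for the gradient -/
lemma Bd.gG_bound (hK : Bd K) {r : ℝ} (h0 : 0 < r) (hr : closedBall 0 r ⊆ K) (x : Eu n) :
    ‖gG K x‖ ≤ r⁻¹ := by
  have hl : LipschitzWith (⟨r, h0.le⟩⁻¹ : ℝ≥0) (gauge K) :=
    hK.conv.lipschitzWith_gauge (r := ⟨r, h0.le⟩) h0 (ball_subset_closedBall.trans hr)
  have : ‖gG K x‖ = ‖fderiv ℝ (gauge K) x‖ := by
    rw [← toDual_gradient, LinearIsometryEquiv.norm_map]; rfl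
  rw [this]
  exact norm_fderiv_le_of_lipschitz ℝ hl

/-- the Minkowski combination lies below the first-order perturbation -/
lemma Bd.mcomb_gauge (hK : Bd K) (hL : Bd L) {t : ℝ} (ht : 0 ≤ t) (ht1 : t ≤ 1) {y : Eu n}
    (hy0 : y ≠ 0) (hd : DifferentiableAt ℝ (gauge K) y) (hy : y ∈ mcomb t K L) :
    gauge K y ≤ 1 + t * (suppFun L (gG K y) - suppFun K (gG K y)) := by
  obtain ⟨u, hu⟩ := hK.exists_nr hy0
  have hu0 : u ≠ 0 := by rintro rfl; simpa using hu.1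
  have hp := hK.supp_pos hu0
  have hG := hK.gG_normal hd hu
  rw [hK.supp_gG hy0 hd]
  have h4 := hL.supp_smul hp.le (gG K y)
  rw [hG] at h4
  obtain ⟨_, ⟨k, hk, rfl⟩, _, ⟨l, hl, rfl⟩, hkl⟩ := hy
  simp only at hkl
  have h5 : ⟪y, u⟫ ≤ (1 - t) * suppFun K u + t * suppFun L u := by
    rw [← hkl, inner_add_left, real_inner_smul_left, real_inner_smul_left]
    have := mul_le_mul_of_nonneg_left (hK.le_supp hk u) (sub_nonneg.2 ht1)
    have := mul_le_mul_of_nonneg_left (hL.le_supp hl u) ht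
    linarith
  rw [hu.2, h4] at h5
  refine le_of_mul_le_mul_left ?_ hp
  linarith

end part7

section part8

open InnerProductSpace

variable {n : ℕ}

variable {K L : Set (Eu n)}

/-- surface measure on the sphere -/
def sg (n : ℕ) : Measure (sphere (0 : Eu n) 1) := (volume : Measure (Eu n)).toSphere

instance : IsFiniteMeasure (sg n) := by unfold sg; infer_instance

lemma polar (hn : 1 ≤ n) {f : Eu n → ℝ} (hf : Integrable f) :
    ∫ x, f x = ∫ u : sphere (0 : Eu n) 1, (∫ r in Ioi (0:ℝ), r ^ (n - 1) * f (r • (u : Eu n))) ∂(sg n) := by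
  haveI : Nontrivial (Eu n) := by
    haveI : Nonempty (Fin n) := ⟨⟨0, hn⟩⟩
    infer_instance
  have hdim : Module.finrank ℝ (Eu n) = n := by simp
  have mp := (volume : Measure (Eu n)).measurePreserving_homeomorphUnitSphereProd
  have hme := (homeomorphUnitSphereProd (Eu n)).measurableEmbedding
  let F : sphere (0 : Eu n) 1 × Ioi (0 : ℝ) → ℝ := fun p => f (p.2.1 • p.1.1)
  have hF : ∀ x : ({0}ᶜ : Set (Eu n)), F (homeomorphUnitSphereProd (Eu n) x) = f x := by
    intro x
    have hx : (x : Eu n) ≠ 0 := x.2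
    have hx' : ‖(x : Eu n)‖ ≠ 0 := norm_ne_zero_iff.2 hx
    simp only [F, homeomorphUnitSphereProd_apply_snd_coe, homeomorphUnitSphereProd_apply_fst_coe]
    rw [smul_smul, mul_inv_cancel₀ hx', one_smul]
  have e1 : ∫ x, f x = ∫ p, F p ∂((sg n).prod (.volumeIoiPow (n - 1))) := by
    have := mp.integral_comp hme F
    rw [hdim] at this
    rw [sg, ← this]
    simp_rw [hF]
    rw [integral_subtype_comap (measurableSet_singleton _).compl f, restrict_compl_singleton]
  have hI : Integrable F ((sg n).prod (.volumeIoiPow (n - 1))) := by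
    have := mp.integrable_comp_emb hme (g := F)
    rw [hdim] at this
    rw [sg, ← this]
    have e : F ∘ homeomorphUnitSphereProd (Eu n) = f ∘ Subtype.val := by
      ext x; exact hF x
    rw [e, ← integrableOn_iff_comap_subtypeVal (measurableSet_singleton _).compl]
    exact hf.integrableOn
  rw [e1, integral_prod _ hI]
  congr 1; ext u
  simp only [Measure.volumeIoiPow, ENNReal.ofReal, F]
  rw [integral_withDensity_eq_integral_smul,
    integral_subtype_comap measurableSet_Ioi
      fun a : ℝ ↦ Real.toNNReal (a ^ (n - 1)) • f (a • (u : Eu n)),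
    setIntegral_congr_fun measurableSet_Ioi fun x hx ↦ ?_]
  · rw [NNReal.smul_def, Real.coe_toNNReal _ (pow_nonneg hx.out.le _)]; rfl
  · exact (measurable_subtype_coe.pow_const _).real_toNNReal

/-- radial weight -/
def psi (n : ℕ) (r : ℝ) : ℝ := r ^ (n - 1) * ((Real.sqrt (2 * Real.pi))⁻¹ ^ n * Real.exp (-r ^ 2 / 2))

lemma psi_cont : Continuous (psi n) := by unfold psi; fun_prop

/-- primitive of the radial weight -/
def PSI (n : ℕ) (R : ℝ) : ℝ := ∫ r in (0:ℝ)..R, psi n r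

lemma PSI_deriv (R : ℝ) : HasDerivAt (PSI n) (psi n R) R :=
  intervalIntegral.integral_hasDerivAt_right (psi_cont.intervalIntegrable _ _)
    (psi_cont.stronglyMeasurableAtFilter _ _) psi_cont.continuousAt

lemma PSI_cont : Continuous (PSI n) :=
  continuous_iff_continuousAt.2 fun R => (PSI_deriv R).continuousAt

lemma psi_bound {B r : ℝ} (h : |r| ≤ B) :
    |psi n r| ≤ B ^ (n - 1) * (Real.sqrt (2 * Real.pi))⁻¹ ^ n := by
  have hB : 0 ≤ B := (abs_nonneg r).trans h
  have hc : 0 ≤ (Real.sqrt (2 * Real.pi))⁻¹ ^ n := by positivity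
  rw [psi, abs_mul, abs_pow, abs_mul, abs_of_nonneg hc, Real.abs_exp]
  have h1 : Real.exp (-r ^ 2 / 2) ≤ 1 := Real.exp_le_one_iff.2 (by nlinarith [sq_nonneg r])
  have h2 : (Real.sqrt (2 * Real.pi))⁻¹ ^ n * Real.exp (-r ^ 2 / 2) ≤
      (Real.sqrt (2 * Real.pi))⁻¹ ^ n := mul_le_of_le_one_right hc h1
  gcongr

/-- the perturbation function -/
def qf (K L : Set (Eu n)) (x : Eu n) : ℝ := suppFun L (gG K x) - suppFun K (gG K x)

lemma Bd.qf_meas (hK : Bd K) (hL : Bd L) : Measurable (qf K L) :=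
  (hL.supp_cont.measurable.comp gG_meas).sub (hK.supp_cont.measurable.comp gG_meas)

lemma Bd.qf_bound (hK : Bd K) (hL : Bd L) : ∃ Q, 0 < Q ∧ ∀ x, |qf K L x| ≤ Q := by
  obtain ⟨r, h0, hr⟩ := hK.exists_ball
  obtain ⟨R, hR0, hR⟩ := hK.exists_bound
  obtain ⟨R', hR0', hR'⟩ := hL.exists_bound
  obtain ⟨r', h0', hr'⟩ := hL.exists_ball
  refine ⟨(R + R') * r⁻¹, by positivity, fun x => ?_⟩
  have hg := hK.gG_bound h0 hr x
  have z1 : suppFun K (0 : Eu n) = 0 := by simpa using hK.supp_smul le_rfl (0 : Eu n)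
  have z2 : suppFun L (0 : Eu n) = 0 := by simpa using hL.supp_smul le_rfl (0 : Eu n)
  have a1 := hK.supp_lip hR (gG K x) 0
  have a2 := hL.supp_lip hR' (gG K x) 0
  have b1 := hK.supp_ge h0 hr (gG K x)
  have b2 := hL.supp_ge h0' hr' (gG K x)
  rw [z1, sub_zero, zero_add] at a1
  rw [z2, sub_zero, zero_add] at a2
  have c1 : R * ‖gG K x‖ ≤ R * r⁻¹ := by gcongr
  have c2 : R' * ‖gG K x‖ ≤ R' * r⁻¹ := by gcongr
  have d1 : 0 ≤ r * ‖gG K x‖ := by positivity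
  have d2 : 0 ≤ r' * ‖gG K x‖ := by positivity
  rw [qf, abs_le]
  constructor <;> nlinarith

lemma sph_ne {u : sphere (0 : Eu n) 1} : (u : Eu n) ≠ 0 := by
  intro h
  have := u.2
  rw [h] at this; simp at this

lemma Bd.qf_smul (hK : Bd K) {x : Eu n} (hx : x ≠ 0) {a : ℝ} (ha : 0 < a) :
    qf K L (a • x) = qf K L x := by
  rw [qf, qf, hK.gG_smul hx ha]

/-- Gaussian measure of a perturbed body in polar coordinates -/
lemma Bd.gam_pert (hn : 1 ≤ n) (hK : Bd K) (hL : Bd L) {t : ℝ} (ht : ∀ x, 0 ≤ 1 + t * qf K L x) :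
    (gam n).real {x | gauge K x ≤ 1 + t * qf K L x} =
      ∫ u : sphere (0 : Eu n) 1, PSI n ((gauge K (u : Eu n))⁻¹ * (1 + t * qf K L u)) ∂(sg n) := by
  have hm : MeasurableSet {x | gauge K x ≤ 1 + t * qf K L x} :=
    measurableSet_le hK.g_cont.measurable (((hK.qf_meas hL).const_mul t).const_add 1)
  rw [gam_real_eq hm, ← integral_indicator hm, polar hn (integrable_gd.indicator hm)]
  congr 1; ext u
  have hg := hK.g_pos (sph_ne (u := u))
  set b := (gauge K (u : Eu n))⁻¹ * (1 + t * qf K L u) with hb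
  have hb0 : 0 ≤ b := by
    rw [hb]; exact mul_nonneg (by positivity) (ht _)
  rw [PSI, intervalIntegral.integral_of_le hb0, ← Ioi_inter_Iic,
    ← setIntegral_indicator measurableSet_Iic]
  refine setIntegral_congr_fun measurableSet_Ioi fun r hr => ?_
  have hr : 0 < r := hr
  have hiff : r • (u : Eu n) ∈ {x | gauge K x ≤ 1 + t * qf K L x} ↔ r ∈ Iic b := by
    rw [mem_ofPred_eq, g_smul hr.le, hK.qf_smul sph_ne hr, mem_Iic, hb, inv_mul_eq_div,
      le_div_iff₀ hg]
  have hu : ‖(u : Eu n)‖ = 1 := by simpa using u.2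
  by_cases h : r ∈ Iic b
  · rw [indicator_of_mem (hiff.2 h), indicator_of_mem h, psi, gd, norm_smul, hu, mul_one,
      Real.norm_eq_abs, sq_abs]
  · rw [indicator_of_notMem (fun h' => h (hiff.1 h')), indicator_of_notMem h, mul_zero]

/-- the first variation -/
def dV (K L : Set (Eu n)) : ℝ :=
  ∫ x in K, n * gd n (tT K x) * qf K L x

lemma Bd.dV_int (hK : Bd K) (hL : Bd L) :
    IntegrableOn (fun x => n * gd n (tT K x) * qf K L x) K := by
  obtain ⟨Q, hQ0, hQ⟩ := hK.qf_bound hL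
  refine IntegrableOn.of_bound hK.cpt.measure_lt_top ?_
    (n * (Real.sqrt (2 * Real.pi))⁻¹ ^ n * Q) ?_
  · exact (((continuous_gd.measurable.comp hK.tT_meas).const_mul _).mul
      (hK.qf_meas hL)).aestronglyMeasurable
  · refine Eventually.of_forall fun x => ?_
    rw [Real.norm_eq_abs, abs_mul, abs_of_nonneg (mul_nonneg (Nat.cast_nonneg n) (gd_pos _).le)]
    have : gd n (tT K x) ≤ (Real.sqrt (2 * Real.pi))⁻¹ ^ n := by
      rw [gd]
      refine mul_le_of_le_one_right (by positivity) (Real.exp_le_one_iff.2 ?_)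
      nlinarith [sq_nonneg ‖tT K x‖]
    have := hQ x
    have := (gd_pos (tT K x)).le
    gcongr

lemma Bd.dV_polar (hn : 1 ≤ n) (hK : Bd K) (hL : Bd L) :
    dV K L = ∫ u : sphere (0 : Eu n) 1, (gauge K (u : Eu n))⁻¹ * qf K L u *
      psi n ((gauge K (u : Eu n))⁻¹) ∂(sg n) := by
  have hKm := hK.cpt.measurableSet
  rw [dV, ← integral_indicator hKm, polar hn ((integrable_indicator_iff hKm).2 (hK.dV_int hL))]
  congr 1; ext u
  have hg := hK.g_pos (sph_ne (u := u))
  set b := (gauge K (u : Eu n))⁻¹ with hb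
  have hb0 : 0 < b := by positivity
  have hu : ‖(u : Eu n)‖ = 1 := by simpa using u.2
  have e : ∫ r in Ioi (0:ℝ), r ^ (n - 1) *
      K.indicator (fun x => n * gd n (tT K x) * qf K L x) (r • (u : Eu n)) =
      ∫ r in (0:ℝ)..b, r ^ (n - 1) * (n * gd n (tT K u) * qf K L u) := by
    rw [intervalIntegral.integral_of_le hb0.le, ← Ioi_inter_Iic,
      ← setIntegral_indicator measurableSet_Iic]
    refine setIntegral_congr_fun measurableSet_Ioi fun r hr => ?_
    have hr : 0 < r := hr
    have hiff : r • (u : Eu n) ∈ K ↔ r ∈ Iic b := by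
      rw [← hK.g_le_one, g_smul hr.le, mem_Iic, hb, le_inv_comm₀ hr hg, ← one_div,
        le_div_iff₀ hr, mul_comm]
    by_cases h : r ∈ Iic b
    · rw [indicator_of_mem (hiff.2 h), indicator_of_mem h, tT_smul hr, hK.qf_smul sph_ne hr]
    · rw [indicator_of_notMem (fun h' => h (hiff.1 h')), indicator_of_notMem h, mul_zero]
  rw [e, intervalIntegral.integral_mul_const, integral_pow]
  have hn1 : n - 1 + 1 = n := by omega
  have hn2 : ((n - 1 : ℕ) : ℝ) + 1 = n := by exact_mod_cast hn1
  have hn0 : (n : ℝ) ≠ 0 := by positivity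
  rw [hn1, hn2, zero_pow (by omega), sub_zero, psi, gd, tT, ← hb, norm_smul, hu, mul_one,
    Real.norm_eq_abs, sq_abs]
  have : b ^ n = b ^ (n - 1) * b := by rw [← pow_succ, hn1]
  rw [this]; field_simp

lemma Bd.first_var (hn : 1 ≤ n) (hK : Bd K) (hL : Bd L) {a : ℝ} {t₀ : ℝ} (ht₀ : 0 < t₀)
    (h : ∀ t, 0 < t → t ≤ t₀ → (gam n).real K + t * a ≤ (gam n).real (mcomb t K L)) :
    a ≤ dV K L := by
  obtain ⟨Q, hQ0, hQ⟩ := hK.qf_bound hL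
  obtain ⟨R, hR0, hR⟩ := hK.exists_bound
  have hρ : ∀ u : sphere (0 : Eu n) 1, 0 < (gauge K (u : Eu n))⁻¹ ∧ (gauge K (u : Eu n))⁻¹ ≤ R := by
    intro u
    have hg := hK.g_pos (sph_ne (u := u))
    have hu : ‖(u : Eu n)‖ = 1 := by simpa using u.2
    refine ⟨by positivity, ?_⟩
    have := hR _ (hK.g_le_one.1 (hK.g_tT (sph_ne (u := u))).le)
    rwa [tT, norm_smul, hu, mul_one, Real.norm_eq_abs, abs_of_pos (by positivity)] at this
  let F : ℝ → sphere (0 : Eu n) 1 → ℝ := fun t u =>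
    PSI n ((gauge K (u : Eu n))⁻¹ * (1 + t * qf K L u))
  let F' : ℝ → sphere (0 : Eu n) 1 → ℝ := fun t u =>
    (gauge K (u : Eu n))⁻¹ * qf K L u * psi n ((gauge K (u : Eu n))⁻¹ * (1 + t * qf K L u))
  have mg : Measurable fun u : sphere (0 : Eu n) 1 => (gauge K (u : Eu n))⁻¹ :=
    (hK.g_cont.measurable.comp measurable_subtype_coe).inv
  have mq : Measurable fun u : sphere (0 : Eu n) 1 => qf K L (u : Eu n) :=
    (hK.qf_meas hL).comp measurable_subtype_coe
  have mF : ∀ t, Measurable (F t) := fun t =>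
    PSI_cont.measurable.comp (mg.mul ((mq.const_mul t).const_add 1))
  have mF' : ∀ t, Measurable (F' t) := fun t =>
    (mg.mul mq).mul (psi_cont.measurable.comp (mg.mul ((mq.const_mul t).const_add 1)))
  have habs : ∀ t ∈ ball (0:ℝ) 1, ∀ u : sphere (0 : Eu n) 1,
      |(gauge K (u : Eu n))⁻¹ * (1 + t * qf K L u)| ≤ R * (1 + Q) := by
    intro t ht u
    have ht' : |t| ≤ 1 := by
      rw [mem_ball_zero_iff, Real.norm_eq_abs] at ht; exact ht.le
    rw [abs_mul, abs_of_pos (hρ u).1]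
    have : |1 + t * qf K L u| ≤ 1 + Q := by
      refine (abs_add_le _ _).trans ?_
      rw [abs_one, abs_mul]
      have := mul_le_mul ht' (hQ u) (abs_nonneg _) zero_le_one
      linarith
    exact mul_le_mul (hρ u).2 this (abs_nonneg _) hR0.le
  obtain ⟨M, hM⟩ : ∃ M, ∀ x ∈ Icc (-(R * (1 + Q))) (R * (1 + Q)), ‖PSI n x‖ ≤ M :=
    isCompact_Icc.exists_bound_of_continuousOn PSI_cont.continuousOn
  have hD := hasDerivAt_integral_of_dominated_loc_of_deriv_le (μ := sg n) (F := F) (F' := F')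
    (x₀ := (0:ℝ)) (bound := fun _ => R * Q * ((R * (1 + Q)) ^ (n - 1) * (Real.sqrt (2 * Real.pi))⁻¹ ^ n))
    (ball_mem_nhds 0 one_pos) (Eventually.of_forall fun t => (mF t).aestronglyMeasurable)
    (Integrable.of_bound (mF 0).aestronglyMeasurable M (Eventually.of_forall fun u =>
      hM _ (abs_le.1 (habs 0 (mem_ball_self one_pos) u))))
    (mF' 0).aestronglyMeasurable
    (Eventually.of_forall fun u t ht => by
      simp only [F']
      rw [Real.norm_eq_abs, abs_mul, abs_mul, abs_of_pos (hρ u).1]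
      have h1 := psi_bound (n := n) (habs t ht u)
      have h2 := mul_le_mul (hρ u).2 (hQ u) (abs_nonneg _) hR0.le
      exact mul_le_mul h2 h1 (abs_nonneg _) (by positivity))
    (integrable_const _)
    (Eventually.of_forall fun u t _ => by
      have h1 : HasDerivAt (fun t : ℝ => (gauge K (u : Eu n))⁻¹ * (1 + t * qf K L u))
          ((gauge K (u : Eu n))⁻¹ * qf K L u) t := by
        have := (((hasDerivAt_id t).mul_const (qf K L u)).const_add 1).const_mul
          ((gauge K (u : Eu n))⁻¹)
        refine this.congr_deriv ?_
        ring
      refine ((PSI_deriv _).comp t h1).congr_deriv ?_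
      simp only [F']; ring)
  have hD2 := hD.2
  have e0 : ∫ u, F' 0 u ∂(sg n) = dV K L := by
    rw [hK.dV_polar hn hL]
    simp only [F', zero_mul, add_zero, mul_one]
  rw [e0] at hD2
  have hsl := hasDerivAt_iff_tendsto_slope_zero.1 hD2
  have hsl' := hsl.mono_left (nhdsGT_le_nhdsNE (0:ℝ))
  refine ge_of_tendsto hsl' ?_
  have hev : ∀ᶠ t in 𝓝[>] (0:ℝ), 0 < t ∧ t ≤ min t₀ (min 1 Q⁻¹) := by
    have := Ioc_mem_nhdsGT (show (0:ℝ) < min t₀ (min 1 Q⁻¹) by positivity)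
    exact this
  filter_upwards [hev] with t ht
  obtain ⟨ht0, ht1⟩ := ht
  have hta : t ≤ t₀ := ht1.trans (min_le_left _ _)
  have htb : t ≤ 1 := ht1.trans ((min_le_right _ _).trans (min_le_left _ _))
  have htc : t ≤ Q⁻¹ := ht1.trans ((min_le_right _ _).trans (min_le_right _ _))
  have hpos : ∀ x, 0 ≤ 1 + t * qf K L x := by
    intro x
    have h1 := (abs_le.1 (hQ x)).1
    have h2 : t * Q ≤ 1 := by
      have := mul_le_mul_of_nonneg_right htc hQ0.le
      rwa [inv_mul_cancel₀ hQ0.ne'] at this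
    nlinarith
  have g1 := hK.gam_pert hn hL hpos
  have g0 := hK.gam_pert hn hL (t := 0) (fun x => by simp)
  have g0' : {x : Eu n | gauge K x ≤ 1 + 0 * qf K L x} = K := by
    ext x; simp [hK.g_le_one]
  rw [g0'] at g0
  have hle : (gam n).real (mcomb t K L) ≤ (gam n).real {x | gauge K x ≤ 1 + t * qf K L x} := by
    rw [measureReal_def, measureReal_def]
    refine ENNReal.toReal_mono (measure_ne_top _ _) (measure_mono_ae ?_)
    have hd : ∀ᵐ x ∂(gam n), DifferentiableAt ℝ (gauge K) x := gam_ac.ae_le hK.ae_diff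
    filter_upwards [hd] with x hx hxm
    rcases eq_or_ne x 0 with rfl | hx0
    · show gauge K 0 ≤ 1 + t * qf K L 0
      rw [gauge_zero]; exact hpos 0
    · exact hK.mcomb_gauge hL ht0.le htb hx0 hx hxm
  have := h t ht0 hta
  simp only [zero_add, smul_eq_mul]
  rw [inv_mul_eq_div, le_div_iff₀ ht0]
  have e1 : ∫ u, F t u ∂(sg n) = (gam n).real {x | gauge K x ≤ 1 + t * qf K L x} := g1.symm
  have e2 : ∫ u, F 0 u ∂(sg n) = (gam n).real K := g0.symm
  rw [e1, e2]
  linarith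

end part8

section part9

open InnerProductSpace
open scoped MeasureTheory.Measure

variable {n : ℕ}

variable {K L : Set (Eu n)}

/-- Euclidean Hausdorff measure of codimension one -/
def HE (n : ℕ) : Measure (Eu n) := μHE[n - 1]

lemma pyramid (hn : 1 ≤ n) (hK : Bd K) {v : Eu n} (hv : ‖v‖ = 1) {h : ℝ} (hh : 0 < h)
    {E : Set (Eu n)} (hE : MeasurableSet E) :
    (n : ℝ≥0∞) * volume {x : Eu n | 0 < ⟪x, v⟫ ∧ ⟪x, v⟫ ≤ h ∧ tT K x ∈ E} =
      ENNReal.ofReal h * HE n {x : Eu n | ⟪x, v⟫ = h ∧ tT K x ∈ E} := by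
  have hv0 : v ≠ 0 := by rintro rfl; simp at hv
  have hm : MeasurableSet {x : Eu n | 0 < ⟪x, v⟫ ∧ ⟪x, v⟫ ≤ h ∧ tT K x ∈ E} := by
    have m1 : MeasurableSet {x : Eu n | 0 < ⟪x, v⟫} := measurableSet_lt (by fun_prop) (by fun_prop)
    have m2 : MeasurableSet {x : Eu n | ⟪x, v⟫ ≤ h} := measurableSet_le (by fun_prop) (by fun_prop)
    exact m1.inter (m2.inter (hK.tT_meas hE))
  have hdim : Module.finrank ℝ (Eu n) = n := by simp
  have h1 := EuclideanGeometry.euclideanHausdorffMeasure_eq_lintegral (0 : Eu n) hv0 hm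
  rw [InnerProductSpace.euclideanHausdorffMeasure_eq_volume] at h1
  rw [h1, hdim]
  set F := {x : Eu n | ⟪x, v⟫ = h ∧ tT K x ∈ E} with hF
  have hmem : ∀ (s : ℝ) (y : Eu n), y ∈ (AffineSubspace.mk' (s • v +ᵥ (0 : Eu n)) (ℝ ∙ v)ᗮ : Set (Eu n)) ↔
      ⟪y, v⟫ = s := by
    intro s y
    rw [SetLike.mem_coe, AffineSubspace.mem_mk', Submodule.mem_orthogonal_singleton_iff_inner_left]
    simp only [vadd_eq_add, add_zero, vsub_eq_sub]
    rw [inner_sub_left, real_inner_smul_left, real_inner_self_eq_norm_sq, hv]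
    constructor <;> intro h <;> linarith
  have hsl : ∀ s : ℝ, HE n ({x : Eu n | 0 < ⟪x, v⟫ ∧ ⟪x, v⟫ ≤ h ∧ tT K x ∈ E} ∩
      AffineSubspace.mk' (s • v +ᵥ (0 : Eu n)) (ℝ ∙ v)ᗮ) =
      (Ioc 0 h).indicator (fun s => ENNReal.ofReal ((s / h) ^ (n - 1)) * HE n F) s := by
    intro s
    by_cases hs : s ∈ Ioc 0 h
    · rw [indicator_of_mem hs]
      have hsh : 0 < s / h := div_pos hs.1 hh
      have e : {x : Eu n | 0 < ⟪x, v⟫ ∧ ⟪x, v⟫ ≤ h ∧ tT K x ∈ E} ∩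
          AffineSubspace.mk' (s • v +ᵥ (0 : Eu n)) (ℝ ∙ v)ᗮ = (s / h) • F := by
        ext y
        rw [mem_inter_iff, hmem, mem_smul_set_iff_inv_smul_mem₀ hsh.ne', hF]
        simp only [mem_ofPred_eq]
        rw [real_inner_smul_left, tT_smul (inv_pos.2 hsh), inv_div]
        constructor
        · rintro ⟨⟨_, _, h3⟩, h4⟩
          refine ⟨?_, h3⟩
          have := hs.1
          rw [h4]; field_simp
        · rintro ⟨h4, h3⟩
          have hs1 := hs.1
          have : ⟪y, v⟫ = s := by field_simp at h4; linarith
          exact ⟨⟨by rw [this]; exact hs.1, by rw [this]; exact hs.2, h3⟩, this⟩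
      rw [e, HE, Measure.euclideanHausdorffMeasure_smul₀ _ hsh.ne', ENNReal.smul_def, smul_eq_mul]
      congr 1
      rw [ENNReal.ofReal_pow hsh.le, ENNReal.coe_pow]
      congr 1
      rw [← Real.enorm_of_nonneg hsh.le]; rfl
    · rw [indicator_of_notMem hs]
      convert measure_empty (μ := HE n)
      ext y
      simp only [mem_inter_iff, hmem, mem_ofPred_eq, mem_empty_iff_false, iff_false]
      rintro ⟨⟨h1, h2, _⟩, h3⟩
      exact hs ⟨h3 ▸ h1, h3 ▸ h2⟩
  have hsl' : ∀ s : ℝ, μHE[n - 1] ({x : Eu n | 0 < ⟪x, v⟫ ∧ ⟪x, v⟫ ≤ h ∧ tT K x ∈ E} ∩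
      AffineSubspace.mk' (s • v +ᵥ (0 : Eu n)) (ℝ ∙ v)ᗮ) =
      (Ioc 0 h).indicator (fun s => ENNReal.ofReal ((s / h) ^ (n - 1)) * HE n F) s := hsl
  simp_rw [hsl']
  rw [lintegral_indicator measurableSet_Ioc, lintegral_mul_const _ (by fun_prop)]
  have hI : ∫⁻ s in Ioc 0 h, ENNReal.ofReal ((s / h) ^ (n - 1)) = ENNReal.ofReal (h / n) := by
    rw [← ofReal_integral_eq_lintegral_ofReal]
    · congr 1
      rw [← intervalIntegral.integral_of_le hh.le]
      have : ∀ s : ℝ, (s / h) ^ (n - 1) = s ^ (n - 1) * (h⁻¹) ^ (n - 1) := by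
        intro s; rw [div_eq_mul_inv, mul_pow]
      simp_rw [this]
      rw [intervalIntegral.integral_mul_const, integral_pow]
      have hn1 : n - 1 + 1 = n := by omega
      have hn2 : ((n - 1 : ℕ) : ℝ) + 1 = n := by exact_mod_cast hn1
      have hn0 : (n : ℝ) ≠ 0 := by positivity
      rw [hn1, hn2, zero_pow (by omega), sub_zero]
      have : h ^ n = h ^ (n - 1) * h := by rw [← pow_succ, hn1]
      rw [this, inv_pow]; field_simp
    · have hc : Continuous fun s : ℝ => (s / h) ^ (n - 1) := by fun_prop
      exact (hc.integrableOn_Icc (a := 0) (b := h)).mono_set Ioc_subset_Icc_self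
    · refine (ae_restrict_iff' measurableSet_Ioc).2 (Eventually.of_forall fun s hs => ?_)
      have := hs.1
      show 0 ≤ _
      positivity
  have hve : ‖v‖ₑ = 1 := by rw [← ofReal_norm, hv, ENNReal.ofReal_one]
  rw [hI, hve, one_mul, ← mul_assoc]
  congr 1
  rw [← ENNReal.ofReal_natCast, ← ENNReal.ofReal_mul (by positivity)]
  congr 1
  have hn0 : (n : ℝ) ≠ 0 := by positivity
  field_simp

/-- boundary points with a normal close to `v` -/
def Bn (K : Set (Eu n)) (v : Eu n) (δ : ℝ) : Set (Eu n) :=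
  {x | x ∈ frontier K ∧ ∃ u, Nr K x u ∧ ‖u - v‖ ≤ δ}

lemma Bd.Bn_closed (hK : Bd K) (v : Eu n) (δ : ℝ) : IsClosed (Bn K v δ) := by
  have hf : IsCompact (frontier K) :=
    hK.cpt.of_isClosed_subset isClosed_frontier hK.cpt.isClosed.frontier_subset
  have hc : IsCompact ((frontier K ×ˢ sphere (0 : Eu n) 1) ∩
      {p : Eu n × Eu n | ‖p.2 - v‖ ≤ δ ∧ ⟪p.1, p.2⟫ = suppFun K p.2 * gauge K p.1}) := by
    refine (hf.prod (isCompact_sphere _ _)).inter_right ?_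
    have c1 : IsClosed {p : Eu n × Eu n | ‖p.2 - v‖ ≤ δ} :=
      isClosed_le (by fun_prop) (by fun_prop)
    have c2 : IsClosed {p : Eu n × Eu n | ⟪p.1, p.2⟫ = suppFun K p.2 * gauge K p.1} :=
      isClosed_eq (by fun_prop)
        ((hK.supp_cont.comp continuous_snd).mul (hK.g_cont.comp continuous_fst))
    exact c1.inter c2
  have := (hc.image continuous_fst).isClosed
  convert this using 1
  ext x
  constructor
  · rintro ⟨hx, u, hu, hd⟩
    exact ⟨(x, u), ⟨⟨hx, by simpa using hu.1⟩, hd, hu.2⟩, rfl⟩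
  · rintro ⟨⟨x', u⟩, ⟨⟨hx, h1⟩, hd, h2⟩, rfl⟩
    exact ⟨hx, u, ⟨by simpa using h1, h2⟩, hd⟩

lemma Bd.loc_geom (hK : Bd K) {v : Eu n} (hv : ‖v‖ = 1) {l : ℝ} (hl : 1 < l) :
    ∃ δ > 0, (∀ x ∈ Bn K v δ, ∀ y ∈ Bn K v δ,
        ‖(suppFun K v / ⟪x, v⟫) • x - (suppFun K v / ⟪y, v⟫) • y‖ ≤ l * ‖x - y‖ ∧
        ‖x - y‖ ≤ l * ‖(suppFun K v / ⟪x, v⟫) • x - (suppFun K v / ⟪y, v⟫) • y‖) ∧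
      (∀ x ∈ Bn K v δ, 0 < ⟪x, v⟫ ∧ ⟪x, v⟫ ≤ l * suppFun K v ∧ suppFun K v ≤ l * ⟪x, v⟫) ∧
      (∀ u, ‖u - v‖ ≤ δ → suppFun K u ≤ l * suppFun K v ∧ suppFun K v ≤ l * suppFun K u) := by
  have hv0 : v ≠ 0 := by rintro rfl; simp at hv
  have hh := hK.supp_pos hv0
  set h := suppFun K v with hhd
  obtain ⟨R, hR0, hR⟩ := hK.exists_bound
  set m := min (1/2) (1 - l⁻¹) with hm
  have hl0 : 0 < l := by linarith
  have hli : l⁻¹ < 1 := inv_lt_one_of_one_lt₀ hl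
  have hm0 : 0 < m := lt_min (by norm_num) (by linarith)
  have hm1 : m ≤ 1 / 2 := min_le_left _ _
  have hm2 : m ≤ 1 - l⁻¹ := min_le_right _ _
  have hm3 : 1 ≤ l * (1 - m) := by
    have : l * l⁻¹ ≤ l * (1 - m) := mul_le_mul_of_nonneg_left (by linarith) hl0.le
    rwa [mul_inv_cancel₀ hl0.ne'] at this
  have hm4 : 1 + m ≤ l := by nlinarith
  set δ := h * m / (8 * R) with hδ
  have hδ0 : 0 < δ := by positivity
  have hδR : 8 * (R * δ) = h * m := by rw [hδ]; field_simp
  have hsupp : ∀ u, ‖u - v‖ ≤ δ → |suppFun K u - h| ≤ R * δ := by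
    intro u hu
    have a1 := hK.supp_lip hR u v
    have a2 := hK.supp_lip hR v u
    rw [norm_sub_rev v u] at a2
    have a3 : R * ‖u - v‖ ≤ R * δ := by gcongr
    rw [abs_le]; constructor <;> linarith
  have hin : ∀ x ∈ Bn K v δ, |⟪x, v⟫ - h| ≤ 2 * (R * δ) := by
    rintro x ⟨hx, u, hu, hd⟩
    have hxK : x ∈ K := hK.g_le_one.1 (hK.g_eq_one.2 hx).le
    have e := ((hK.nr_front hx).1 hu).2
    have h1 : ⟪x, v⟫ - h = (suppFun K u - h) - ⟪x, u - v⟫ := by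
      rw [inner_sub_right, e]; ring
    have h2 : |⟪x, u - v⟫| ≤ R * δ :=
      (abs_real_inner_le_norm _ _).trans (mul_le_mul (hR x hxK) hd (norm_nonneg _) hR0.le)
    rw [h1]
    refine (abs_sub _ _).trans ?_
    linarith [hsupp u hd]
  have hhalf : ∀ x ∈ Bn K v δ, h / 2 ≤ ⟪x, v⟫ := by
    intro x hx
    have := (abs_le.1 (hin x hx)).1
    nlinarith
  have hdiff : ∀ x ∈ Bn K v δ, ∀ y ∈ Bn K v δ, ⟪y - x, v⟫ ≤ δ * ‖x - y‖ := by
    rintro x ⟨hx, u, hu, hd⟩ y ⟨hy, -⟩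
    have hyK : y ∈ K := hK.g_le_one.1 (hK.g_eq_one.2 hy).le
    have e := ((hK.nr_front hx).1 hu).2
    have h1 : ⟪y - x, v⟫ = (⟪y, u⟫ - suppFun K u) - ⟪y - x, u - v⟫ := by
      rw [inner_sub_right, inner_sub_left y x u, e]; ring
    have h2 : |⟪y - x, u - v⟫| ≤ δ * ‖x - y‖ := by
      refine (abs_real_inner_le_norm _ _).trans ?_
      rw [norm_sub_rev y x, mul_comm]
      gcongr
    have h3 := hK.le_supp hyK u
    have := (abs_le.1 h2).1
    linarith
  refine ⟨δ, hδ0, ?_, ?_, ?_⟩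
  · intro x hx y hy
    have hx1 := hhalf x hx
    have hy1 := hhalf y hy
    have hx2 := hin x hx
    set α := ⟪x, v⟫ with hα
    set β := ⟪y, v⟫ with hβ
    have hα0 : 0 < α := by linarith
    have hβ0 : 0 < β := by linarith
    have hyK : y ∈ K := hK.g_le_one.1 (hK.g_eq_one.2 hy.1).le
    have hαβ : |α - β| ≤ δ * ‖x - y‖ := by
      have a1 := hdiff x hx y hy
      have a2 := hdiff y hy x hx
      rw [inner_sub_left] at a1 a2
      rw [norm_sub_rev y x] at a2
      rw [abs_le]; constructor <;> linarith
    have ha : |h / α - 1| ≤ m / 2 := by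
      have : h / α - 1 = -(α - h) / α := by field_simp; ring
      rw [this, abs_div, abs_neg, abs_of_pos hα0, div_le_iff₀ hα0]
      nlinarith
    have hab : |h / α - h / β| * R ≤ m / 2 * ‖x - y‖ := by
      have : h / α - h / β = h * (-(α - β)) / (α * β) := by field_simp; ring
      rw [this, abs_div, abs_mul, abs_neg, abs_of_pos hh, abs_of_pos (mul_pos hα0 hβ0),
        div_mul_eq_mul_div, div_le_iff₀ (mul_pos hα0 hβ0)]
      have hq : h ^ 2 / 4 ≤ α * β := by nlinarith
      calc h * |α - β| * R ≤ h * (δ * ‖x - y‖) * R := by gcongr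
        _ = h * ‖x - y‖ * (8 * (R * δ)) / 8 := by ring
        _ = m / 2 * ‖x - y‖ * (h ^ 2 / 4) := by rw [hδR]; ring
        _ ≤ _ := by gcongr
    have hv1 : (h / α) • x - (h / β) • y - (x - y) = (h / α - 1) • (x - y) + (h / α - h / β) • y := by
      module
    have hnorm : ‖(h / α) • x - (h / β) • y - (x - y)‖ ≤ m * ‖x - y‖ := by
      rw [hv1]
      refine (norm_add_le _ _).trans ?_
      rw [norm_smul, norm_smul, Real.norm_eq_abs, Real.norm_eq_abs]
      have b1 : |h / α - 1| * ‖x - y‖ ≤ m / 2 * ‖x - y‖ := by gcongr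
      have b2 : |h / α - h / β| * ‖y‖ ≤ |h / α - h / β| * R :=
        mul_le_mul_of_nonneg_left (hR y hyK) (abs_nonneg _)
      linarith
    set P := (h / α) • x - (h / β) • y with hP
    have c1 : ‖P‖ ≤ ‖P - (x - y)‖ + ‖x - y‖ := by
      have := norm_add_le (P - (x - y)) (x - y)
      rwa [sub_add_cancel] at this
    have c2 : ‖x - y‖ ≤ ‖P - (x - y)‖ + ‖P‖ := by
      have := norm_sub_le P (P - (x - y))
      rw [sub_sub_cancel] at this; linarith
    have hnn := norm_nonneg (x - y)
    have hPn := norm_nonneg P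
    constructor
    · nlinarith
    · have c3 : (1 - m) * ‖x - y‖ ≤ ‖P‖ := by linarith
      have c4 : l * ((1 - m) * ‖x - y‖) ≤ l * ‖P‖ := mul_le_mul_of_nonneg_left c3 hl0.le
      nlinarith
  · intro x hx
    have hx1 := hhalf x hx
    have hx2 := abs_le.1 (hin x hx)
    refine ⟨by linarith, ?_, ?_⟩
    · nlinarith
    · have : h * (1 - m) ≤ ⟪x, v⟫ := by nlinarith
      nlinarith [mul_le_mul_of_nonneg_left this hl0.le]
  · intro u hu
    have hx2 := abs_le.1 (hsupp u hu)
    constructor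
    · nlinarith
    · have : h * (1 - m) ≤ suppFun K u := by nlinarith
      nlinarith [mul_le_mul_of_nonneg_left this hl0.le]

end part9

section part10

open InnerProductSpace
open scoped MeasureTheory.Measure

variable {n : ℕ}

variable {K L : Set (Eu n)}

lemma lip_HE {p : Eu n → Eu n} {l : ℝ≥0} {A : Set (Eu n)} (h : LipschitzOnWith l p A) :
    HE n (p '' A) ≤ (l : ℝ≥0∞) ^ (n - 1) * HE n A := by
  have h1 := h.hausdorffMeasure_image_le (d := ((n - 1 : ℕ) : ℝ)) (Nat.cast_nonneg _)
  rw [ENNReal.rpow_natCast] at h1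
  rw [HE, Measure.euclideanHausdorffMeasure_def, Measure.smul_apply, Measure.smul_apply,
    mul_smul_comm]
  gcongr

lemma bilip_HE {p : Eu n → Eu n} {l : ℝ≥0} {A : Set (Eu n)}
    (h : ∀ x ∈ A, ∀ y ∈ A, ‖p x - p y‖ ≤ l * ‖x - y‖ ∧ ‖x - y‖ ≤ l * ‖p x - p y‖) :
    HE n (p '' A) ≤ (l : ℝ≥0∞) ^ (n - 1) * HE n A ∧
    HE n A ≤ (l : ℝ≥0∞) ^ (n - 1) * HE n (p '' A) := by
  constructor
  · refine lip_HE (LipschitzOnWith.of_dist_le_mul fun x hx y hy => ?_)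
    rw [dist_eq_norm, dist_eq_norm]; exact (h x hx y hy).1
  · have hinj : InjOn p A := by
      intro x hx y hy hxy
      have := (h x hx y hy).2
      rw [hxy, sub_self, norm_zero, mul_zero] at this
      exact sub_eq_zero.1 (norm_le_zero_iff.1 this)
    have hl : LipschitzOnWith l (Function.invFunOn p A) (p '' A) := by
      refine LipschitzOnWith.of_dist_le_mul ?_
      rintro _ ⟨x, hx, rfl⟩ _ ⟨y, hy, rfl⟩
      rw [hinj.leftInvOn_invFunOn hx, hinj.leftInvOn_invFunOn hy, dist_eq_norm, dist_eq_norm]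
      exact (h x hx y hy).2
    have := lip_HE hl
    rwa [hinj.leftInvOn_invFunOn.image_image] at this

lemma vol_scale {l : ℝ≥0} (hl : 0 < l) {A B : Set (Eu n)}
    (h : ∀ x ∈ A, (l : ℝ)⁻¹ • x ∈ B) : volume A ≤ (l : ℝ≥0∞) ^ n * volume B := by
  have hl' : (0:ℝ) < l := hl
  have : A ⊆ (l : ℝ) • B := by
    intro x hx
    rw [mem_smul_set_iff_inv_smul_mem₀ hl'.ne']
    exact h x hx
  refine (measure_mono this).trans ?_
  rw [Measure.addHaar_smul, finrank_euclideanSpace_fin, abs_of_nonneg (by positivity),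
    ENNReal.ofReal_pow hl'.le, ENNReal.ofReal_coe_nnreal]

/-- the cone measure weighted by the gradient -/
def WW (K : Set (Eu n)) : Measure (Eu n) :=
  Measure.map (tT K) ((volume.restrict K).withDensity
    (fun x => ENNReal.ofReal (n * ‖gG K x‖)))

lemma Bd.WW_apply (hK : Bd K) {E : Set (Eu n)} (hE : MeasurableSet E) :
    WW K E = ∫⁻ x in {x | x ∈ K ∧ tT K x ∈ E}, ENNReal.ofReal (n * ‖gG K x‖) := by
  have hm := hK.tT_meas hE
  rw [WW, Measure.map_apply hK.tT_meas hE, withDensity_apply _ hm, Measure.restrict_restrict hm,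
    inter_comm]
  rfl

lemma Bd.front_ne (hK : Bd K) {x : Eu n} (hx : x ∈ frontier K) : x ≠ 0 := by
  rintro rfl
  have := hK.g_eq_one.2 hx
  simp at this

lemma Bd.local_cmp (hn : 1 ≤ n) (hK : Bd K) {v : Eu n} (hv : ‖v‖ = 1) {l : ℝ≥0} (hl : 1 < l) :
    ∃ δ > 0, ∀ E ⊆ Bn K v δ, MeasurableSet E →
      WW K E ≤ (l : ℝ≥0∞) ^ (2 * n) * HE n E ∧ HE n E ≤ (l : ℝ≥0∞) ^ (2 * n) * WW K E := by
  obtain ⟨δ, hδ, hg1, hg2, hg3⟩ := hK.loc_geom hv (l := l) (by exact_mod_cast hl)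
  refine ⟨δ, hδ, fun E hEB hE => ?_⟩
  have hv0 : v ≠ 0 := by rintro rfl; simp at hv
  have hh := hK.supp_pos hv0
  set h := suppFun K v with hhd
  have hl0 : 0 < l := one_pos.trans hl
  have hl0' : (0:ℝ) < l := hl0
  set p : Eu n → Eu n := fun x => (h / ⟪x, v⟫) • x with hp
  set F := {x : Eu n | ⟪x, v⟫ = h ∧ tT K x ∈ E} with hF
  set CF := {x : Eu n | 0 < ⟪x, v⟫ ∧ ⟪x, v⟫ ≤ h ∧ tT K x ∈ E} with hCF
  set CE := {x : Eu n | x ∈ K ∧ tT K x ∈ E} with hCE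
  have hCEm : MeasurableSet CE := hK.cpt.measurableSet.inter (hK.tT_meas hE)
  have hne : ∀ x, tT K x ∈ E → x ≠ 0 := by
    rintro x hx rfl
    rw [tT_zero] at hx
    exact hK.front_ne (hEB hx).1 rfl
  have hin : ∀ x, tT K x ∈ E → ⟪x, v⟫ = gauge K x * ⟪tT K x, v⟫ := by
    intro x hx
    conv_lhs => rw [hK.tT_eq (hne x hx), real_inner_smul_left]
  have hFE : F = p '' E := by
    ext x
    constructor
    · rintro ⟨h1, h2⟩
      refine ⟨tT K x, h2, ?_⟩
      have hg := hK.g_pos (hne x h2)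
      have e := hin x h2
      have hb := (hg2 _ (hEB h2)).1
      simp only [hp]
      have : h / ⟪tT K x, v⟫ = gauge K x := by
        rw [← h1, e]; field_simp
      rw [this, ← hK.tT_eq (hne x h2)]
    · rintro ⟨y, hy, rfl⟩
      have hb := (hg2 _ (hEB hy)).1
      have ha : 0 < h / ⟪y, v⟫ := by positivity
      refine ⟨?_, ?_⟩
      · simp only [hp]; rw [real_inner_smul_left]; field_simp
      · simp only [hp]; rw [tT_smul ha, tT, hK.g_eq_one.2 (hEB hy).1, inv_one, one_smul]; exact hy
  obtain ⟨c1, c2⟩ := bilip_HE (p := p) (l := l) (A := E)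
    (fun x hx y hy => hg1 x (hEB hx) y (hEB hy))
  rw [← hFE] at c1 c2
  have d1 : volume CE ≤ (l : ℝ≥0∞) ^ n * volume CF := by
    refine vol_scale hl0 fun x hx => ?_
    have hb := hg2 _ (hEB hx.2)
    have hg := hK.g_pos (hne x hx.2)
    have hg' := hK.g_le_one.2 hx.1
    have e := hin x hx.2
    refine ⟨?_, ?_, ?_⟩
    · rw [real_inner_smul_left, e]; have := hb.1; positivity
    · rw [real_inner_smul_left, e, inv_mul_le_iff₀ hl0']
      have := mul_le_mul_of_nonneg_right hg' hb.1.le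
      linarith [hb.2.1]
    · rw [tT_smul (inv_pos.2 hl0')]; exact hx.2
  have d2 : volume CF ≤ (l : ℝ≥0∞) ^ n * volume CE := by
    refine vol_scale hl0 fun x hx => ?_
    obtain ⟨hx1, hx2, hx3⟩ := hx
    have hb := hg2 _ (hEB hx3)
    have hg := hK.g_pos (hne x hx3)
    have e := hin x hx3
    refine ⟨?_, ?_⟩
    · rw [← hK.g_le_one, g_smul (by positivity), inv_mul_le_iff₀ hl0', mul_one]
      have h1 : gauge K x * ⟪tT K x, v⟫ ≤ l * ⟪tT K x, v⟫ := by
        rw [← e]; exact hx2.trans hb.2.2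
      exact le_of_mul_le_mul_right h1 hb.1
    · rw [tT_smul (inv_pos.2 hl0')]; exact hx3
  have hpy := pyramid hn hK hv hh hE
  rw [← hCF, ← hF] at hpy
  -- density bounds
  have hae : ∀ᵐ x ∂(volume.restrict CE), ‖gG K x‖ ≤ l * h⁻¹ ∧ h⁻¹ ≤ l * ‖gG K x‖ := by
    refine (ae_restrict_iff' hCEm).2 ?_
    filter_upwards [hK.ae_diff] with x hx hxC
    obtain ⟨-, u, hu, hd⟩ := hEB hxC.2
    have hg := hK.g_pos (hne x hxC.2)
    have hu' : Nr K x u := (nr_smul (inv_pos.2 hg)).1 hu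
    have hu0 : u ≠ 0 := by rintro rfl; simpa using hu.1
    have hp := hK.supp_pos hu0
    rw [(hK.gG_norm hx hu').1]
    obtain ⟨a1, a2⟩ := hg3 u hd
    constructor
    · rw [inv_eq_one_div, div_le_iff₀ hp, ← div_eq_mul_inv, div_mul_eq_mul_div, le_div_iff₀ hh]
      linarith
    · rw [inv_eq_one_div, div_le_iff₀ hh, ← div_eq_mul_inv, div_mul_eq_mul_div, le_div_iff₀ hp]
      linarith
  have hW := hK.WW_apply hE
  rw [← hCE] at hW
  have hhi : ENNReal.ofReal h⁻¹ * ENNReal.ofReal h = 1 := by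
    rw [← ENNReal.ofReal_mul (by positivity), inv_mul_cancel₀ hh.ne', ENNReal.ofReal_one]
  have w1 : WW K E ≤ l * ENNReal.ofReal h⁻¹ * (n * volume CE) := by
    rw [hW]
    calc _ ≤ ∫⁻ x in CE, (l * ENNReal.ofReal h⁻¹ * n) := by
          refine lintegral_mono_ae ?_
          filter_upwards [hae] with x hx
          rw [← ENNReal.ofReal_coe_nnreal, ← ENNReal.ofReal_mul hl0'.le, ← ENNReal.ofReal_natCast,
            ← ENNReal.ofReal_mul (by positivity)]
          refine ENNReal.ofReal_le_ofReal ?_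
          rw [mul_comm]
          exact mul_le_mul_of_nonneg_right hx.1 (Nat.cast_nonneg n)
      _ = _ := by rw [setLIntegral_const]; ring
  have w2 : ENNReal.ofReal h⁻¹ * (n * volume CE) ≤ l * WW K E := by
    rw [hW, ← lintegral_const_mul' _ _ (by simp)]
    calc _ = ∫⁻ x in CE, (ENNReal.ofReal h⁻¹ * n) := by rw [setLIntegral_const]; ring
      _ ≤ _ := by
          refine lintegral_mono_ae ?_
          filter_upwards [hae] with x hx
          rw [← ENNReal.ofReal_coe_nnreal, ← ENNReal.ofReal_mul hl0'.le, ← ENNReal.ofReal_natCast,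
            ← ENNReal.ofReal_mul (by positivity)]
          refine ENNReal.ofReal_le_ofReal ?_
          nlinarith [mul_le_mul_of_nonneg_right hx.2 (Nat.cast_nonneg (α := ℝ) n)]
  have hpw : (l : ℝ≥0∞) ^ (2 * n) = l * l ^ n * l ^ (n - 1) := by
    rw [← pow_succ', ← pow_add]; congr 1; omega
  constructor
  · calc WW K E ≤ l * ENNReal.ofReal h⁻¹ * (n * volume CE) := w1
      _ ≤ l * ENNReal.ofReal h⁻¹ * (n * (l ^ n * volume CF)) := by gcongr
      _ = l * ENNReal.ofReal h⁻¹ * l ^ n * (n * volume CF) := by ring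
      _ = l * l ^ n * (ENNReal.ofReal h⁻¹ * ENNReal.ofReal h) * HE n F := by rw [hpy]; ring
      _ = l * l ^ n * HE n F := by rw [hhi, mul_one]
      _ ≤ l * l ^ n * (l ^ (n - 1) * HE n E) := by gcongr
      _ = _ := by rw [hpw]; ring
  · calc HE n E ≤ l ^ (n - 1) * HE n F := c2
      _ = l ^ (n - 1) * ((ENNReal.ofReal h⁻¹ * ENNReal.ofReal h) * HE n F) := by rw [hhi, one_mul]
      _ = l ^ (n - 1) * (ENNReal.ofReal h⁻¹ * (n * volume CF)) := by rw [hpy, mul_assoc]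
      _ ≤ l ^ (n - 1) * (ENNReal.ofReal h⁻¹ * (n * (l ^ n * volume CE))) := by gcongr
      _ = l ^ (n - 1) * l ^ n * (ENNReal.ofReal h⁻¹ * (n * volume CE)) := by ring
      _ ≤ l ^ (n - 1) * l ^ n * (l * WW K E) := by gcongr
      _ = _ := by rw [hpw]; ring

lemma Bd.global_cmp (hn : 1 ≤ n) (hK : Bd K) {l : ℝ≥0} (hl : 1 < l) {E : Set (Eu n)}
    (hEf : E ⊆ frontier K) (hE : MeasurableSet E) :
    WW K E ≤ (l : ℝ≥0∞) ^ (2 * n) * HE n E ∧ HE n E ≤ (l : ℝ≥0∞) ^ (2 * n) * WW K E := by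
  have hloc : ∀ v : Eu n, v ∈ sphere (0 : Eu n) 1 → ∃ δ > 0, ∀ E ⊆ Bn K v δ, MeasurableSet E →
      WW K E ≤ (l : ℝ≥0∞) ^ (2 * n) * HE n E ∧ HE n E ≤ (l : ℝ≥0∞) ^ (2 * n) * WW K E :=
    fun v hv => hK.local_cmp hn (by simpa using hv) hl
  choose! δ hδ hc using hloc
  obtain ⟨t, ht, hcov⟩ := (isCompact_sphere (0 : Eu n) 1).elim_nhds_subcover (fun v => ball v (δ v))
    (fun v hv => ball_mem_nhds v (hδ v hv))
  have key : ∀ s : Finset (Eu n), (∀ v ∈ s, v ∈ sphere (0 : Eu n) 1) → ∀ E : Set (Eu n),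
      MeasurableSet E → (∀ x ∈ E, ∃ v ∈ s, x ∈ Bn K v (δ v)) →
      WW K E ≤ (l : ℝ≥0∞) ^ (2 * n) * HE n E ∧ HE n E ≤ (l : ℝ≥0∞) ^ (2 * n) * WW K E := by
    classical
    intro s
    induction s using Finset.induction_on with
    | empty =>
      intro _ E _ h
      have : E = ∅ := by
        ext x; constructor
        · intro hx; obtain ⟨v, hv, -⟩ := h x hx; simp at hv
        · simp
      simp [this]
    | insert a s _ ih =>
      intro hs E hE h
      have hB : MeasurableSet (Bn K a (δ a)) := (hK.Bn_closed a (δ a)).measurableSet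
      obtain ⟨p1, p2⟩ := hc a (hs a (Finset.mem_insert_self a s)) (E ∩ Bn K a (δ a))
        inter_subset_right (hE.inter hB)
      obtain ⟨q1, q2⟩ := ih (fun v hv => hs v (Finset.mem_insert_of_mem hv)) (E \ Bn K a (δ a))
        (hE.diff hB) (by
          rintro x ⟨hx, hx'⟩
          obtain ⟨v, hv, hxv⟩ := h x hx
          rcases Finset.mem_insert.1 hv with rfl | hv
          · exact absurd hxv hx'
          · exact ⟨v, hv, hxv⟩)
      rw [← measure_inter_add_sdiff E hB, ← measure_inter_add_sdiff (μ := HE n) E hB, mul_add, mul_add]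
      exact ⟨add_le_add p1 q1, add_le_add p2 q2⟩
  refine key t ht E hE fun x hx => ?_
  obtain ⟨u, hu⟩ := hK.exists_nr (hK.front_ne (hEf hx))
  have hus : u ∈ sphere (0 : Eu n) 1 := by simpa using hu.1
  obtain ⟨v, hv, huv⟩ := mem_iUnion₂.1 (hcov hus)
  refine ⟨v, hv, hEf hx, u, hu, ?_⟩
  rw [mem_ball, dist_eq_norm] at huv
  exact huv.le

lemma le_of_forall_pow {a b : ℝ≥0∞} {k : ℕ} (h : ∀ l : ℝ≥0, 1 < l → a ≤ (l : ℝ≥0∞) ^ k * b) :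
    a ≤ b := by
  have ht : Tendsto (fun l : ℝ≥0 => (l : ℝ≥0∞) ^ k * b) (𝓝[>] 1) (𝓝 ((1 : ℝ≥0∞) ^ k * b)) := by
    refine ENNReal.Tendsto.mul_const ?_ (Or.inl (by simp))
    refine ENNReal.Tendsto.pow ?_
    have : Tendsto (fun l : ℝ≥0 => (l : ℝ≥0∞)) (𝓝 1) (𝓝 ((1 : ℝ≥0) : ℝ≥0∞)) :=
      ENNReal.continuous_coe.tendsto 1
    exact this.mono_left nhdsWithin_le_nhds
  rw [one_pow, one_mul] at ht
  haveI : (𝓝[>] (1 : ℝ≥0)).NeBot := nhdsGT_neBot 1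
  exact ge_of_tendsto ht (eventually_nhdsWithin_of_forall fun l hl => h l hl)

lemma Bd.HE_eq (hn : 1 ≤ n) (hK : Bd K) {E : Set (Eu n)} (hEf : E ⊆ frontier K)
    (hE : MeasurableSet E) : HE n E = WW K E :=
  le_antisymm (le_of_forall_pow fun _ hl => (hK.global_cmp hn hl hEf hE).2)
    (le_of_forall_pow fun _ hl => (hK.global_cmp hn hl hEf hE).1)

lemma Bd.HE_restrict (hn : 1 ≤ n) (hK : Bd K) {E : Set (Eu n)} (hEf : E ⊆ frontier K)
    (hE : MeasurableSet E) : (HE n).restrict E = (WW K).restrict E := by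
  ext A hA
  rw [Measure.restrict_apply hA, Measure.restrict_apply hA]
  exact hK.HE_eq hn (inter_subset_right.trans hEf) (hA.inter hE)

end part10

section part11

open InnerProductSpace
open scoped MeasureTheory.Measure

variable {n : ℕ}

variable {K L : Set (Eu n)}

/-- The Gauss map, as the normalized gradient of the gauge. -/
def nuG (K : Set (Eu n)) (x : Eu n) : Eu n := ‖gG K x‖⁻¹ • gG K x

lemma nuG_meas : Measurable (nuG K) := (gG_meas.norm.inv).smul gG_meas

/-- density of the Gaussian cone measure. -/
def dK (K : Set (Eu n)) (x : Eu n) : ℝ := n * gd n (tT K x) * ‖gG K x‖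

lemma dK_nonneg (x : Eu n) : 0 ≤ dK K x := by
  have := gd_pos (tT K x)
  unfold dK; positivity

lemma Bd.gd_tT_meas (hK : Bd K) : Measurable fun x => gd n (tT K x) :=
  continuous_gd.measurable.comp hK.tT_meas

lemma Bd.dK_meas (hK : Bd K) : Measurable (dK K) :=
  (hK.gd_tT_meas.const_mul _).mul gG_meas.norm

lemma Bd.dK_int (hK : Bd K) : IntegrableOn (dK K) K := by
  obtain ⟨r, h0, hr⟩ := hK.exists_ball
  refine IntegrableOn.of_bound (C := n * (Real.sqrt (2 * Real.pi))⁻¹ ^ n * r⁻¹)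
    hK.cpt.measure_lt_top hK.dK_meas.aestronglyMeasurable (Eventually.of_forall fun x => ?_)
  rw [Real.norm_of_nonneg (dK_nonneg x)]
  unfold dK
  have h1 := hK.gG_bound h0 hr x
  have h2 : gd n (tT K x) ≤ (Real.sqrt (2 * Real.pi))⁻¹ ^ n := by
    unfold gd
    refine mul_le_of_le_one_right (by positivity) (Real.exp_le_one_iff.2 ?_)
    have : 0 ≤ ‖tT K x‖ ^ 2 := by positivity
    linarith
  gcongr

/-- the Gaussian cone measure -/
def mK (K : Set (Eu n)) : Measure (Eu n) :=
  (volume.restrict K).withDensity (fun x => ENNReal.ofReal (dK K x))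

lemma Bd.mK_fin (hK : Bd K) : IsFiniteMeasure (mK K) :=
  isFiniteMeasure_withDensity_ofReal hK.dK_int.2

lemma ae_ne_zero (hn : 1 ≤ n) : ∀ᵐ x : Eu n, x ≠ 0 := by
  haveI : Nonempty (Fin n) := ⟨⟨0, hn⟩⟩
  haveI : Nontrivial (Eu n) := inferInstance
  have : (volume : Measure (Eu n)) {0} = 0 := measure_singleton 0
  exact measure_eq_zero_iff_ae_notMem.1 this

/-- differentiability points -/
def DD (K : Set (Eu n)) : Set (Eu n) := {x | DifferentiableAt ℝ (gauge K) x}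

lemma Bd.DD_meas (hK : Bd K) : MeasurableSet (DD K) :=
  measurableSet_of_differentiableAt ℝ (gauge K)

lemma Bd.HE_null (hn : 1 ≤ n) (hK : Bd K) : HE n (frontier K \ DD K) = 0 := by
  have hm : MeasurableSet (frontier K \ DD K) := isClosed_frontier.measurableSet.diff hK.DD_meas
  rw [hK.HE_eq hn sdiff_subset hm, hK.WW_apply hm]
  have : volume {x | x ∈ K ∧ tT K x ∈ frontier K \ DD K} = 0 := by
    have h : ∀ᵐ x : Eu n, x ∉ {x | x ∈ K ∧ tT K x ∈ frontier K \ DD K} := by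
      filter_upwards [hK.ae_diff, ae_ne_zero hn] with x hx h0 h
      exact h.2.2 ((hK.diff_tT h0).2 hx)
    exact measure_eq_zero_iff_ae_notMem.2 h
  exact setLIntegral_measure_zero _ _ this

lemma HE_factor (n : ℕ) (hn : 1 ≤ n) : ∃ c : ℝ≥0, c ≠ 0 ∧ 
    HE n = c • (μH[(n : ℝ) - 1] : Measure (Eu n)) := by
  have e : (n : ℝ) - 1 = ((n - 1 : ℕ) : ℝ) := by push_cast [Nat.cast_sub hn]; ring
  rw [e]
  exact ⟨_, Measure.addHaarScalarFactor_volume_hausdorffMeasure_ne_zero _, Measure.euclideanHausdorffMeasure_def _⟩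

lemma Bd.surf_ae (hn : 1 ≤ n) (hK : Bd K) {η : Set (Eu n)} (hη : η ⊆ sphere 0 1) :
    ({x | x ∈ frontier K ∧ ∃ v ∈ η, ⟪x, v⟫ = suppFun K v} : Set (Eu n))
      =ᵐ[HE n] (frontier K ∩ nuG K ⁻¹' η : Set (Eu n)) := by
  have h := measure_eq_zero_iff_ae_notMem.1 (hK.HE_null hn)
  filter_upwards [h] with x hx
  refine propext ?_
  change (x ∈ frontier K ∧ ∃ v ∈ η, ⟪x, v⟫ = suppFun K v) ↔ (x ∈ frontier K ∧ nuG K x ∈ η)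
  refine and_congr_right fun hf => ?_
  have hd : DifferentiableAt ℝ (gauge K) x := by
    by_contra h; exact hx ⟨hf, h⟩
  constructor
  · rintro ⟨v, hv, he⟩
    have h1 : ‖v‖ = 1 := by simpa using hη hv
    have := (hK.gG_norm hd ((hK.nr_front hf).2 ⟨h1, he⟩)).2
    rw [nuG, ← this]; exact hv
  · intro hv
    obtain ⟨u, hu⟩ := hK.exists_nr (hK.front_ne hf)
    have := (hK.gG_norm hd hu).2
    exact ⟨nuG K x, hv, by rw [nuG, ← this]; exact ((hK.nr_front hf).1 hu).2⟩

lemma Bd.HE_lint (hn : 1 ≤ n) (hK : Bd K) {η : Set (Eu n)} (hη : MeasurableSet η) :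
    ∫⁻ x in frontier K ∩ nuG K ⁻¹' η, ENNReal.ofReal (gd n x) ∂(HE n) = mK K (nuG K ⁻¹' η) := by
  have hE : MeasurableSet (frontier K ∩ nuG K ⁻¹' η) :=
    isClosed_frontier.measurableSet.inter (nuG_meas hη)
  have hg : Measurable fun x : Eu n => ENNReal.ofReal (gd n x) :=
    continuous_gd.measurable.ennreal_ofReal
  have hd : Measurable fun x : Eu n => ENNReal.ofReal (n * ‖gG K x‖) :=
    (gG_meas.norm.const_mul _).ennreal_ofReal
  have hgt : Measurable fun x : Eu n => ENNReal.ofReal (gd n (tT K x)) := hg.comp hK.tT_meas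
  rw [hK.HE_restrict hn inter_subset_left hE, WW, setLIntegral_map hE hg hK.tT_meas,
    restrict_withDensity (hK.tT_meas hE),
    lintegral_withDensity_eq_lintegral_mul _ hd hgt, mK,
    withDensity_apply _ (nuG_meas hη)]
  have hs : (tT K ⁻¹' (frontier K ∩ nuG K ⁻¹' η) : Set (Eu n)) =ᵐ[volume.restrict K]
      (nuG K ⁻¹' η : Set (Eu n)) := by
    filter_upwards [ae_restrict_of_ae (ae_ne_zero hn)] with x h0
    refine propext ?_
    change (tT K x ∈ frontier K ∧ nuG K (tT K x) ∈ η) ↔ nuG K x ∈ η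
    rw [nuG, hK.gG_tT h0, ← nuG]
    exact and_iff_right (hK.g_eq_one.1 (hK.g_tT h0))
  rw [Measure.restrict_congr_set hs]
  refine lintegral_congr fun x => ?_
  have := (gd_pos (tT K x)).le
  simp only [Pi.mul_apply]
  rw [← ENNReal.ofReal_mul (by positivity), dK]
  congr 1; ring

lemma surf_eq (n : ℕ) (hn : 1 ≤ n) : ∃ c : ℝ≥0, c ≠ 0 ∧ ∀ K : Set (Eu n), Bd K →
    ∀ η ⊆ sphere (0 : Eu n) 1, MeasurableSet η →
      c * gaussSurf n K η = (mK K (nuG K ⁻¹' η)).toReal := by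
  obtain ⟨c, hc, he⟩ := HE_factor n hn
  refine ⟨c, hc, fun K hK η hη hm => ?_⟩
  have h1 := hK.surf_ae hn hη
  have h2 : gaussSurf n K η = ∫ x in {x | x ∈ frontier K ∧ ∃ v ∈ η, ⟪x, v⟫ = suppFun K v},
      gd n x ∂μH[(n : ℝ) - 1] := by
    unfold gaussSurf gd
    rw [integral_const_mul]
  have h3 : (c : ℝ) * gaussSurf n K η =
      ∫ x in {x | x ∈ frontier K ∧ ∃ v ∈ η, ⟪x, v⟫ = suppFun K v}, gd n x ∂(HE n) := by
    rw [h2, he, Measure.restrict_smul, integral_smul_nnreal_measure]; rfl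
  rw [h3, Measure.restrict_congr_set h1, ← hK.HE_lint hn hm,
    integral_eq_lintegral_of_nonneg_ae (Eventually.of_forall fun x => (gd_pos x).le)
      continuous_gd.aestronglyMeasurable]

lemma Bd.nuG_sphere (hn : 1 ≤ n) (hK : Bd K) : mK K (nuG K ⁻¹' (sphere 0 1)ᶜ) = 0 := by
  refine measure_eq_zero_iff_ae_notMem.2 ?_
  refine (withDensity_absolutelyContinuous _ _).ae_le ?_
  filter_upwards [ae_restrict_of_ae (ae_ne_zero hn), ae_restrict_of_ae hK.ae_diff] with x h0 hd h
  obtain ⟨u, hu⟩ := hK.exists_nr h0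
  have := (hK.gG_norm hd hu).2
  refine h ?_
  rw [nuG, ← this]; simpa using hu.1

lemma map_eq (hn : 1 ≤ n) (hK : Bd K) (hL : Bd L)
    (heq : ∀ η ⊆ sphere (0 : Eu n) 1, MeasurableSet η → gaussSurf n K η = gaussSurf n L η) :
    (mK K).map (nuG K) = (mK L).map (nuG L) := by
  obtain ⟨c, hc, h⟩ := surf_eq n hn
  haveI := hK.mK_fin
  haveI := hL.mK_fin
  have key : ∀ M : Set (Eu n), Bd M → ∀ A, MeasurableSet A →
      (mK M).map (nuG M) A = mK M (nuG M ⁻¹' (A ∩ sphere 0 1)) := by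
    intro M hM A hA
    rw [Measure.map_apply nuG_meas hA]
    refine le_antisymm ?_ (measure_mono (preimage_mono inter_subset_left))
    calc mK M (nuG M ⁻¹' A) ≤ mK M (nuG M ⁻¹' (A ∩ sphere 0 1) ∪ nuG M ⁻¹' (sphere 0 1)ᶜ) := by
          refine measure_mono fun x hx => ?_
          by_cases hs : nuG M x ∈ sphere (0 : Eu n) 1
          · exact Or.inl ⟨hx, hs⟩
          · exact Or.inr hs
      _ ≤ _ := measure_union_le _ _
      _ = _ := by rw [hM.nuG_sphere hn, add_zero]
  ext A hA
  have hm : MeasurableSet (A ∩ sphere (0 : Eu n) 1) := hA.inter isClosed_sphere.measurableSet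
  rw [key K hK A hA, key L hL A hA]
  refine (ENNReal.toReal_eq_toReal_iff' (measure_ne_top _ _) (measure_ne_top _ _)).1 ?_
  rw [← h K hK _ inter_subset_right hm, ← h L hL _ inter_subset_right hm,
    heq _ inter_subset_right hm]

lemma Bd.dV_eq (hK : Bd K) (hL : Bd L) : dV K L =
    ∫ u, (suppFun L u - suppFun K u) ∂((mK K).map (nuG K)) := by
  have hc : Continuous fun u : Eu n => suppFun L u - suppFun K u := hL.supp_cont.sub hK.supp_cont
  rw [integral_map nuG_meas.aemeasurable hc.aestronglyMeasurable, mK,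
    integral_withDensity_eq_integral_toReal_smul hK.dK_meas.ennreal_ofReal
      (Eventually.of_forall fun x => ENNReal.ofReal_lt_top), dV]
  refine integral_congr_ae (Eventually.of_forall fun x => ?_)
  simp only []
  have h1 : ∀ M : Set (Eu n), Bd M → suppFun M (gG K x) = ‖gG K x‖ * suppFun M (nuG K x) := by
    intro M hM
    rw [← hM.supp_smul (norm_nonneg _), nuG, smul_smul]
    by_cases h : gG K x = 0
    · simp [h]
    · rw [mul_inv_cancel₀ (norm_ne_zero_iff.2 h), one_smul]
  rw [ENNReal.toReal_ofReal (dK_nonneg x), qf, h1 L hL, h1 K hK, dK, smul_eq_mul]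
  ring

lemma dV_add (hn : 1 ≤ n) (hK : Bd K) (hL : Bd L)
    (heq : ∀ η ⊆ sphere (0 : Eu n) 1, MeasurableSet η → gaussSurf n K η = gaussSurf n L η) :
    dV K L + dV L K = 0 := by
  rw [hK.dV_eq hL, hL.dV_eq hK, map_eq hn hK hL heq]
  have : ∀ u : Eu n, suppFun K u - suppFun L u = -(suppFun L u - suppFun K u) := fun u => by ring
  simp_rw [this]
  rw [integral_neg, ← sub_eq_add_neg]
  simp only [neg_sub, this, sub_self]
  

lemma Bd.conc_dV (hn : 1 ≤ n) (hK : Bd K) (hL : Bd L)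
    (h1 : 1 / 2 ≤ (gam n).real K) (h2 : 1 / 2 ≤ (gam n).real (mcomb (1 / 2) K L)) :
    2 * ((gam n).real (mcomb (1 / 2) K L) - (gam n).real K) ≤ dV K L := by
  refine hK.first_var hn hL (t₀ := 1 / 2) (by norm_num) fun t ht ht2 => ?_
  have hcM : IsCompact (mcomb (1 / 2) K L) := mcomb_compact _ hK.cpt hL.cpt
  have hc := (gauss_conc (u := 1 - 2 * t) (v := 2 * t) hn hK.cpt hcM
    (mcomb_compact t hK.cpt hL.cpt).isClosed hK.conv (mcomb_convex _ hK.conv hL.conv)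
    (mcomb_convex t hK.conv hL.conv) (by linarith) (by linarith) (by ring) ?_ h1 h2).1
  · linarith
  · rintro x hx y ⟨_, ⟨a, ha, rfl⟩, _, ⟨b, hb, rfl⟩, rfl⟩
    have ht1 : 0 < 1 - t := by linarith
    have hz : ((1 - 2 * t) / (1 - t)) • x + (t / (1 - t)) • a ∈ K :=
      hK.conv hx ha (div_nonneg (by linarith) ht1.le) (by positivity) (by field_simp; ring)
    have := mcomb_mem (t := t) hz hb
    convert this using 1
    simp only [smul_add, smul_smul]
    rw [mul_div_cancel₀ _ ht1.ne', mul_div_cancel₀ _ ht1.ne', ← add_assoc]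
    norm_num
    congr 3 <;> ring

end part11

/-- The Gaussian Minkowski problem has a unique solution among convex bodies of
Gaussian volume at least `1/2`. -/
theorem gaussian_minkowski_uniqueness
    (n : ℕ) (hn : 2 ≤ n) (K L : Set (Eu n))
    (hK : IsConvexBody K) (hL : IsConvexBody L)
    (hK0 : (0 : Eu n) ∈ interior K) (hL0 : (0 : Eu n) ∈ interior L)
    (heq : ∀ η ⊆ sphere (0 : Eu n) 1, MeasurableSet η → gaussSurf n K η = gaussSurf n L η)
    (hKvol : 1 / 2 ≤ gaussVol n K) (hLvol : 1 / 2 ≤ gaussVol n L) :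
    K = L := by
  have hn1 : 1 ≤ n := by omega
  have bK : Bd K := ⟨hK.1, hK.2.1, hK0⟩
  have bL : Bd L := ⟨hL.1, hL.2.1, hL0⟩
  rw [gaussVol_eq hK.2.1.measurableSet] at hKvol
  rw [gaussVol_eq hL.2.1.measurableSet] at hLvol
  by_contra hne
  have hs := strict_conc hn1 hK hL hKvol hLvol hne
  have e : mcomb (1 / 2) L K = mcomb (1 / 2) K L := by
    unfold mcomb; rw [add_comm]; norm_num
  have hM : 1 / 2 ≤ (gam n).real (mcomb (1 / 2) K L) := by linarith
  have a1 := bK.conc_dV hn1 bL hKvol hM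
  have a2 := bL.conc_dV hn1 bK hLvol (by rw [e]; exact hM)
  rw [e] at a2
  have a3 := dV_add hn1 bK bL heq
  linarith
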